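/- Let n∈ℕ, p∈(1,∞), s∈((p−1)/p, 1), q>1 and let Ω⊆ℝⁿ be a bounded open set. Let u:ℝⁿ→ℝ be a local weak solution of (−Δ_p)^s u = f in Ω with f∈L^{pq/(p−1)}_loc(Ω), and assume in addition that u is continuously differentiable on Ω. Then there exists a constant c = c(n,p,s,q) such that for every ball B_{2R}(x_o) whose closure is contained in Ω one has (⨍_{B_R(x_o)} |∇u|^{pq} dx)^{1/q} ≤ c ⨍_{B_{2R}(x_o)} |∇u|^p dx + c R^{−(1−s)p} (⨍_{B_{2R}(x_o)} |R^s f|^{pq/(p−1)} dx)^{1/q} + c R^{−p} Tail(u−(u)_{B_{2R}(x_o)}; B_{2R}(x_o))^p. -/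

import Mathlib

open MeasureTheory Metric Set
open scoped ENNReal

noncomputable section

/-- Double Gagliardo integral `∬_{D×D} |u(x)-u(y)|^p / |x-y|^{n+sp} dx dy` in `ℝ≥0∞`. -/
def gagliardoE (n : ℕ) (s p : ℝ) (D : Set (EuclideanSpace ℝ (Fin n)))
    (u : EuclideanSpace ℝ (Fin n) → ℝ) : ℝ≥0∞ :=
  ∫⁻ x in D, ∫⁻ y in D, ENNReal.ofReal (|u x - u y| ^ p / dist x y ^ ((n : ℝ) + s * p))

/-- Nonlocal tail `Tail(u; B_R(x₀))` in `ℝ≥0∞`. -/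
def tailE (n : ℕ) (s p : ℝ) (u : EuclideanSpace ℝ (Fin n) → ℝ)
    (x₀ : EuclideanSpace ℝ (Fin n)) (R : ℝ) : ℝ≥0∞ :=
  (ENNReal.ofReal (R ^ (s * p)) *
      ∫⁻ x in (ball x₀ R)ᶜ,
        ENNReal.ofReal (|u x| ^ (p - 1) / dist x x₀ ^ ((n : ℝ) + s * p))) ^ (1 / (p - 1))

/-- `f ∈ L^q_loc(D)`. -/
def MemLploc (n : ℕ) (q : ℝ) (D : Set (EuclideanSpace ℝ (Fin n)))
    (f : EuclideanSpace ℝ (Fin n) → ℝ) : Prop :=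
  Measurable f ∧
    ∀ K : Set (EuclideanSpace ℝ (Fin n)), K ⊆ D → IsCompact K →
      (∫⁻ x in K, ENNReal.ofReal (|f x| ^ q)) < ⊤

/-- `u` is a local weak solution of `(-Δ_p)^s u = f` in `D`. -/
def IsLocalWeakSolution (n : ℕ) (p s : ℝ) (D : Set (EuclideanSpace ℝ (Fin n)))
    (f u : EuclideanSpace ℝ (Fin n) → ℝ) : Prop :=
  Measurable u ∧
  (∀ K : Set (EuclideanSpace ℝ (Fin n)), K ⊆ D → IsCompact K →
      (∫⁻ x in K, ENNReal.ofReal (|u x| ^ p)) < ⊤ ∧ gagliardoE n s p K u < ⊤) ∧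
  (∫⁻ x, ENNReal.ofReal (|u x| ^ (p - 1) / (1 + ‖x‖) ^ ((n : ℝ) + s * p))) < ⊤ ∧
  ∀ φ : EuclideanSpace ℝ (Fin n) → ℝ, Measurable φ →
    (∃ K : Set (EuclideanSpace ℝ (Fin n)), IsCompact K ∧ K ⊆ D ∧
      ∀ᵐ x, x ∉ K → φ x = 0) →
    (∫⁻ x, ENNReal.ofReal (|φ x| ^ p)) < ⊤ →
    gagliardoE n s p Set.univ φ < ⊤ →
    (∫ x, ∫ y,
        |u x - u y| ^ (p - 2) * (u x - u y) * (φ x - φ y) / dist x y ^ ((n : ℝ) + s * p)) =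
      ∫ x in D, f x * φ x


/-- The odd power `|t|^(p-2) t`. -/
def Jp (p t : ℝ) : ℝ := |t| ^ (p - 2) * t

theorem abs_Jp {p : ℝ} (hp : 1 < p) (t : ℝ) : |Jp p t| = |t| ^ (p - 1) := by
  unfold Jp
  rw [abs_mul, abs_of_nonneg (Real.rpow_nonneg (abs_nonneg t) _)]
  rcases eq_or_ne t 0 with rfl | ht
  · simp; rw [Real.zero_rpow (by linarith)]
  · have h : 0 < |t| := abs_pos.mpr ht
    rw [← Real.rpow_add_one h.ne']; congr 1; ring

theorem Jp_neg (p t : ℝ) : Jp p (-t) = - Jp p t := by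
  unfold Jp; rw [abs_neg]; ring

theorem Jp_of_nonneg {p : ℝ} (hp : 1 < p) {t : ℝ} (ht : 0 ≤ t) : Jp p t = t ^ (p - 1) := by
  have h := abs_Jp hp t
  rw [abs_of_nonneg ht] at h
  rw [← h, abs_of_nonneg]
  unfold Jp; positivity

theorem Jp_of_nonpos {p : ℝ} (hp : 1 < p) {t : ℝ} (ht : t ≤ 0) : Jp p t = -(-t) ^ (p - 1) := by
  rw [← Jp_of_nonneg hp (by linarith : 0 ≤ -t), Jp_neg]; ring

theorem measurable_Jp (p : ℝ) : Measurable (Jp p) := by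
  unfold Jp; fun_prop

theorem Jp_zero (p : ℝ) : Jp p 0 = 0 := by simp [Jp]

/-- reduce two-point inequality for `Jp` to three sign cases -/
theorem Jp_cases {Q : ℝ → ℝ → Prop} (hneg : ∀ a b, Q a b → Q (-b) (-a))
    (h1 : ∀ a b, 0 ≤ b → b ≤ a → Q a b) (h2 : ∀ a b, 0 ≤ a → b ≤ 0 → Q a b)
    (a b : ℝ) (hab : b ≤ a) : Q a b := by
  rcases le_total 0 b with hb | hb
  · exact h1 a b hb hab
  · rcases le_total 0 a with ha | ha
    · exact h2 a b ha hb
    · have := hneg _ _ (h1 (-b) (-a) (by linarith) (by linarith))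
      simpa using this

theorem Jp_lower_big {p : ℝ} (hp : 2 ≤ p) (a b : ℝ) (hab : b ≤ a) :
    ((a - b) / 2) ^ (p - 1) ≤ Jp p a - Jp p b := by
  have hp1 : 1 < p := by linarith
  refine Jp_cases (Q := fun a b => ((a - b) / 2) ^ (p - 1) ≤ Jp p a - Jp p b) ?_ ?_ ?_ a b hab
  · intro a b h
    rw [Jp_neg, Jp_neg]
    convert h using 1
    · congr 1; ring
    · ring
  · intro a b hb hab
    rw [Jp_of_nonneg hp1 hb, Jp_of_nonneg hp1 (hb.trans hab)]
    have h := Real.add_rpow_le_rpow_add (p := p - 1) (sub_nonneg.2 hab) hb (by linarith)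
    rw [sub_add_cancel] at h
    have : ((a - b) / 2) ^ (p - 1) ≤ (a - b) ^ (p - 1) := by
      apply Real.rpow_le_rpow <;> linarith
    linarith
  · intro a b ha hb
    rw [Jp_of_nonneg hp1 ha, Jp_of_nonpos hp1 hb]
    have hb' : 0 ≤ -b := by linarith
    have h1 := Real.rpow_nonneg ha (p - 1)
    have h2 := Real.rpow_nonneg hb' (p - 1)
    rcases le_total a (-b) with h | h
    · have : ((a - b) / 2) ^ (p - 1) ≤ (-b) ^ (p - 1) := by
        apply Real.rpow_le_rpow <;> linarith
      linarith
    · have : ((a - b) / 2) ^ (p - 1) ≤ (a) ^ (p - 1) := by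
        apply Real.rpow_le_rpow <;> linarith
      linarith

theorem Jp_lower_small {p : ℝ} (hp1 : 1 < p) (hp : p < 2) (a b : ℝ) (hab : b ≤ a) :
    (p - 1) * (a - b) ≤ (Jp p a - Jp p b) * (|a| + |b|) ^ (2 - p) := by
  refine Jp_cases (Q := fun a b => (p - 1) * (a - b) ≤ (Jp p a - Jp p b) * (|a| + |b|) ^ (2 - p))
    ?_ ?_ ?_ a b hab
  · intro a b h
    rw [Jp_neg, Jp_neg, abs_neg, abs_neg]
    convert h using 1
    · ring
    · rw [add_comm |a|]; ring
  · intro a b hb hab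
    have ha := hb.trans hab
    rw [Jp_of_nonneg hp1 hb, Jp_of_nonneg hp1 ha, abs_of_nonneg ha, abs_of_nonneg hb]
    rcases ha.eq_or_lt with h0 | h0
    · have : b = 0 := by linarith
      subst this; simp [← h0]
    · have h := rpow_one_add_le_one_add_mul_self (s := b / a - 1) (p := p - 1)
        (by have := div_nonneg hb ha; linarith) (by linarith) (by linarith)
      rw [add_sub_cancel, Real.div_rpow hb ha] at h
      have hpow : 0 < a ^ (p - 1) := Real.rpow_pos_of_pos h0 _
      rw [div_le_iff₀ hpow] at h
      have e1 : (1 + (p - 1) * (b / a - 1)) * a ^ (p-1)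
          = a ^ (p-1) - (p-1) * (a - b) * a ^ (p-2) := by
        have : a ^ (p - 1) = a ^ (p - 2) * a := by
          rw [← Real.rpow_add_one h0.ne']; congr 1; ring
        rw [this]; field_simp; ring
      rw [e1] at h
      have h3 : (p-1) * (a-b) * a ^ (p-2) ≤ a^(p-1) - b^(p-1) := by linarith
      have h4 : a ^ (2 - p) ≤ (a + b) ^ (2-p) := by
        apply Real.rpow_le_rpow <;> linarith
      have h5 : a ^ (p - 2) * a ^ (2-p) = 1 := by
        rw [← Real.rpow_add h0]; simp
      have h6 : 0 ≤ (p-1) * (a-b) * a ^ (p-2) :=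
        mul_nonneg (mul_nonneg (by linarith) (by linarith)) (by positivity)
      calc (p-1)*(a-b) = (p-1) * (a-b) * a ^ (p-2) * a ^ (2-p) := by
            rw [mul_assoc ((p-1)*(a-b)), h5, mul_one]
        _ ≤ _ := mul_le_mul h3 h4 (by positivity) (h6.trans h3)
  · intro a b ha hb
    rw [Jp_of_nonneg hp1 ha, Jp_of_nonpos hp1 hb, abs_of_nonneg ha, abs_of_nonpos hb]
    have hb' : 0 ≤ -b := by linarith
    have h := Real.rpow_add_le_add_rpow (p := p - 1) ha hb' (by linarith) (by linarith)
    have h0 : 0 ≤ a + -b := by linarith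
    rcases h0.eq_or_lt with h1 | h1
    · have : a = 0 := by linarith
      have : b = 0 := by linarith
      subst_vars; simp; 
      rw [Real.zero_rpow (by linarith)]; simp
    · have h5 : (a + -b) ^ (p - 1) * (a + -b) ^ (2-p) = a - b := by
        rw [← Real.rpow_add h1]; ring_nf; simp [sub_eq_add_neg]
      have : (a + -b) ^ (p - 1) * (a + -b) ^ (2-p) ≤ (a ^ (p-1) - -(-b)^(p-1)) * (a + -b) ^ (2-p) := by
        apply mul_le_mul_of_nonneg_right _ (by positivity)
        linarith
      rw [h5] at this
      refine le_trans ?_ this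
      nlinarith

theorem Jp_lip {p : ℝ} (hp : 2 ≤ p) {M a b : ℝ} (ha : |a| ≤ M) (hb : |b| ≤ M) :
    |Jp p a - Jp p b| ≤ (p - 1) * M ^ (p - 2) * |a - b| := by
  have hp1 : 1 < p := by linarith
  have key : ∀ a b : ℝ, b ≤ a → |a| ≤ M → |b| ≤ M →
      |Jp p a - Jp p b| ≤ (p - 1) * M ^ (p - 2) * |a - b| := by
    intro a b hab
    refine Jp_cases (Q := fun a b => |a| ≤ M → |b| ≤ M →
      |Jp p a - Jp p b| ≤ (p - 1) * M ^ (p - 2) * |a - b|) ?_ ?_ ?_ a b hab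
    · intro a b h h1 h2
      rw [abs_neg] at h1 h2
      have := h h2 h1
      rw [Jp_neg, Jp_neg]
      convert this using 2
      · ring_nf
      · ring_nf
    · intro a b hb hab h1 h2
      have ha := hb.trans hab
      rw [Jp_of_nonneg hp1 hb, Jp_of_nonneg hp1 ha]
      rw [abs_of_nonneg ha] at h1
      rw [abs_of_nonneg (sub_nonneg.2 hab), abs_of_nonneg
        (sub_nonneg.2 (Real.rpow_le_rpow hb hab (by linarith)))]
      rcases ha.eq_or_lt with h0 | h0
      · have : b = 0 := by linarith
        subst this; simp [← h0]
      · have h := one_add_mul_self_le_rpow_one_add (s := b / a - 1) (p := p - 1)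
          (by have := div_nonneg hb ha; linarith) (by linarith)
        rw [add_sub_cancel, Real.div_rpow hb ha] at h
        have hpow : 0 < a ^ (p - 1) := Real.rpow_pos_of_pos h0 _
        rw [le_div_iff₀ hpow] at h
        have e1 : (1 + (p - 1) * (b / a - 1)) * a ^ (p-1)
            = a ^ (p-1) - (p-1) * (a - b) * a ^ (p-2) := by
          have : a ^ (p - 1) = a ^ (p - 2) * a := by
            rw [← Real.rpow_add_one h0.ne']; congr 1; ring
          rw [this]; field_simp; ring
        rw [e1] at h
        have h3 : a^(p-1) - b^(p-1) ≤ (p-1) * (a-b) * a ^ (p-2) := by linarith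
        have h4 : a ^ (p-2) ≤ M ^ (p-2) := by
          apply Real.rpow_le_rpow <;> linarith
        have : (p-1) * (a-b) * a ^ (p-2) ≤ (p-1) * (a-b) * M ^ (p-2) := by
          apply mul_le_mul_of_nonneg_left h4
          exact mul_nonneg (by linarith) (by linarith)
        linarith
    · intro a b ha hb h1 h2
      rw [Jp_of_nonneg hp1 ha, Jp_of_nonpos hp1 hb]
      rw [abs_of_nonneg ha] at h1
      rw [abs_of_nonpos hb] at h2
      have hb' : 0 ≤ -b := by linarith
      have hM : 0 ≤ M := by linarith
      have aux : ∀ t : ℝ, 0 ≤ t → t ≤ M → t ^ (p-1) ≤ M ^ (p-2) * t := by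
        intro t ht htM
        rcases ht.eq_or_lt with h0 | h0
        · rw [← h0, Real.zero_rpow (by linarith)]; simp
        · have : t ^ (p - 1) = t ^ (p - 2) * t := by
            rw [← Real.rpow_add_one h0.ne']; congr 1; ring
          rw [this]
          apply mul_le_mul_of_nonneg_right _ ht
          apply Real.rpow_le_rpow <;> linarith
      have h3 := aux a ha h1
      have h4 := aux (-b) hb' h2
      have h5 := Real.rpow_nonneg ha (p-1)
      have h6 := Real.rpow_nonneg hb' (p-1)
      rw [abs_of_nonneg (by linarith), abs_of_nonneg (by linarith)]
      have h7 : 0 ≤ M ^ (p-2) * (a - b) := mul_nonneg (by positivity) (by linarith)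
      nlinarith
  rcases le_total b a with h | h
  · exact key a b h ha hb
  · have := key b a h hb ha
    rwa [abs_sub_comm, abs_sub_comm a b]

theorem Jp_mono {p : ℝ} (hp : 1 < p) {a b : ℝ} (hab : b ≤ a) : Jp p b ≤ Jp p a := by
  refine Jp_cases (Q := fun a b => Jp p b ≤ Jp p a) ?_ ?_ ?_ a b hab
  · intro a b h; rw [Jp_neg, Jp_neg]; linarith
  · intro a b hb hab
    rw [Jp_of_nonneg hp hb, Jp_of_nonneg hp (hb.trans hab)]
    exact Real.rpow_le_rpow hb hab (by linarith)
  · intro a b ha hb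
    rw [Jp_of_nonneg hp ha, Jp_of_nonpos hp hb]
    have := Real.rpow_nonneg ha (p-1)
    have := Real.rpow_nonneg (neg_nonneg.2 hb) (p-1)
    linarith

theorem Jp_prod_nonneg {p β : ℝ} (hp : 1 < p) (hβ : 1 ≤ β) (a b s t : ℝ) (h : a - b = s - t) :
    0 ≤ (Jp p a - Jp p b) * (Jp (β + 1) s - Jp (β + 1) t) := by
  rcases le_total b a with hab | hab
  · have := Jp_mono hp hab
    have := Jp_mono (p := β + 1) (by linarith) (by linarith : t ≤ s)
    exact mul_nonneg (by linarith) (by linarith)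
  · have := Jp_mono hp hab
    have := Jp_mono (p := β + 1) (by linarith) (by linarith : s ≤ t)
    exact mul_nonneg_of_nonpos_of_nonpos (by linarith) (by linarith)

/-- The main pointwise inequality. -/
theorem Jp_key {p β : ℝ} (hp : 1 < p) (hβ : 1 ≤ β) :
    ∃ C τ : ℝ, 0 < C ∧ 0 < τ ∧ ∀ l a b s t : ℝ, 1 ≤ l → a - b = s - t →
      |a - b| ^ (p + β - 1) ≤ C * l * ((Jp p a - Jp p b) * (Jp (β + 1) s - Jp (β + 1) t))
        + l ^ (-τ) * (|a| + |b|) ^ (p + β - 1) := by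
  -- it suffices to treat `b ≤ a`
  suffices H : ∃ C τ : ℝ, 0 < C ∧ 0 < τ ∧ ∀ l a b s t : ℝ, 1 ≤ l → a - b = s - t → b ≤ a →
      |a - b| ^ (p + β - 1) ≤ C * l * ((Jp p a - Jp p b) * (Jp (β + 1) s - Jp (β + 1) t))
        + l ^ (-τ) * (|a| + |b|) ^ (p + β - 1) by
    obtain ⟨C, τ, hC, hτ, H⟩ := H
    refine ⟨C, τ, hC, hτ, fun l a b s t hl h => ?_⟩
    rcases le_total b a with hab | hab
    · exact H l a b s t hl h hab
    · have := H l b a t s hl (by linarith) hab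
      rw [abs_sub_comm, add_comm |a|]
      convert this using 2
      ring
  have hg : ∀ s t : ℝ, t ≤ s → ((s - t) / 2) ^ β ≤ Jp (β + 1) s - Jp (β + 1) t := by
    intro s t hst
    have := Jp_lower_big (p := β + 1) (by linarith) s t hst
    simpa using this
  rcases le_or_gt 2 p with hp2 | hp2
  · refine ⟨2 ^ (p + β - 1), 1, by positivity, one_pos, ?_⟩
    intro l a b s t hl h hab
    have h1 := Jp_lower_big hp2 a b hab
    have h2 := hg s t (by linarith)
    rw [← h] at h2
    have hx : 0 ≤ a - b := by linarith
    have h3 : ((a - b) / 2) ^ (p-1) * ((a-b)/2) ^ β ≤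
      (Jp p a - Jp p b) * (Jp (β + 1) s - Jp (β + 1) t) :=
      mul_le_mul h1 h2 (by positivity) (le_trans (by positivity) h1)
    rw [← Real.rpow_add_of_nonneg (by positivity) (by linarith) (by linarith)] at h3
    have e : (a - b) ^ (p + β - 1) = 2 ^ (p + β - 1) * ((a-b)/2) ^ (p - 1 + β) := by
      rw [Real.div_rpow hx (by norm_num)]
      have : p - 1 + β = p + β - 1 := by ring
      rw [this]; field_simp
    rw [abs_of_nonneg hx, e]
    set X := (Jp p a - Jp p b) * (Jp (β + 1) s - Jp (β + 1) t)
    have hX : 0 ≤ X := le_trans (by positivity) h3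
    have h4 : 2 ^ (p + β - 1) * ((a-b)/2) ^ (p - 1 + β) ≤ 2 ^ (p + β - 1) * X :=
      mul_le_mul_of_nonneg_left h3 (by positivity)
    have h5 : 2 ^ (p + β - 1) * X ≤ 2 ^ (p + β - 1) * l * X := by
      apply mul_le_mul_of_nonneg_right _ hX
      have : (0:ℝ) < 2 ^ (p + β - 1) := by positivity
      nlinarith
    have h6 : 0 ≤ l ^ (-(1:ℝ)) * (|a| + |b|) ^ (p + β - 1) := by positivity
    linarith
  · refine ⟨2 ^ β / (p - 1), (p + β - 1) / (2 - p), ?_, ?_, ?_⟩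
    · have : 0 < p - 1 := by linarith
      positivity
    · apply div_pos <;> linarith
    intro l a b s t hl h hab
    have h1 := Jp_lower_small hp hp2 a b hab
    have h2 := hg s t (by linarith)
    rw [← h] at h2
    have hx : 0 ≤ a - b := by linarith
    have hl0 : 0 < l := by linarith
    set X := (Jp p a - Jp p b) * (Jp (β + 1) s - Jp (β + 1) t) with hXdef
    have hX : 0 ≤ X := Jp_prod_nonneg hp hβ a b s t h
    set S := |a| + |b| with hS
    have hS0 : 0 ≤ S := by positivity
    have hxS : a - b ≤ S := by
      have := le_abs_self a
      have := neg_abs_le b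
      linarith
    have h3 : (p-1) * (a-b) * ((a-b)/2)^β ≤ X * S ^ (2-p) := by
      have := mul_le_mul h1 h2 (by positivity) (le_trans (mul_nonneg (by linarith) hx) h1)
      calc _ ≤ _ := this
        _ = _ := by rw [hXdef]; ring
    rw [abs_of_nonneg hx]
    have hp1 : 0 < p - 1 := by linarith
    have h2p : 0 < 2 - p := by linarith
    rcases hx.eq_or_lt with h0 | h0
    · rw [← h0, Real.zero_rpow (by linarith)]
      positivity
    have hSp : 0 < S := lt_of_lt_of_le h0 hxS
    by_cases hc : S ^ (2 - p) ≤ l * (a - b) ^ (2 - p)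
    · -- first term dominates
      have h4 : (p-1) * (a-b) * ((a-b)/2)^β ≤ X * (l * (a - b) ^ (2 - p)) :=
        h3.trans (mul_le_mul_of_nonneg_left hc hX)
      have e : (a - b) ^ (p + β - 1) * (a - b) ^ (2 - p) = 2 ^ β * ((a-b) * ((a-b)/2)^β) := by
        rw [Real.div_rpow hx (by norm_num), ← Real.rpow_add h0]
        have : p + β - 1 + (2 - p) = β + 1 := by ring
        rw [this, Real.rpow_add_one h0.ne']; field_simp
      have h5 : (a - b) ^ (p + β - 1) * (a - b) ^ (2 - p) ≤
          (2 ^ β / (p - 1) * l * X) * (a - b) ^ (2 - p) := by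
        rw [e]
        calc 2 ^ β * ((a-b) * ((a-b)/2)^β) = 2 ^ β / (p-1) * ((p-1) * (a-b) * ((a-b)/2)^β) := by
              field_simp
          _ ≤ 2 ^ β / (p-1) * (X * (l * (a - b) ^ (2 - p))) :=
              mul_le_mul_of_nonneg_left h4 (by positivity)
          _ = _ := by ring
      have h6 := le_of_mul_le_mul_right h5 (by positivity)
      have h7 : 0 ≤ l ^ (-((p + β - 1) / (2 - p))) * S ^ (p + β - 1) := by positivity
      linarith
    · push Not at hc
      have h4 : (a - b) ^ (2-p) ≤ l⁻¹ * S ^ (2-p) := by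
        rw [inv_mul_eq_div, le_div_iff₀ hl0]; linarith
      have hmain : (a - b) ^ (p + β - 1) ≤ l ^ (-((p + β - 1) / (2 - p))) * S ^ (p + β - 1) := by
        have h5 := Real.rpow_le_rpow (by positivity) h4
          (by apply div_nonneg <;> linarith : 0 ≤ (p + β - 1) / (2-p))
        rw [← Real.rpow_mul hx, Real.mul_rpow (by positivity) (by positivity),
          ← Real.rpow_mul hS0, Real.inv_rpow hl0.le, ← Real.rpow_neg hl0.le,
          mul_div_cancel₀ _ h2p.ne'] at h5
        exact h5
      have : 0 ≤ 2 ^ β / (p - 1) * l * X := by positivity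
      linarith

/-- trivial Young inequality -/
theorem young_triv {x y a b : ℝ} (hx : 0 ≤ x) (hy : 0 ≤ y) (ha : 0 ≤ a) (hb : 0 ≤ b) :
    x ^ a * y ^ b ≤ x ^ (a + b) + y ^ (a + b) := by
  rcases le_total x y with h | h
  · have h1 : x ^ a * y ^ b ≤ y ^ a * y ^ b :=
      mul_le_mul_of_nonneg_right (Real.rpow_le_rpow hx h ha) (by positivity)
    rw [← Real.rpow_add_of_nonneg hy ha hb] at h1
    have : 0 ≤ x ^ (a + b) := by positivity
    linarith
  · have h1 : x ^ a * y ^ b ≤ x ^ a * x ^ b :=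
      mul_le_mul_of_nonneg_left (Real.rpow_le_rpow hy h hb) (by positivity)
    rw [← Real.rpow_add_of_nonneg hx ha hb] at h1
    have : 0 ≤ y ^ (a + b) := by positivity
    linarith

theorem add_rpow_le_two {x y a : ℝ} (hx : 0 ≤ x) (hy : 0 ≤ y) (ha : 0 ≤ a) :
    (x + y) ^ a ≤ 2 ^ a * (x ^ a + y ^ a) := by
  have hx' := Real.rpow_nonneg hx a
  have hy' := Real.rpow_nonneg hy a
  have h2 : (0:ℝ) ≤ 2 ^ a := by positivity
  rcases le_total x y with h | h
  · calc (x + y) ^ a ≤ (2 * y) ^ a := Real.rpow_le_rpow (by positivity) (by linarith) ha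
      _ = 2 ^ a * y ^ a := Real.mul_rpow (by norm_num) hy
      _ ≤ _ := mul_le_mul_of_nonneg_left (by linarith) h2
  · calc (x + y) ^ a ≤ (2 * x) ^ a := Real.rpow_le_rpow (by positivity) (by linarith) ha
      _ = 2 ^ a * x ^ a := Real.mul_rpow (by norm_num) hx
      _ ≤ _ := mul_le_mul_of_nonneg_left (by linarith) h2

/-- Euclidean space. -/
abbrev Eu (n : ℕ) := EuclideanSpace ℝ (Fin n)

theorem kerLoc (n : ℕ) {γ : ℝ} (hγ : 0 < γ) :
    ∫⁻ k in ball (0 : Eu n) 4, ENNReal.ofReal (‖k‖ ^ (γ - n)) < ⊤ := by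
  rcases Nat.eq_zero_or_pos n with rfl | hn
  · have : ∀ k : Eu 0, ENNReal.ofReal (‖k‖ ^ (γ - (0:ℕ))) = 0 := by
      intro k
      have : k = 0 := Subsingleton.elim _ _
      subst this
      simp [Real.zero_rpow hγ.ne']
    simp only [this]; simp
  · have hd : Module.finrank ℝ (Eu n) = n := finrank_euclideanSpace_fin
    have := integrableOn_ball_of_norm_le_rpow (E := Eu n) (μ := volume)
      (f := fun k : Eu n => ‖k‖ ^ (γ - n)) (C := 1) (α := n - γ) (r := 4)
      (by rw [hd]; exact hn) (by rw [hd]; linarith)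
      (by
        refine Filter.Eventually.of_forall fun k => ?_
        rw [Real.norm_of_nonneg (by positivity)]
        simp)
      (measurable_norm.pow_const _).aestronglyMeasurable
    exact this.setLIntegral_lt_top

theorem kerFar (n : ℕ) {a : ℝ} (ha : (n : ℝ) < a) :
    ∫⁻ y : Eu n, ENNReal.ofReal ((1 + ‖y‖) ^ (-a)) < ⊤ := by
  apply finite_integral_one_add_norm
  rw [finrank_euclideanSpace_fin]; exact ha

theorem jensen_lintegral {α : Type*} [MeasurableSpace α] (μ : Measure α) {q : ℝ} (hq : 1 ≤ q)
    {φ : α → ℝ≥0∞} (hφ : AEMeasurable φ μ) :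
    (∫⁻ x, φ x ∂μ) ^ q ≤ μ univ ^ (q - 1) * ∫⁻ x, φ x ^ q ∂μ := by
  rcases hq.eq_or_lt with rfl | hq
  · simp
  · have hc := Real.HolderConjugate.conjExponent hq
    have h := ENNReal.lintegral_mul_le_Lp_mul_Lq μ hc hφ (aemeasurable_const (b := (1:ℝ≥0∞)))
    simp only [Pi.mul_apply, mul_one, ENNReal.one_rpow, lintegral_const, one_mul] at h
    calc (∫⁻ x, φ x ∂μ) ^ q ≤ ((∫⁻ x, φ x ^ q ∂μ) ^ (1 / q) *
          μ univ ^ (1 / q.conjExponent)) ^ q := ENNReal.rpow_le_rpow h (by linarith)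
      _ = _ := by
        rw [ENNReal.mul_rpow_of_nonneg _ _ (by linarith), ← ENNReal.rpow_mul, ← ENNReal.rpow_mul,
          one_div_mul_cancel (by linarith), ENNReal.rpow_one, mul_comm]
        congr 2
        rw [Real.conjExponent]; field_simp

/-- power of the gradient norm -/
def gP {n : ℕ} (u : Eu n → ℝ) (P : ℝ) (x : Eu n) : ℝ≥0∞ := ENNReal.ofReal (‖fderiv ℝ u x‖ ^ P)

theorem measurable_gP {n : ℕ} (u : Eu n → ℝ) (P : ℝ) : Measurable (gP u P) := by
  unfold gP
  have := (measurable_fderiv ℝ u).norm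
  exact (this.pow_const P).ennreal_ofReal

theorem ofReal_abs_rpow (t : ℝ) {P : ℝ} (hP : 0 ≤ P) :
    ENNReal.ofReal (|t| ^ P) = ‖t‖ₑ ^ P := by
  rw [← ENNReal.ofReal_rpow_of_nonneg (abs_nonneg t) hP, ← Real.norm_eq_abs, ofReal_norm]

theorem seg_pointwise {n : ℕ} {u : Eu n → ℝ} {Ω : Set (Eu n)} (hΩ : IsOpen Ω)
    (hu : ContDiffOn ℝ 1 u Ω) {P : ℝ} (hP : 1 ≤ P) (x k : Eu n)
    (hseg : ∀ t ∈ Icc (0:ℝ) 1, x + t • k ∈ Ω) :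
    ENNReal.ofReal (|u (x + k) - u x| ^ P) ≤
      ENNReal.ofReal (‖k‖ ^ P) * ∫⁻ t in Icc (0:ℝ) 1, gP u P (x + t • k) := by
  have hd : ∀ t ∈ Icc (0:ℝ) 1, HasDerivAt (fun t : ℝ => u (x + t • k))
      (fderiv ℝ u (x + t • k) k) t := by
    intro t ht
    have h1 : HasFDerivAt u (fderiv ℝ u (x + t • k)) (x + t • k) :=
      ((hu.differentiableOn (by norm_num)).differentiableAt (hΩ.mem_nhds (hseg t ht))).hasFDerivAt
    have h2 : HasDerivAt (fun t : ℝ => x + t • k) k t := by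
      have := ((hasDerivAt_id t).smul_const k).const_add x
      simpa using this
    exact h1.comp_hasDerivAt t h2
  have hcont : ContinuousOn (fun t : ℝ => fderiv ℝ u (x + t • k) k) (Icc 0 1) := by
    have h1 : ContinuousOn (fderiv ℝ u) Ω := hu.continuousOn_fderiv_of_isOpen hΩ (by norm_num)
    have h2 : ContinuousOn (fun t : ℝ => fderiv ℝ u (x + t • k)) (Icc 0 1) :=
      h1.comp (by fun_prop) hseg
    exact h2.clm_apply continuousOn_const
  have hint : ∫ t in (0:ℝ)..1, fderiv ℝ u (x + t • k) k = u (x + k) - u x := by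
    rw [intervalIntegral.integral_eq_sub_of_hasDerivAt (f := fun t : ℝ => u (x + t • k))]
    · simp
    · rw [uIcc_of_le zero_le_one]; exact hd
    · apply ContinuousOn.intervalIntegrable
      rwa [uIcc_of_le zero_le_one]
  have h1 : ‖u (x + k) - u x‖ₑ ≤ ∫⁻ t in Icc (0:ℝ) 1, ‖k‖ₑ * ‖fderiv ℝ u (x + t • k)‖ₑ := by
    rw [← hint, intervalIntegral.integral_of_le zero_le_one, ← integral_Icc_eq_integral_Ioc]
    refine (enorm_integral_le_lintegral_enorm _).trans ?_
    refine lintegral_mono fun t => ?_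
    rw [mul_comm]
    exact ContinuousLinearMap.le_opENorm _ _
  have hm : Measurable (fun t : ℝ => ‖fderiv ℝ u (x + t • k)‖ₑ) := by
    have h2 : Measurable fun t : ℝ => x + t • k := by fun_prop
    exact ((measurable_fderiv ℝ u).comp h2).enorm
  rw [lintegral_const_mul _ hm] at h1
  have hP0 : 0 ≤ P := by linarith
  have h3 := jensen_lintegral (volume.restrict (Icc (0:ℝ) 1)) hP hm.aemeasurable
  simp only [Measure.restrict_apply_univ, Real.volume_Icc, sub_zero, ENNReal.ofReal_one,
    ENNReal.one_rpow, one_mul] at h3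
  have h4 : ∀ y : Eu n, gP u P y = ‖fderiv ℝ u y‖ₑ ^ P := by
    intro y
    unfold gP
    rw [← ENNReal.ofReal_rpow_of_nonneg (norm_nonneg _) hP0, ofReal_norm]
  rw [ofReal_abs_rpow _ hP0, ← ENNReal.ofReal_rpow_of_nonneg (norm_nonneg _) hP0, ofReal_norm]
  simp only [h4]
  calc _ ≤ (‖k‖ₑ * ∫⁻ t in Icc (0:ℝ) 1, ‖fderiv ℝ u (x + t • k)‖ₑ) ^ P :=
        ENNReal.rpow_le_rpow h1 hP0
    _ = ‖k‖ₑ ^ P * (∫⁻ t in Icc (0:ℝ) 1, ‖fderiv ℝ u (x + t • k)‖ₑ) ^ P :=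
        ENNReal.mul_rpow_of_nonneg _ _ hP0
    _ ≤ _ := by gcongr

open Classical in
theorem seg_integral {n : ℕ} {u : Eu n → ℝ} {Ω B : Set (Eu n)} (hΩ : IsOpen Ω)
    (hu : ContDiffOn ℝ 1 u Ω) (hBΩ : B ⊆ Ω) (hBm : MeasurableSet B) (hBc : Convex ℝ B)
    {P : ℝ} (hP : 1 ≤ P) (k : Eu n) :
    ∫⁻ x, (if x ∈ B ∧ x + k ∈ B then ENNReal.ofReal (|u (x + k) - u x| ^ P) else 0) ≤
      ENNReal.ofReal (‖k‖ ^ P) * ∫⁻ x in B, gP u P x := by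
  have hgm := (measurable_gP u P).indicator hBm
  calc _ ≤ ∫⁻ x, ENNReal.ofReal (‖k‖ ^ P) *
        ∫⁻ t in Icc (0:ℝ) 1, B.indicator (gP u P) (x + t • k) := by
        refine lintegral_mono fun x => ?_
        split_ifs with h
        · have hs : ∀ t ∈ Icc (0:ℝ) 1, x + t • k ∈ B := by
            intro t ht
            exact hBc.add_smul_mem h.1 h.2 ht
          refine (seg_pointwise hΩ hu hP x k (fun t ht => hBΩ (hs t ht))).trans ?_
          refine mul_le_mul' le_rfl ?_
          refine setLIntegral_mono' measurableSet_Icc fun t ht => ?_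
          rw [indicator_of_mem (hs t ht)]
        · exact zero_le
    _ = ENNReal.ofReal (‖k‖ ^ P) *
        ∫⁻ x, ∫⁻ t in Icc (0:ℝ) 1, B.indicator (gP u P) (x + t • k) := by
        rw [lintegral_const_mul]
        apply Measurable.lintegral_prod_right' (f := fun z : Eu n × ℝ => B.indicator (gP u P) (z.1 + z.2 • k))
        exact hgm.comp (by fun_prop)
    _ = ENNReal.ofReal (‖k‖ ^ P) *
        ∫⁻ t in Icc (0:ℝ) 1, ∫⁻ x, B.indicator (gP u P) (x + t • k) := by
        rw [lintegral_lintegral_swap]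
        apply Measurable.aemeasurable
        exact hgm.comp (by fun_prop)
    _ = _ := by
        congr 1
        have : ∀ t : ℝ, ∫⁻ x, B.indicator (gP u P) (x + t • k) = ∫⁻ x in B, gP u P x := by
          intro t
          rw [lintegral_add_right_eq_self (B.indicator (gP u P)), lintegral_indicator hBm]
        simp [this]

open Classical in
theorem pairs_integral {n : ℕ} {u : Eu n → ℝ} {Ω B : Set (Eu n)} (hΩ : IsOpen Ω)
    (hu : ContDiffOn ℝ 1 u Ω) (hum : Measurable u) (hBΩ : B ⊆ Ω) (hBm : MeasurableSet B)
    (hBc : Convex ℝ B) (hB2 : B ⊆ ball 0 2)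
    {P : ℝ} (hP : 1 ≤ P) {κ : Eu n → ℝ≥0∞} (hκ : Measurable κ) :
    ∫⁻ x in B, ∫⁻ y in B, ENNReal.ofReal (|u x - u y| ^ P) * κ (y - x) ≤
      (∫⁻ k in ball (0 : Eu n) 4, κ k * ENNReal.ofReal (‖k‖ ^ P)) * ∫⁻ x in B, gP u P x := by
  have e1 : ∀ x, ∫⁻ y in B, ENNReal.ofReal (|u x - u y| ^ P) * κ (y - x) =
      ∫⁻ k, B.indicator (fun y => ENNReal.ofReal (|u x - u y| ^ P) * κ (y - x)) (x + k) := by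
    intro x
    rw [← lintegral_indicator hBm, lintegral_add_left_eq_self]
  have hm : Measurable (fun z : Eu n × Eu n => if z.1 ∈ B ∧ z.1 + z.2 ∈ B then
      ENNReal.ofReal (|u (z.1 + z.2) - u z.1| ^ P) else 0) := by
    apply Measurable.ite
    · exact (measurable_fst hBm).inter ((measurable_fst.add measurable_snd) hBm)
    · fun_prop
    · fun_prop
  calc _ = ∫⁻ x, ∫⁻ k, κ k * (if x ∈ B ∧ x + k ∈ B then
        ENNReal.ofReal (|u (x + k) - u x| ^ P) else 0) := by
        rw [← lintegral_indicator hBm]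
        refine lintegral_congr fun x => ?_
        by_cases hx : x ∈ B
        · rw [indicator_of_mem hx, e1]
          refine lintegral_congr fun k => ?_
          by_cases hk : x + k ∈ B
          · simp only [indicator_of_mem hk, hx, hk, and_self, if_true]
            rw [mul_comm, abs_sub_comm, add_sub_cancel_left]
          · simp [hk]
        · simp [hx]
    _ = ∫⁻ k, κ k * ∫⁻ x, (if x ∈ B ∧ x + k ∈ B then
        ENNReal.ofReal (|u (x + k) - u x| ^ P) else 0) := by
        rw [lintegral_lintegral_swap]
        · refine lintegral_congr fun k => ?_
          rw [lintegral_const_mul]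
          exact hm.comp (by fun_prop : Measurable fun x : Eu n => (x, k))
        · apply Measurable.aemeasurable
          exact (hκ.comp measurable_snd).mul hm
    _ ≤ ∫⁻ k, (ball (0 : Eu n) 4).indicator (fun k => κ k * ENNReal.ofReal (‖k‖ ^ P)) k
          * ∫⁻ x in B, gP u P x := by
        refine lintegral_mono fun k => ?_
        by_cases hk : k ∈ ball (0 : Eu n) 4
        · rw [indicator_of_mem hk, mul_assoc]
          gcongr
          exact seg_integral hΩ hu hBΩ hBm hBc hP k
        · have : ∀ x, ¬ (x ∈ B ∧ x + k ∈ B) := by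
            rintro x ⟨h1, h2⟩
            apply hk
            have h1 := hB2 h1
            have h2 := hB2 h2
            rw [mem_ball_zero_iff] at *
            have : k = (x + k) - x := by abel
            rw [this]
            exact (norm_sub_le _ _).trans_lt (by linarith)
          simp [this]
    _ = _ := by
        rw [lintegral_mul_const, lintegral_indicator measurableSet_ball]
        exact (hκ.mul (by fun_prop)).indicator measurableSet_ball

theorem ball_vol_pos {n : ℕ} (x : Eu n) {r : ℝ} (hr : 0 < r) : volume (ball x r) ≠ 0 :=
  (measure_ball_pos volume x hr).ne'

theorem ball_vol_fin {n : ℕ} (x : Eu n) (r : ℝ) : volume (ball x r) ≠ ⊤ :=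
  measure_ball_lt_top.ne

/-- Jensen for averages -/
theorem avg_pointwise {α : Type*} [MeasurableSpace α] {μ : Measure α} {B : Set α}
    (hB0 : μ B ≠ 0) (hBt : μ B ≠ ⊤) {u : α → ℝ} (hum : Measurable u)
    (hint : IntegrableOn u B μ) {p : ℝ} (hp : 1 ≤ p) (a : ℝ) :
    ENNReal.ofReal (|a - ⨍ y in B, u y ∂μ| ^ p) ≤
      (μ B)⁻¹ * ∫⁻ y in B, ENNReal.ofReal (|a - u y| ^ p) ∂μ := by
  have hp0 : 0 ≤ p := by linarith
  have h0 : a - ⨍ y in B, u y ∂μ = (μ.real B)⁻¹ * ∫ y in B, (a - u y) ∂μ := by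
    rw [setAverage_eq, integral_sub (integrable_const_iff.2 (Or.inr ⟨by simpa using hBt.lt_top⟩)) hint]
    have : μ.real B ≠ 0 := by
      rw [Measure.real]; exact ENNReal.toReal_ne_zero.2 ⟨hB0, hBt⟩
    simp; field_simp
  have h1 : ‖a - ⨍ y in B, u y ∂μ‖ₑ ≤ (μ B)⁻¹ * ∫⁻ y in B, ‖a - u y‖ₑ ∂μ := by
    rw [h0, enorm_mul]
    gcongr
    · rw [enorm_inv, Measure.real, Real.enorm_of_nonneg ENNReal.toReal_nonneg,
        ENNReal.ofReal_toReal hBt]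
      rw [Measure.real]; exact ENNReal.toReal_ne_zero.2 ⟨hB0, hBt⟩
    · exact enorm_integral_le_lintegral_enorm _
  simp only [ofReal_abs_rpow _ hp0]
  have h2 := jensen_lintegral (μ.restrict B) hp (φ := fun y => ‖a - u y‖ₑ)
    (by fun_prop)
  rw [Measure.restrict_apply_univ] at h2
  calc _ ≤ ((μ B)⁻¹ * ∫⁻ y in B, ‖a - u y‖ₑ ∂μ) ^ p := ENNReal.rpow_le_rpow h1 hp0
    _ = (μ B)⁻¹ ^ p * (∫⁻ y in B, ‖a - u y‖ₑ ∂μ) ^ p := ENNReal.mul_rpow_of_nonneg _ _ hp0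
    _ ≤ (μ B)⁻¹ ^ p * (μ B ^ (p - 1) * ∫⁻ y in B, ‖a - u y‖ₑ ^ p ∂μ) := by gcongr
    _ = _ := by
      rw [← mul_assoc]
      congr 1
      rw [ENNReal.inv_rpow, ← ENNReal.rpow_neg, ← ENNReal.rpow_add _ _ hB0 hBt]
      rw [← ENNReal.rpow_neg_one]; congr 1; ring

theorem poincare (n : ℕ) {p : ℝ} (hp : 1 ≤ p) : ∃ C : ℝ≥0∞, C ≠ ⊤ ∧
    ∀ (u : Eu n → ℝ) (Ω : Set (Eu n)), IsOpen Ω → ContDiffOn ℝ 1 u Ω → Measurable u →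
      closedBall 0 2 ⊆ Ω →
      ∫⁻ x in ball 0 2, ENNReal.ofReal (|u x - ⨍ y in ball 0 2, u y| ^ p) ≤
        C * ∫⁻ x in ball 0 2, gP u p x := by
  refine ⟨(volume (ball (0 : Eu n) 2))⁻¹ * ∫⁻ k in ball (0 : Eu n) 4, 1 * ENNReal.ofReal (‖k‖ ^ p),
    ?_, ?_⟩
  · apply ENNReal.mul_ne_top
    · exact ENNReal.inv_ne_top.2 (ball_vol_pos _ (by norm_num))
    · have h := kerLoc n (γ := n + p) (by positivity)
      simpa using h.ne
  · intro u Ω hΩ hu hum hB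
    have hint : IntegrableOn u (ball (0 : Eu n) 2) := by
      apply IntegrableOn.mono_set _ ball_subset_closedBall
      apply ContinuousOn.integrableOn_compact (isCompact_closedBall _ _)
      exact hu.continuousOn.mono hB
    calc _ ≤ ∫⁻ x in ball (0 : Eu n) 2, (volume (ball (0 : Eu n) 2))⁻¹ *
          ∫⁻ y in ball (0 : Eu n) 2, ENNReal.ofReal (|u x - u y| ^ p) * 1 := by
          refine lintegral_mono fun x => ?_
          have := avg_pointwise (ball_vol_pos (0 : Eu n) (by norm_num : (0:ℝ) < 2))
            (ball_vol_fin (0 : Eu n) 2) hum hint hp (u x)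
          simpa using this
      _ = (volume (ball (0 : Eu n) 2))⁻¹ * ∫⁻ x in ball (0 : Eu n) 2,
          ∫⁻ y in ball (0 : Eu n) 2, ENNReal.ofReal (|u x - u y| ^ p) * 1 := by
          rw [lintegral_const_mul]
          apply Measurable.lintegral_prod_right'
            (f := fun z : Eu n × Eu n => ENNReal.ofReal (|u z.1 - u z.2| ^ p) * 1)
          fun_prop
      _ ≤ _ := by
          rw [mul_assoc]
          gcongr
          exact pairs_integral hΩ hu hum (ball_subset_closedBall.trans hB) measurableSet_ball
            (convex_ball _ _) subset_rfl hp (κ := fun _ => 1) measurable_const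

/-- splitting of a dominating function in a local and two nonlocal pieces -/
def QT {n : ℕ} (t t' : ℝ) (A H : Eu n × Eu n → ℝ≥0∞) (z : Eu n × Eu n) : ℝ≥0∞ :=
  (ball (0 : Eu n) t' ×ˢ ball (0 : Eu n) t').indicator A z
    + (ball (0 : Eu n) t ×ˢ (ball (0 : Eu n) t')ᶜ).indicator H z
    + (ball (0 : Eu n) t ×ˢ (ball (0 : Eu n) t')ᶜ).indicator H z.swap

theorem measurable_QT {n : ℕ} (t t' : ℝ) {A H : Eu n × Eu n → ℝ≥0∞} (hA : Measurable A)
    (hH : Measurable H) : Measurable (QT t t' A H) := by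
  unfold QT
  have h1 : MeasurableSet (ball (0 : Eu n) t' ×ˢ ball (0 : Eu n) t') :=
    measurableSet_ball.prod measurableSet_ball
  have h2 : MeasurableSet (ball (0 : Eu n) t ×ˢ (ball (0 : Eu n) t')ᶜ) :=
    measurableSet_ball.prod measurableSet_ball.compl
  exact ((hA.indicator h1).add (hH.indicator h2)).add ((hH.indicator h2).comp measurable_swap)

theorem lintegral_QT {n : ℕ} (t t' : ℝ) {A H : Eu n × Eu n → ℝ≥0∞} (hA : Measurable A)
    (hH : Measurable H) :
    ∫⁻ z, QT t t' A H z ∂(volume.prod volume) =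
      (∫⁻ x in ball (0 : Eu n) t', ∫⁻ y in ball (0 : Eu n) t', A (x, y)) +
      2 * ∫⁻ x in ball (0 : Eu n) t, ∫⁻ y in (ball (0 : Eu n) t')ᶜ, H (x, y) := by
  have h1 : MeasurableSet (ball (0 : Eu n) t' ×ˢ ball (0 : Eu n) t') :=
    measurableSet_ball.prod measurableSet_ball
  have h2 : MeasurableSet (ball (0 : Eu n) t ×ˢ (ball (0 : Eu n) t')ᶜ) :=
    measurableSet_ball.prod measurableSet_ball.compl
  have i1 := setLIntegral_prod (μ := volume) (ν := volume) (s := ball (0 : Eu n) t')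
    (t := ball (0 : Eu n) t') A hA.aemeasurable
  have i2 := setLIntegral_prod (μ := volume) (ν := volume) (s := ball (0 : Eu n) t)
    (t := (ball (0 : Eu n) t')ᶜ) H hH.aemeasurable
  unfold QT
  have h3 : Measurable fun z : Eu n × Eu n =>
      (ball (0 : Eu n) t ×ˢ (ball (0 : Eu n) t')ᶜ).indicator H z.swap :=
    (hH.indicator h2).comp measurable_swap
  rw [lintegral_add_right _ h3,
    lintegral_add_right _ (hH.indicator h2)]
  rw [lintegral_prod_swap (f := (ball (0 : Eu n) t ×ˢ (ball (0 : Eu n) t')ᶜ).indicator H)]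
  rw [lintegral_indicator h1, lintegral_indicator h2, i1, i2]
  ring

theorem comp_integral {α : Type*} [MeasurableSpace α] {μ : Measure α} {F : α → ℝ}
    (hF : Integrable F μ) (hFm : Measurable F) {Q R : α → ℝ≥0∞}
    (h : ∀ z, R z + ENNReal.ofReal (-F z) ≤ ENNReal.ofReal (F z) + Q z) :
    ∫⁻ z, R z ∂μ ≤ ENNReal.ofReal |∫ z, F z ∂μ| + ∫⁻ z, Q z ∂μ := by
  have h1 := lintegral_mono (μ := μ) h
  have hneg : Measurable fun z => ENNReal.ofReal (-F z) := hFm.neg.ennreal_ofReal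
  rw [lintegral_add_right _ hneg, lintegral_add_left hFm.ennreal_ofReal] at h1
  have h2 := integral_eq_lintegral_pos_part_sub_lintegral_neg_part hF
  have hA : ∫⁻ z, ENNReal.ofReal (F z) ∂μ ≠ ⊤ := hF.lintegral_lt_top.ne
  have hB : ∫⁻ z, ENNReal.ofReal (-F z) ∂μ ≠ ⊤ := hF.neg.lintegral_lt_top.ne
  set A := ∫⁻ z, ENNReal.ofReal (F z) ∂μ
  set B := ∫⁻ z, ENNReal.ofReal (-F z) ∂μ
  have h3 : A ≤ B + ENNReal.ofReal |∫ z, F z ∂μ| := by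
    have h5 : A.toReal ≤ B.toReal + |∫ z, F z ∂μ| := by
      have := le_abs_self (∫ z, F z ∂μ)
      linarith
    rw [← ENNReal.ofReal_toReal hA, ← ENNReal.ofReal_toReal hB,
      ← ENNReal.ofReal_add ENNReal.toReal_nonneg (abs_nonneg _)]
    exact ENNReal.ofReal_le_ofReal h5
  have h4 : B + ∫⁻ z, R z ∂μ ≤ B + (ENNReal.ofReal |∫ z, F z ∂μ| + ∫⁻ z, Q z ∂μ) := by
    rw [add_comm, ← add_assoc]
    exact h1.trans (by gcongr)
  exact (ENNReal.add_le_add_iff_left hB).1 h4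

theorem comp_pointwise {r f q : ℝ} (hr : 0 ≤ r) (hq : 0 ≤ q) (h : r ≤ f + q) :
    ENNReal.ofReal r + ENNReal.ofReal (-f) ≤ ENNReal.ofReal f + ENNReal.ofReal q := by
  rcases le_total 0 f with hf | hf
  · rw [ENNReal.ofReal_of_nonpos (by linarith : -f ≤ 0), add_zero, ← ENNReal.ofReal_add hf hq]
    exact ENNReal.ofReal_le_ofReal h
  · rw [ENNReal.ofReal_of_nonpos hf, zero_add, ← ENNReal.ofReal_add hr (by linarith)]
    exact ENNReal.ofReal_le_ofReal (by linarith)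

theorem dist_far {n : ℕ} {t t' : ℝ} (ht : t ≤ 2) (hd : 0 < t' - t) (hd1 : t' - t ≤ 1) {x y : Eu n}
    (hx : x ∈ ball (0 : Eu n) t) (hy : y ∈ (ball (0 : Eu n) t')ᶜ) {γ : ℝ} (hγ : 0 ≤ γ) :
    (dist x y ^ γ)⁻¹ ≤ (4 / (t' - t)) ^ γ * (1 + ‖y‖) ^ (-γ) := by
  rw [mem_ball_zero_iff] at hx
  rw [mem_compl_iff, mem_ball_zero_iff, not_lt] at hy
  have h1 : ‖y‖ ≤ ‖x‖ + dist x y := by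
    rw [dist_eq_norm]
    have := norm_sub_norm_le y x
    rw [norm_sub_rev] at this; linarith
  have h2 : t' - t ≤ dist x y := by linarith
  have h3 : 1 + ‖y‖ ≤ 4 / (t' - t) * dist x y := by
    rw [div_mul_eq_mul_div, le_div_iff₀ hd]
    nlinarith
  have hpos : 0 < 1 + ‖y‖ := by positivity
  have hdp : 0 < dist x y := by linarith
  have h4 : (1 + ‖y‖) ^ γ ≤ (4 / (t' - t)) ^ γ * dist x y ^ γ := by
    rw [← Real.mul_rpow (by positivity) (by positivity)]
    exact Real.rpow_le_rpow hpos.le h3 hγ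
  rw [Real.rpow_neg hpos.le, ← div_eq_mul_inv, le_div_iff₀ (by positivity),
    inv_mul_le_iff₀ (by positivity)]
  linarith

/-- tail integral -/
def tailI {n : ℕ} (γ a : ℝ) (v : Eu n → ℝ) : ℝ≥0∞ :=
  ∫⁻ y, ENNReal.ofReal (|v y| ^ a * (1 + ‖y‖) ^ (-γ))

def kF (n : ℕ) (γ : ℝ) : ℝ≥0∞ := ∫⁻ y : Eu n, ENNReal.ofReal ((1 + ‖y‖) ^ (-γ))

theorem nonlocal_bound {n : ℕ} {t t' : ℝ} (ht : t ≤ 2) (hd : 0 < t' - t) (hd1 : t' - t ≤ 1)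
    {γ a : ℝ} (hγ : 0 ≤ γ) (ha : 0 ≤ a) (c : ℝ) {v Ψ : Eu n → ℝ} (hv : Measurable v)
    (hΨ : Measurable Ψ) (hΨ0 : ∀ x, 0 ≤ Ψ x) :
    ∫⁻ x in ball (0 : Eu n) t, ∫⁻ y in (ball (0 : Eu n) t')ᶜ,
      ENNReal.ofReal (|v x - v y| ^ a * Ψ x / dist x y ^ γ) ≤
    ENNReal.ofReal (2 ^ a * (4 / (t' - t)) ^ γ) * ∫⁻ x in ball (0 : Eu n) t,
      ENNReal.ofReal (Ψ x) * (ENNReal.ofReal (|v x - c| ^ a) * kF n γ +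
        tailI γ a (fun y => v y - c)) := by
  rw [← lintegral_const_mul]
  swap
  · fun_prop
  refine setLIntegral_mono' measurableSet_ball fun x hx => ?_
  have hm1 : Measurable fun y : Eu n => ENNReal.ofReal ((1 + ‖y‖) ^ (-γ)) := by fun_prop
  have hm2 : Measurable fun y : Eu n => ENNReal.ofReal (|v y - c| ^ a * (1 + ‖y‖) ^ (-γ)) := by
    fun_prop
  calc _ ≤ ∫⁻ y in (ball (0 : Eu n) t')ᶜ, ENNReal.ofReal (2 ^ a * (4 / (t' - t)) ^ γ) *
        (ENNReal.ofReal (Ψ x) * (ENNReal.ofReal (|v x - c| ^ a) *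
          ENNReal.ofReal ((1 + ‖y‖) ^ (-γ)) + ENNReal.ofReal (|v y - c| ^ a * (1 + ‖y‖) ^ (-γ)))) := by
        refine setLIntegral_mono' measurableSet_ball.compl fun y hy => ?_
        have h0 := hΨ0 x
        have hK : 0 ≤ 4 / (t' - t) := by positivity
        rw [← ENNReal.ofReal_mul (by positivity), ← ENNReal.ofReal_add (by positivity) (by positivity),
          ← ENNReal.ofReal_mul (by positivity), ← ENNReal.ofReal_mul (by positivity)]
        apply ENNReal.ofReal_le_ofReal
        have h1 := dist_far ht hd hd1 hx hy hγ
        have h2 : |v x - v y| ^ a ≤ 2 ^ a * (|v x - c| ^ a + |v y - c| ^ a) := by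
          refine le_trans ?_ (add_rpow_le_two (abs_nonneg _) (abs_nonneg _) ha)
          apply Real.rpow_le_rpow (abs_nonneg _) _ ha
          rw [abs_sub_comm (v y) c]
          have := abs_add_le (v x - c) (c - v y)
          simpa using this
        rw [div_eq_mul_inv]
        calc _ ≤ (2 ^ a * (|v x - c| ^ a + |v y - c| ^ a)) * Ψ x *
              ((4 / (t' - t)) ^ γ * (1 + ‖y‖) ^ (-γ)) := by gcongr
          _ = _ := by ring
    _ ≤ ∫⁻ y, ENNReal.ofReal (2 ^ a * (4 / (t' - t)) ^ γ) *
        (ENNReal.ofReal (Ψ x) * (ENNReal.ofReal (|v x - c| ^ a) *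
          ENNReal.ofReal ((1 + ‖y‖) ^ (-γ)) + ENNReal.ofReal (|v y - c| ^ a * (1 + ‖y‖) ^ (-γ)))) :=
        setLIntegral_le_lintegral _ _
    _ = _ := by
        rw [lintegral_const_mul _ (by fun_prop), lintegral_const_mul _ (by fun_prop),
          lintegral_add_right _ hm2, lintegral_const_mul _ hm1]
        rfl

theorem loc_kernel_fin {n : ℕ} {t' e c : ℝ} (ht' : t' ≤ 2) (he : 0 < e + n) :
    ∫⁻ x in ball (0 : Eu n) t', ∫⁻ y in ball (0 : Eu n) t',
      ENNReal.ofReal (c * ‖y - x‖ ^ e) < ⊤ := by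
  have hk := kerLoc n he
  rw [add_sub_cancel_right] at hk
  have h1 : ∀ x ∈ ball (0 : Eu n) t', ∫⁻ y in ball (0 : Eu n) t',
      ENNReal.ofReal (c * ‖y - x‖ ^ e) ≤
      ENNReal.ofReal |c| * ∫⁻ k in ball (0 : Eu n) 4, ENNReal.ofReal (‖k‖ ^ e) := by
    intro x hx
    rw [← lintegral_indicator measurableSet_ball, ← lintegral_indicator measurableSet_ball,
      ← lintegral_sub_right_eq_self ((ball (0 : Eu n) 4).indicator fun k => ENNReal.ofReal (‖k‖ ^ e)) x, ← lintegral_const_mul]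
    swap
    · exact Measurable.comp (g := (ball (0 : Eu n) 4).indicator fun k => ENNReal.ofReal (‖k‖ ^ e))
        (Measurable.indicator (by fun_prop) measurableSet_ball) (measurable_sub_const x)
    refine lintegral_mono fun y => ?_
    by_cases hy : y ∈ ball (0 : Eu n) t'
    · have hm : y - x ∈ ball (0 : Eu n) 4 := by
        rw [mem_ball_zero_iff] at *
        exact (norm_sub_le _ _).trans_lt (by linarith)
      rw [indicator_of_mem hy, indicator_of_mem hm, ← ENNReal.ofReal_mul (abs_nonneg _)]
      apply ENNReal.ofReal_le_ofReal
      gcongr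
      exact le_abs_self c
    · rw [indicator_of_notMem hy]; exact zero_le
  refine lt_of_le_of_lt (setLIntegral_mono' measurableSet_ball h1) ?_
  rw [setLIntegral_const]
  exact ENNReal.mul_lt_top (ENNReal.mul_lt_top (by simp) hk) measure_ball_lt_top

theorem integrable_form {n : ℕ} {p γ t t' L K : ℝ} (hp : 1 < p) (ht : t ≤ 2) (ht' : t' ≤ 2)
    (hd : 0 < t' - t) (hd1 : t' - t ≤ 1) (hγ : (n:ℝ) < γ) (hγ2 : γ < n + p)
    {u φ : Eu n → ℝ} (hum : Measurable u) (hφm : Measurable φ)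
    (hφ0 : ∀ x ∉ ball (0 : Eu n) t, φ x = 0)
    (hL : ∀ x ∈ ball (0 : Eu n) t', ∀ y ∈ ball (0 : Eu n) t', |u x - u y| ≤ L * dist x y)
    (hK : ∀ x y, |φ x - φ y| ≤ K * dist x y) (hK0 : 0 ≤ K) (hL0 : 0 ≤ L)
    {M Mu : ℝ} (hMφ : ∀ x, |φ x| ≤ M) (hMu : ∀ x ∈ ball (0 : Eu n) t, |u x| ≤ Mu)
    (htail : tailI γ (p - 1) u < ⊤) :
    Integrable (fun z : Eu n × Eu n => Jp p (u z.1 - u z.2) * (φ z.1 - φ z.2) / dist z.1 z.2 ^ γ)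
      (volume.prod volume) := by
  have hn : (0:ℝ) ≤ n := Nat.cast_nonneg n
  have hγ0 : 0 < γ := by linarith
  have hJm := measurable_Jp p
  have hm : Measurable (fun z : Eu n × Eu n =>
      Jp p (u z.1 - u z.2) * (φ z.1 - φ z.2) / dist z.1 z.2 ^ γ) := by
    have h1 : Measurable fun z : Eu n × Eu n => Jp p (u z.1 - u z.2) := hJm.comp (by fun_prop)
    have h2 : Measurable fun z : Eu n × Eu n => dist z.1 z.2 ^ γ :=
      (measurable_fst.dist measurable_snd).pow_const _
    exact (h1.mul (by fun_prop)).div h2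
  refine ⟨hm.aestronglyMeasurable, ?_⟩
  set A : Eu n × Eu n → ℝ≥0∞ := fun z => ENNReal.ofReal (L ^ (p-1) * K * ‖z.2 - z.1‖ ^ (p - γ))
  set H : Eu n × Eu n → ℝ≥0∞ := fun z => ENNReal.ofReal (|u z.1 - u z.2| ^ (p-1) * |φ z.1| /
    dist z.1 z.2 ^ γ)
  have hA : Measurable A := by
    refine Measurable.ennreal_ofReal (Measurable.const_mul ?_ _)
    exact (by fun_prop : Measurable fun z : Eu n × Eu n => ‖z.2 - z.1‖).pow_const _
  have hH : Measurable H := by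
    refine Measurable.ennreal_ofReal (Measurable.div (by fun_prop) ?_)
    exact (measurable_fst.dist measurable_snd).pow_const _
  have htt : t ≤ t' := by linarith
  have hbt : ball (0 : Eu n) t ⊆ ball 0 t' := ball_subset_ball htt
  have hpt : ∀ z : Eu n × Eu n, ‖Jp p (u z.1 - u z.2) * (φ z.1 - φ z.2) / dist z.1 z.2 ^ γ‖ₑ ≤
      QT t t' A H z := by
    rintro ⟨x, y⟩
    have e : ‖Jp p (u x - u y) * (φ x - φ y) / dist x y ^ γ‖ₑ =
        ENNReal.ofReal (|u x - u y| ^ (p-1) * |φ x - φ y| / dist x y ^ γ) := by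
      rw [← ofReal_norm, Real.norm_eq_abs, abs_div, abs_mul, abs_Jp hp,
        abs_of_nonneg (by positivity : 0 ≤ dist x y ^ γ)]
    simp only
    rw [e]
    unfold QT
    by_cases hx' : x ∈ ball (0 : Eu n) t' <;> by_cases hy' : y ∈ ball (0 : Eu n) t'
    · refine le_trans ?_ (le_trans (le_add_right le_rfl) (le_add_right le_rfl))
      have hmem : (x, y) ∈ ball (0 : Eu n) t' ×ˢ ball (0 : Eu n) t' := ⟨hx', hy'⟩
      rw [indicator_of_mem hmem]
      apply ENNReal.ofReal_le_ofReal
      simp only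
      rcases eq_or_ne x y with rfl | hxy
      · simp; positivity
      · have hdp : 0 < dist x y := dist_pos.2 hxy
        rw [← dist_eq_norm, dist_comm y x, Real.rpow_sub hdp, div_le_iff₀ (by positivity)]
        have h1 : |u x - u y| ^ (p-1) ≤ L ^ (p-1) * dist x y ^ (p-1) := by
          rw [← Real.mul_rpow hL0 hdp.le]
          exact Real.rpow_le_rpow (abs_nonneg _) (hL x hx' y hy') (by linarith)
        calc _ ≤ (L ^ (p-1) * dist x y ^ (p-1)) * (K * dist x y) := by
              gcongr; exact hK x y
          _ = L ^ (p-1) * K * dist x y ^ p := by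
              have : dist x y ^ p = dist x y ^ (p-1) * dist x y := by
                rw [← Real.rpow_add_one hdp.ne']; congr 1; ring
              rw [this]; ring
          _ = _ := by field_simp
    · have hφy : φ y = 0 := hφ0 y (fun h => hy' (hbt h))
      by_cases hx : x ∈ ball (0 : Eu n) t
      · refine le_trans ?_ (le_trans (le_add_left le_rfl) (le_add_right le_rfl))
        have hmem : (x, y) ∈ ball (0 : Eu n) t ×ˢ (ball (0 : Eu n) t')ᶜ := ⟨hx, hy'⟩
        rw [indicator_of_mem hmem]
        simp [H, hφy]
      · simp [hφy, hφ0 x hx]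
    · have hφx : φ x = 0 := hφ0 x (fun h => hx' (hbt h))
      by_cases hy : y ∈ ball (0 : Eu n) t
      · refine le_trans ?_ (le_add_left le_rfl)
        have hmem : (y, x) ∈ ball (0 : Eu n) t ×ˢ (ball (0 : Eu n) t')ᶜ := ⟨hy, hx'⟩
        rw [Prod.swap_prod_mk, indicator_of_mem hmem]
        simp [H, hφx, abs_sub_comm (u x), dist_comm x]
      · simp [hφx, hφ0 y hy]
    · simp [hφ0 x (fun h => hx' (hbt h)), hφ0 y (fun h => hy' (hbt h))]
  refine lt_of_le_of_lt (lintegral_mono hpt) ?_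
  rw [lintegral_QT t t' hA hH]
  refine ENNReal.add_lt_top.2 ⟨?_, ENNReal.mul_lt_top (by simp) ?_⟩
  · exact loc_kernel_fin ht' (by linarith)
  · have hb := nonlocal_bound ht hd hd1 hγ0.le (by linarith : 0 ≤ p - 1) 0 hum
      (Ψ := fun x => |φ x|) (by fun_prop) (fun x => abs_nonneg _)
    refine lt_of_le_of_lt hb (ENNReal.mul_lt_top (by simp) ?_)
    calc _ ≤ ∫⁻ x in ball (0 : Eu n) t, ENNReal.ofReal M * (ENNReal.ofReal (Mu ^ (p-1)) * kF n γ
          + tailI γ (p-1) (fun y => u y - 0)) := by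
          refine setLIntegral_mono' measurableSet_ball fun x hx => ?_
          have h1 := hMφ x
          have h2 := hMu x hx
          rw [sub_zero]
          gcongr
      _ < ⊤ := by
          rw [setLIntegral_const]
          refine ENNReal.mul_lt_top (ENNReal.mul_lt_top (by simp) ?_) measure_ball_lt_top
          refine ENNReal.add_lt_top.2 ⟨ENNReal.mul_lt_top (by simp) (kerFar n hγ), ?_⟩
          simpa using htail

theorem shift_mem {n : ℕ} {t r : ℝ} {h x : Eu n} (htr : t + ‖h‖ ≤ r) (hx : x ∈ ball (0 : Eu n) t) :
    x + h ∈ ball (0 : Eu n) r := by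
  rw [mem_ball_zero_iff] at *
  exact (norm_add_le _ _).trans_lt (by linarith)

theorem shift_le {n : ℕ} {t r : ℝ} {h : Eu n} (htr : t + ‖h‖ ≤ r) (g : Eu n → ℝ≥0∞) :
    ∫⁻ x in ball (0 : Eu n) t, g (x + h) ≤ ∫⁻ x in ball (0 : Eu n) r, g x := by
  rw [← lintegral_indicator measurableSet_ball, ← lintegral_indicator measurableSet_ball,
    ← lintegral_add_right_eq_self ((ball (0 : Eu n) r).indicator g) h]
  refine lintegral_mono fun x => ?_
  by_cases hx : x ∈ ball (0 : Eu n) t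
  · rw [indicator_of_mem hx, indicator_of_mem (shift_mem htr hx)]
  · rw [indicator_of_notMem hx]; exact zero_le

theorem dlt_int {n : ℕ} {u : Eu n → ℝ} {Ω : Set (Eu n)} (hΩ : IsOpen Ω)
    (hu : ContDiffOn ℝ 1 u Ω) (hB : closedBall 0 2 ⊆ Ω) {P : ℝ} (hP : 1 ≤ P) {t r : ℝ} {h : Eu n}
    (htr : t + ‖h‖ ≤ r) (hr : r ≤ 2) :
    ∫⁻ x in ball (0 : Eu n) t, ENNReal.ofReal (|u (x + h) - u x| ^ P) ≤
      ENNReal.ofReal (‖h‖ ^ P) * ∫⁻ x in ball (0 : Eu n) r, gP u P x := by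
  classical
  refine le_trans ?_ (seg_integral hΩ hu (((ball_subset_ball hr).trans ball_subset_closedBall).trans hB)
    measurableSet_ball (convex_ball 0 r) hP h)
  rw [← lintegral_indicator measurableSet_ball]
  refine lintegral_mono fun x => ?_
  by_cases hx : x ∈ ball (0 : Eu n) t
  · rw [indicator_of_mem hx, if_pos]
    refine ⟨ball_subset_ball ?_ hx, shift_mem htr hx⟩
    have := norm_nonneg h; linarith
  · rw [indicator_of_notMem hx]; exact zero_le

theorem young_e {a β h x : ℝ} (ha : 0 < a) (hβ : 0 < β) (hh : 0 < h) (hx : 0 ≤ x) (T : ℝ≥0∞) :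
    ENNReal.ofReal (x ^ β) * T ≤ ENNReal.ofReal (h ^ β) *
      (ENNReal.ofReal ((x / h) ^ (a + β)) + T ^ ((a + β) / a)) := by
  have e1 : x ^ β = h ^ β * (x / h) ^ β := by
    rw [← Real.mul_rpow hh.le (by positivity)]; congr 1; field_simp
  rw [e1, ENNReal.ofReal_mul (by positivity), mul_assoc]
  gcongr
  rw [← ENNReal.ofReal_rpow_of_nonneg (by positivity) hβ.le,
    ← ENNReal.ofReal_rpow_of_nonneg (by positivity) (by positivity)]
  set X := ENNReal.ofReal (x / h)
  obtain ⟨τ, rfl⟩ : ∃ τ : ℝ≥0∞, T = τ ^ a := ⟨T ^ (1/a), by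
    rw [← ENNReal.rpow_mul, one_div_mul_cancel ha.ne', ENNReal.rpow_one]⟩
  rw [← ENNReal.rpow_mul, mul_div_cancel₀ _ ha.ne']
  rcases le_total X τ with h | h
  · refine le_trans ?_ (le_add_left le_rfl)
    rw [ENNReal.rpow_add_of_nonneg _ _ ha.le hβ.le, mul_comm]
    gcongr
  · refine le_trans ?_ (le_add_right le_rfl)
    rw [ENNReal.rpow_add_of_nonneg _ _ ha.le hβ.le, mul_comm]
    gcongr

theorem tailI_shift {n : ℕ} {γ a : ℝ} (hγ : 0 ≤ γ) {h : Eu n} (hh : ‖h‖ ≤ 1) (v : Eu n → ℝ) :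
    tailI γ a (fun y => v (y + h)) ≤ ENNReal.ofReal (2 ^ γ) * tailI γ a v := by
  unfold tailI
  rw [← lintegral_const_mul' _ _ (by simp), ← lintegral_sub_right_eq_self _ h]
  refine lintegral_mono fun y => ?_
  rw [← ENNReal.ofReal_mul (by positivity)]
  apply ENNReal.ofReal_le_ofReal
  simp only [sub_add_cancel]
  have h1 : 1 + ‖y‖ ≤ 2 * (1 + ‖y - h‖) := by
    have := norm_sub_norm_le y h
    have h0 := norm_nonneg (y - h)
    linarith
  have h2 : (1 + ‖y - h‖) ^ (-γ) ≤ 2 ^ γ * (1 + ‖y‖) ^ (-γ) := by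
    rw [Real.rpow_neg (by positivity), Real.rpow_neg (by positivity), ← div_eq_mul_inv,
      le_div_iff₀ (by positivity), inv_mul_le_iff₀ (by positivity), mul_comm,
      ← Real.mul_rpow (by norm_num) (by positivity)]
    exact Real.rpow_le_rpow (by positivity) h1 hγ
  calc _ ≤ |v y| ^ a * (2 ^ γ * (1 + ‖y‖) ^ (-γ)) := by gcongr
    _ = _ := by ring

theorem tailI_const {n : ℕ} {γ a : ℝ} (hγ : (n:ℝ) < γ) (ha : 0 ≤ a) {v : Eu n → ℝ} (hv : Measurable v)
    (c : ℝ) (h : tailI γ a v < ⊤) : tailI γ a (fun y => v y - c) < ⊤ := by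
  have h2 := kerFar n hγ
  unfold tailI at *
  calc _ ≤ ∫⁻ y, ENNReal.ofReal (2 ^ a) * (ENNReal.ofReal (|v y| ^ a * (1 + ‖y‖) ^ (-γ)) +
        ENNReal.ofReal (|c| ^ a) * ENNReal.ofReal ((1 + ‖y‖) ^ (-γ))) := by
        refine lintegral_mono fun y => ?_
        rw [← ENNReal.ofReal_mul (by positivity), ← ENNReal.ofReal_add (by positivity) (by positivity),
          ← ENNReal.ofReal_mul (by positivity)]
        apply ENNReal.ofReal_le_ofReal
        have h1 : |v y - c| ^ a ≤ 2 ^ a * (|v y| ^ a + |c| ^ a) := by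
          refine le_trans ?_ (add_rpow_le_two (abs_nonneg _) (abs_nonneg _) ha)
          exact Real.rpow_le_rpow (abs_nonneg _) (abs_sub _ _) ha
        calc _ ≤ (2 ^ a * (|v y| ^ a + |c| ^ a)) * (1 + ‖y‖) ^ (-γ) := by gcongr
          _ = _ := by ring
    _ < ⊤ := by
        rw [lintegral_const_mul' _ _ (by simp), lintegral_add_left (by fun_prop),
          lintegral_const_mul' _ _ (by simp)]
        exact ENNReal.mul_lt_top (by simp) (ENNReal.add_lt_top.2 ⟨h, ENNReal.mul_lt_top (by simp) h2⟩)

/-- the shifted function is C1 on the shifted set -/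
theorem shift_C1 {n : ℕ} {u : Eu n → ℝ} {Ω : Set (Eu n)} (hu : ContDiffOn ℝ 1 u Ω) (h : Eu n) :
    ContDiffOn ℝ 1 (fun x => u (x + h)) ((fun x => x + h) ⁻¹' Ω) :=
  hu.comp (by fun_prop) (fun x hx => hx)

theorem shift_gP {n : ℕ} (u : Eu n → ℝ) (h : Eu n) (P : ℝ) (x : Eu n) :
    gP (fun x => u (x + h)) P x = gP u P (x + h) := by
  unfold gP
  rw [fderiv_comp_add_right]

/-- C1 on neighbourhood of closed ball: Lipschitz and bounded -/
theorem lip_ball {n : ℕ} {u : Eu n → ℝ} {Ω : Set (Eu n)} (hΩ : IsOpen Ω)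
    (hu : ContDiffOn ℝ 1 u Ω) (hB : closedBall 0 2 ⊆ Ω) :
    ∃ L : ℝ, 0 ≤ L ∧ (∀ x ∈ closedBall (0 : Eu n) 2, ‖fderiv ℝ u x‖ ≤ L) ∧
      (∀ x ∈ closedBall (0 : Eu n) 2, |u x| ≤ L) ∧
      ∀ x ∈ closedBall (0 : Eu n) 2, ∀ y ∈ closedBall (0 : Eu n) 2, |u x - u y| ≤ L * dist x y := by
  have hc : IsCompact (closedBall (0 : Eu n) 2) := isCompact_closedBall _ _
  obtain ⟨L1, h1⟩ := hc.exists_bound_of_continuousOn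
    ((hu.continuousOn_fderiv_of_isOpen hΩ le_rfl).mono hB)
  obtain ⟨L2, h2⟩ := hc.exists_bound_of_continuousOn (hu.continuousOn.mono hB)
  refine ⟨max 0 (max L1 L2), le_max_left _ _, fun x hx => (h1 x hx).trans (by simp),
    fun x hx => (h2 x hx).trans (by simp), ?_⟩
  intro x hx y hy
  have := (convex_closedBall (0 : Eu n) 2).norm_image_sub_le_of_norm_fderiv_le (𝕜 := ℝ) (f := u)
    (C := max 0 (max L1 L2))
    (fun z hz => (hu.differentiableOn (by norm_num)).differentiableAt (hΩ.mem_nhds (hB hz)))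
    (fun z hz => (h1 z hz).trans (by simp)) hy hx
  rw [dist_eq_norm x y, ← Real.norm_eq_abs]
  exact this

/-- local kernel constant -/
def kL (n : ℕ) (e : ℝ) : ℝ≥0∞ := ∫⁻ k in ball (0 : Eu n) 4, ENNReal.ofReal (‖k‖ ^ e)

theorem kL_fin {n : ℕ} {e : ℝ} (he : 0 < e + n) : kL n e < ⊤ := by
  have := kerLoc n he
  rwa [add_sub_cancel_right] at this

theorem inner_kL {n : ℕ} {t' e : ℝ} (ht' : t' ≤ 2) {x : Eu n} (hx : x ∈ ball (0 : Eu n) t') :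
    ∫⁻ y in ball (0 : Eu n) t', ENNReal.ofReal (‖y - x‖ ^ e) ≤ kL n e := by
  unfold kL
  rw [← lintegral_indicator measurableSet_ball, ← lintegral_indicator measurableSet_ball,
    ← lintegral_sub_right_eq_self ((ball (0 : Eu n) 4).indicator fun k => ENNReal.ofReal (‖k‖ ^ e)) x]
  refine lintegral_mono fun y => ?_
  by_cases hy : y ∈ ball (0 : Eu n) t'
  · have hm : y - x ∈ ball (0 : Eu n) 4 := by
      rw [mem_ball_zero_iff] at *
      exact (norm_sub_le _ _).trans_lt (by linarith)
    rw [indicator_of_mem hy, indicator_of_mem hm]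
  · rw [indicator_of_notMem hy]; exact zero_le

theorem pairs_kL {n : ℕ} {u : Eu n → ℝ} {Ω : Set (Eu n)} (hΩ : IsOpen Ω)
    (hu : ContDiffOn ℝ 1 u Ω) (hum : Measurable u) {t' : ℝ} (ht' : t' ≤ 2)
    (hB : ball (0 : Eu n) t' ⊆ Ω) {P e : ℝ} (hP : 1 ≤ P) :
    ∫⁻ x in ball (0 : Eu n) t', ∫⁻ y in ball (0 : Eu n) t',
      ENNReal.ofReal (|u x - u y| ^ P) * ENNReal.ofReal (‖y - x‖ ^ (e - P)) ≤
    kL n e * ∫⁻ x in ball (0 : Eu n) t', gP u P x := by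
  refine le_trans (pairs_integral hΩ hu hum hB measurableSet_ball (convex_ball _ _)
    (ball_subset_ball ht') hP (κ := fun k => ENNReal.ofReal (‖k‖ ^ (e - P))) (by fun_prop)) ?_
  gcongr
  unfold kL
  refine lintegral_mono fun k => ?_
  rw [← ENNReal.ofReal_mul (by positivity)]
  apply ENNReal.ofReal_le_ofReal
  rcases (norm_nonneg k).eq_or_lt with h | h
  · rw [← h, Real.zero_rpow (by linarith : P ≠ 0), mul_zero]; positivity
  · rw [← Real.rpow_add h, sub_add_cancel]

theorem young_loc {a w δ h p β : ℝ} (hp : 1 < p) (hβ : 1 ≤ β) (ha : 0 ≤ a) (hw : 0 ≤ w)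
    (hδ : 0 < δ) (hh : 0 < h) :
    a ^ (p-1) * w ^ β ≤ δ ^ (p-1) * h ^ β * ((a/δ) ^ (p-1+β) + (w/h) ^ (p-1+β)) := by
  have h1 := young_triv (x := a/δ) (y := w/h) (a := p-1) (b := β) (by positivity) (by positivity)
    (by linarith) (by linarith)
  calc a ^ (p-1) * w ^ β = δ ^ (p-1) * h ^ β * ((a/δ) ^ (p-1) * (w/h) ^ β) := by
        rw [Real.div_rpow ha hδ.le, Real.div_rpow hw hh.le]
        field_simp
    _ ≤ _ := by gcongr

/-- pointwise bound of the bad local term -/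
theorem bad_pointwise {a b w w' δ h p β γ K : ℝ} (hp : 1 < p) (hβ : 1 ≤ β)
    (hδ : 0 < δ) (hh : 0 < h) (hK : 0 ≤ K) :
    (|a| ^ (p-1) + |b| ^ (p-1)) * ((|w| ^ β + |w'| ^ β) / 2) * (K * δ) / δ ^ γ ≤
      K * h ^ β * (|a| ^ (p-1+β) * δ ^ (p - γ - (p-1+β)) + |b| ^ (p-1+β) * δ ^ (p - γ - (p-1+β))
        + (|w|/h) ^ (p-1+β) * δ ^ (p-γ) + (|w'|/h) ^ (p-1+β) * δ ^ (p-γ)) := by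
  have y1 := young_loc hp hβ (abs_nonneg a) (abs_nonneg w) hδ hh
  have y2 := young_loc hp hβ (abs_nonneg b) (abs_nonneg w) hδ hh
  have y3 := young_loc hp hβ (abs_nonneg a) (abs_nonneg w') hδ hh
  have y4 := young_loc hp hβ (abs_nonneg b) (abs_nonneg w') hδ hh
  have e1 : ∀ a : ℝ, |a| ^ (p-1+β) * δ ^ (p - γ - (p-1+β)) = (|a|/δ) ^ (p-1+β) * δ ^ (p-γ) := by
    intro a
    rw [Real.rpow_sub hδ (p-γ), Real.div_rpow (abs_nonneg _) hδ.le]; ring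
  have e2 : δ ^ (p-γ) = δ ^ (p-1) * δ / δ ^ γ := by
    rw [Real.rpow_sub hδ, ← Real.rpow_add_one hδ.ne', sub_add_cancel]
  rw [e1, e1, e2]
  have hδγ : 0 < δ ^ γ := by positivity
  calc _ = (|a| ^ (p-1) * |w| ^ β + |b| ^ (p-1) * |w| ^ β + |a| ^ (p-1) * |w'| ^ β
        + |b| ^ (p-1) * |w'| ^ β) / 2 * (K * δ / δ ^ γ) := by ring
    _ ≤ ((δ ^ (p-1) * h ^ β * ((|a|/δ) ^ (p-1+β) + (|w|/h) ^ (p-1+β))) +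
        (δ ^ (p-1) * h ^ β * ((|b|/δ) ^ (p-1+β) + (|w|/h) ^ (p-1+β))) +
        (δ ^ (p-1) * h ^ β * ((|a|/δ) ^ (p-1+β) + (|w'|/h) ^ (p-1+β))) +
        (δ ^ (p-1) * h ^ β * ((|b|/δ) ^ (p-1+β) + (|w'|/h) ^ (p-1+β)))) / 2 * (K * δ / δ ^ γ) := by
        gcongr
    _ = _ := by ring

theorem dbl_sum4 {α : Type*} [MeasurableSpace α] {μ : Measure α} [SFinite μ]
    {c : ℝ≥0∞} (hc : c ≠ ⊤) {a1 a2 a3 a4 : α → α → ℝ≥0∞}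
    (m2 : Measurable (Function.uncurry a2))
    (m3 : Measurable (Function.uncurry a3)) (m4 : Measurable (Function.uncurry a4)) :
    ∫⁻ x, ∫⁻ y, c * (a1 x y + a2 x y + a3 x y + a4 x y) ∂μ ∂μ =
      c * ((∫⁻ x, ∫⁻ y, a1 x y ∂μ ∂μ) + (∫⁻ x, ∫⁻ y, a2 x y ∂μ ∂μ) + (∫⁻ x, ∫⁻ y, a3 x y ∂μ ∂μ)
        + ∫⁻ x, ∫⁻ y, a4 x y ∂μ ∂μ) := by
  have l2 : ∀ x, Measurable (a2 x) := fun x => m2.comp measurable_prodMk_left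
  have l3 : ∀ x, Measurable (a3 x) := fun x => m3.comp measurable_prodMk_left
  have l4 : ∀ x, Measurable (a4 x) := fun x => m4.comp measurable_prodMk_left
  have i2 : Measurable fun x => ∫⁻ y, a2 x y ∂μ := m2.lintegral_prod_right'
  have i3 : Measurable fun x => ∫⁻ y, a3 x y ∂μ := m3.lintegral_prod_right'
  have i4 : Measurable fun x => ∫⁻ y, a4 x y ∂μ := m4.lintegral_prod_right'
  have e : ∀ x, ∫⁻ y, c * (a1 x y + a2 x y + a3 x y + a4 x y) ∂μ =
      c * ((∫⁻ y, a1 x y ∂μ) + (∫⁻ y, a2 x y ∂μ) + (∫⁻ y, a3 x y ∂μ) + ∫⁻ y, a4 x y ∂μ) := by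
    intro x
    rw [lintegral_const_mul' _ _ hc, lintegral_add_right _ (l4 x),
      lintegral_add_right _ (l3 x), lintegral_add_right _ (l2 x)]
  simp only [e]
  rw [lintegral_const_mul' _ _ hc, lintegral_add_right _ i4, lintegral_add_right _ i3,
    lintegral_add_right _ i2]

/-- the bad local density -/
def badA {n : ℕ} (u : Eu n → ℝ) (h : Eu n) (p β γ K : ℝ) (z : Eu n × Eu n) : ℝ :=
  (|u (z.1 + h) - u (z.2 + h)| ^ (p-1) + |u z.1 - u z.2| ^ (p-1)) *
    ((|u (z.1 + h) - u z.1| ^ β + |u (z.2 + h) - u z.2| ^ β) / 2) * (K * dist z.1 z.2)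
      / dist z.1 z.2 ^ γ

theorem bad_integral {n : ℕ} {u : Eu n → ℝ} {Ω : Set (Eu n)} (hΩ : IsOpen Ω)
    (hu : ContDiffOn ℝ 1 u Ω) (hum : Measurable u) (hB : closedBall 0 2 ⊆ Ω)
    {p β γ K t' r : ℝ} {h : Eu n} (hp : 1 < p) (hβ : 1 ≤ β) (hh : h ≠ 0) (hK : 0 ≤ K)
    (htr : t' + ‖h‖ ≤ r) (hr : r ≤ 2) :
    ∫⁻ x in ball (0 : Eu n) t', ∫⁻ y in ball (0 : Eu n) t',
      ENNReal.ofReal (badA u h p β γ K (x, y)) ≤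
    ENNReal.ofReal (K * ‖h‖ ^ β) * (4 * kL n (p - γ) * ∫⁻ x in ball (0 : Eu n) r, gP u (p-1+β) x) := by
  set P := p - 1 + β with hPdef
  have hP : 1 ≤ P := by linarith
  have hh0 : 0 < ‖h‖ := norm_pos_iff.2 hh
  have ht' : t' ≤ 2 := by linarith
  have ht'r : t' ≤ r := by linarith
  set G := ∫⁻ x in ball (0 : Eu n) r, gP u P x with hG
  set k := fun z : Eu n => ENNReal.ofReal (‖z‖ ^ (p-γ-P)) with hk
  set k2 := fun z : Eu n => ENNReal.ofReal (‖z‖ ^ (p-γ)) with hk2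
  set W := fun x : Eu n => ENNReal.ofReal ((|u (x + h) - u x| / ‖h‖) ^ P) with hW
  have hWm : Measurable W := by fun_prop
  have hkm : Measurable k := by fun_prop
  have hkm2 : Measurable k2 := by fun_prop
  set a1 := fun x y : Eu n => ENNReal.ofReal (|u (x + h) - u (y + h)| ^ P) * k (y - x)
  set a2 := fun x y : Eu n => ENNReal.ofReal (|u x - u y| ^ P) * k (y - x)
  set a3 := fun x y : Eu n => W x * k2 (y - x)
  set a4 := fun x y : Eu n => W y * k2 (y - x)
  have m1 : Measurable (Function.uncurry a1) := by unfold a1 Function.uncurry; fun_prop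
  have m2 : Measurable (Function.uncurry a2) := by unfold a2 Function.uncurry; fun_prop
  have m3 : Measurable (Function.uncurry a3) := by unfold a3 Function.uncurry; fun_prop
  have m4 : Measurable (Function.uncurry a4) := by unfold a4 Function.uncurry; fun_prop
  have hWint : ∫⁻ x in ball (0 : Eu n) t', W x ≤ G := by
    have h1 := dlt_int hΩ hu hB hP htr hr
    have e : ∀ x, ENNReal.ofReal (|u (x + h) - u x| ^ P) = ENNReal.ofReal (‖h‖ ^ P) * W x := by
      intro x
      rw [hW, ← ENNReal.ofReal_mul (by positivity), Real.div_rpow (abs_nonneg _) hh0.le]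
      congr 1
      have : ‖h‖ ^ P ≠ 0 := by positivity
      field_simp
    simp only [e] at h1
    rw [lintegral_const_mul _ hWm] at h1
    have hne : ENNReal.ofReal (‖h‖ ^ P) ≠ 0 := by
      rw [ne_eq, ENNReal.ofReal_eq_zero, not_le]; positivity
    exact (ENNReal.mul_le_mul_iff_right hne (by simp)).1 h1
  have I1 : ∫⁻ x in ball (0 : Eu n) t', ∫⁻ y in ball (0 : Eu n) t', a1 x y ≤ kL n (p-γ) * G := by
    refine le_trans (pairs_kL (u := fun x => u (x + h)) (hΩ.preimage (by fun_prop))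
      (shift_C1 hu h) (by fun_prop) ht' ?_ hP) ?_
    · intro x hx
      exact hB (ball_subset_closedBall (ball_subset_ball hr (shift_mem htr hx)))
    · gcongr
      simp only [shift_gP]
      exact shift_le htr _
  have I2 : ∫⁻ x in ball (0 : Eu n) t', ∫⁻ y in ball (0 : Eu n) t', a2 x y ≤ kL n (p-γ) * G := by
    refine le_trans (pairs_kL hΩ hu hum ht' ?_ hP) ?_
    · intro x hx
      exact hB (ball_subset_closedBall (ball_subset_ball ht' hx))
    · gcongr
      exact lintegral_mono_set (ball_subset_ball ht'r)
  have I3 : ∫⁻ x in ball (0 : Eu n) t', ∫⁻ y in ball (0 : Eu n) t', a3 x y ≤ kL n (p-γ) * G := by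
    calc _ ≤ ∫⁻ x in ball (0 : Eu n) t', W x * kL n (p-γ) := by
          refine setLIntegral_mono' measurableSet_ball fun x hx => ?_
          rw [lintegral_const_mul _ (by fun_prop)]
          gcongr
          exact inner_kL ht' hx
      _ ≤ _ := by
          rw [lintegral_mul_const _ hWm, mul_comm]; gcongr
  have I4 : ∫⁻ x in ball (0 : Eu n) t', ∫⁻ y in ball (0 : Eu n) t', a4 x y ≤ kL n (p-γ) * G := by
    rw [lintegral_lintegral_swap m4.aemeasurable]
    refine le_trans (le_of_eq ?_) I3
    simp only [a3, a4, hk2, norm_sub_rev]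
  have hpt : ∀ x y : Eu n, ENNReal.ofReal (badA u h p β γ K (x, y)) ≤
      ENNReal.ofReal (K * ‖h‖ ^ β) * (a1 x y + a2 x y + a3 x y + a4 x y) := by
    intro x y
    rcases eq_or_ne x y with rfl | hxy
    · simp [badA]
    · have hδ : 0 < dist x y := dist_pos.2 hxy
      simp only [a1, a2, a3, a4, hk, hk2, hW, ← dist_eq_norm, dist_comm y x]
      rw [← ENNReal.ofReal_mul (by positivity), ← ENNReal.ofReal_mul (by positivity),
        ← ENNReal.ofReal_mul (by positivity), ← ENNReal.ofReal_mul (by positivity),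
        ← ENNReal.ofReal_add (by positivity) (by positivity),
        ← ENNReal.ofReal_add (by positivity) (by positivity),
        ← ENNReal.ofReal_add (by positivity) (by positivity), ← ENNReal.ofReal_mul (by positivity)]
      apply ENNReal.ofReal_le_ofReal
      exact bad_pointwise hp hβ hδ hh0 hK
  calc _ ≤ ∫⁻ x in ball (0 : Eu n) t', ∫⁻ y in ball (0 : Eu n) t',
        ENNReal.ofReal (K * ‖h‖ ^ β) * (a1 x y + a2 x y + a3 x y + a4 x y) :=
        lintegral_mono fun x => lintegral_mono fun y => hpt x y
    _ = ENNReal.ofReal (K * ‖h‖ ^ β) * (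
        (∫⁻ x in ball (0 : Eu n) t', ∫⁻ y in ball (0 : Eu n) t', a1 x y) +
        (∫⁻ x in ball (0 : Eu n) t', ∫⁻ y in ball (0 : Eu n) t', a2 x y) +
        (∫⁻ x in ball (0 : Eu n) t', ∫⁻ y in ball (0 : Eu n) t', a3 x y) +
        (∫⁻ x in ball (0 : Eu n) t', ∫⁻ y in ball (0 : Eu n) t', a4 x y)) := by
        exact dbl_sum4 (by simp) m2 m3 m4
    _ ≤ ENNReal.ofReal (K * ‖h‖ ^ β) * (kL n (p-γ) * G + kL n (p-γ) * G + kL n (p-γ) * G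
        + kL n (p-γ) * G) := by gcongr
    _ = _ := by ring

theorem wq_int {n : ℕ} {u : Eu n → ℝ} {Ω : Set (Eu n)} (hΩ : IsOpen Ω)
    (hu : ContDiffOn ℝ 1 u Ω) (hum : Measurable u) (hB : closedBall 0 2 ⊆ Ω) {P : ℝ} (hP : 1 ≤ P)
    {t r : ℝ} {h : Eu n} (hh : h ≠ 0) (htr : t + ‖h‖ ≤ r) (hr : r ≤ 2) :
    ∫⁻ x in ball (0 : Eu n) t, ENNReal.ofReal ((|u (x + h) - u x| / ‖h‖) ^ P) ≤
      ∫⁻ x in ball (0 : Eu n) r, gP u P x := by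
  have hh0 : 0 < ‖h‖ := norm_pos_iff.2 hh
  have h1 := dlt_int hΩ hu hB hP htr hr
  have e : ∀ x, ENNReal.ofReal (|u (x + h) - u x| ^ P) = ENNReal.ofReal (‖h‖ ^ P) *
      ENNReal.ofReal ((|u (x + h) - u x| / ‖h‖) ^ P) := by
    intro x
    rw [← ENNReal.ofReal_mul (by positivity), Real.div_rpow (abs_nonneg _) hh0.le]
    congr 1
    have : ‖h‖ ^ P ≠ 0 := by positivity
    field_simp
  simp only [e] at h1
  rw [lintegral_const_mul _ (by fun_prop)] at h1
  have hne : ENNReal.ofReal (‖h‖ ^ P) ≠ 0 := by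
    rw [ne_eq, ENNReal.ofReal_eq_zero, not_le]; positivity
  exact (ENNReal.mul_le_mul_iff_right hne (by simp)).1 h1

theorem ofReal_rpow_frac {a P x : ℝ} (ha : 0 < a) (hP : 0 < P) :
    ENNReal.ofReal (|x| ^ a) ^ (P / a) = ENNReal.ofReal (|x| ^ P) := by
  rw [ENNReal.ofReal_rpow_of_nonneg (by positivity) (by positivity),
    ← Real.rpow_mul (abs_nonneg _), mul_div_cancel₀ _ ha.ne']

/-- weight times a nonnegative function -/
theorem weight_int {n : ℕ} {u : Eu n → ℝ} {Ω : Set (Eu n)} (hΩ : IsOpen Ω)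
    (hu : ContDiffOn ℝ 1 u Ω) (hum : Measurable u) (hB : closedBall 0 2 ⊆ Ω) {a β : ℝ} (ha : 0 < a)
    (hβ : 1 ≤ β) {t r : ℝ} {h : Eu n} (hh : h ≠ 0) (htr : t + ‖h‖ ≤ r) (hr : r ≤ 2)
    (T : Eu n → ℝ≥0∞) :
    ∫⁻ x in ball (0 : Eu n) t, ENNReal.ofReal (|u (x + h) - u x| ^ β) * T x ≤
      ENNReal.ofReal (‖h‖ ^ β) * ((∫⁻ x in ball (0 : Eu n) r, gP u (a + β) x) +
        ∫⁻ x in ball (0 : Eu n) t, T x ^ ((a + β) / a)) := by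
  have hh0 : 0 < ‖h‖ := norm_pos_iff.2 hh
  calc _ ≤ ∫⁻ x in ball (0 : Eu n) t, ENNReal.ofReal (‖h‖ ^ β) *
        (ENNReal.ofReal ((|u (x + h) - u x| / ‖h‖) ^ (a + β)) + T x ^ ((a + β) / a)) :=
        lintegral_mono fun x => young_e ha (by linarith) hh0 (abs_nonneg _) _
    _ ≤ _ := by
        rw [lintegral_const_mul' _ _ (by simp), lintegral_add_left (by fun_prop)]
        refine mul_le_mul' le_rfl (add_le_add ?_ le_rfl)
        exact wq_int hΩ hu hum hB (by linarith : 1 ≤ a + β) hh htr hr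

theorem nonloc_one {n : ℕ} {u : Eu n → ℝ} {Ω : Set (Eu n)} (hΩ : IsOpen Ω)
    (hu : ContDiffOn ℝ 1 u Ω) (hum : Measurable u) (hB : closedBall 0 2 ⊆ Ω) {a β γ : ℝ} (ha : 0 < a)
    (hβ : 1 ≤ β) (hγ : 0 ≤ γ) {t t' r : ℝ} {h : Eu n} (hh : h ≠ 0) (htr : t + ‖h‖ ≤ r) (hr : r ≤ 2)
    (hd : 0 < t' - t) (hd1 : t' - t ≤ 1) {v : Eu n → ℝ} (hv : Measurable v) (c : ℝ) :
    ∫⁻ x in ball (0 : Eu n) t, ∫⁻ y in (ball (0 : Eu n) t')ᶜ,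
      ENNReal.ofReal (|v x - v y| ^ a * |u (x + h) - u x| ^ β / dist x y ^ γ) ≤
    ENNReal.ofReal (2 ^ a * (4 / (t' - t)) ^ γ) * (ENNReal.ofReal (‖h‖ ^ β) *
      (kF n γ * ((∫⁻ x in ball (0 : Eu n) r, gP u (a + β) x) +
        ∫⁻ x in ball (0 : Eu n) t, ENNReal.ofReal (|v x - c| ^ (a + β))) +
      ((∫⁻ x in ball (0 : Eu n) r, gP u (a + β) x) +
        tailI γ a (fun y => v y - c) ^ ((a + β) / a) * volume (ball (0 : Eu n) t)))) := by
  have ht : t ≤ 2 := by have := norm_nonneg h; linarith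
  refine le_trans (nonlocal_bound ht hd hd1 hγ ha.le c hv (Ψ := fun x => |u (x + h) - u x| ^ β)
    (by fun_prop) (fun x => by positivity)) ?_
  gcongr
  have w1 := weight_int hΩ hu hum hB ha hβ hh htr hr (fun x => ENNReal.ofReal (|v x - c| ^ a))
  have w2 := weight_int hΩ hu hum hB ha hβ hh htr hr (fun x => tailI γ a (fun y => v y - c))
  simp only [ofReal_rpow_frac ha (by linarith : 0 < a + β)] at w1
  rw [setLIntegral_const] at w2
  calc _ = (∫⁻ x in ball (0 : Eu n) t, kF n γ * (ENNReal.ofReal (|u (x + h) - u x| ^ β) *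
          ENNReal.ofReal (|v x - c| ^ a))) + ∫⁻ x in ball (0 : Eu n) t,
            ENNReal.ofReal (|u (x + h) - u x| ^ β) * tailI γ a (fun y => v y - c) := by
        rw [← lintegral_add_left (by fun_prop)]
        congr 1; ext x; ring
    _ ≤ _ := by
        rw [lintegral_const_mul _ (by fun_prop), mul_add, mul_left_comm]
        gcongr

theorem key_alg {k G U T M V X Y v : ℝ≥0∞} (hX : X ≤ U) (hY : Y ≤ M * T) (hv : v ≤ V) :
    k * (G + X) + (G + Y * v) ≤ (k + 1 + M * V) * (G + U + T) := by
  calc _ ≤ k * (G + U) + (G + M * T * V) := by gcongr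
    _ ≤ k * (G + U + T) + ((G + U + T) + M * (G + U + T) * V) := by
        have h1 : G + U ≤ G + U + T := le_add_right le_rfl
        have h2 : G ≤ G + U + T := le_add_right (le_add_right le_rfl)
        have h3 : T ≤ G + U + T := le_add_left le_rfl
        gcongr
    _ = _ := by ring

theorem dbl_add {α : Type*} [MeasurableSpace α] {μ ν : Measure α} [SFinite ν]
    {A B : α → α → ℝ≥0∞} (hB : Measurable (fun z : α × α => B z.1 z.2)) :
    ∫⁻ x, ∫⁻ y, (A x y + B x y) ∂ν ∂μ =
      (∫⁻ x, ∫⁻ y, A x y ∂ν ∂μ) + ∫⁻ x, ∫⁻ y, B x y ∂ν ∂μ := by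
  have i2 : Measurable fun x => ∫⁻ y, B x y ∂ν := hB.lintegral_prod_right'
  rw [← lintegral_add_right _ i2]
  refine lintegral_congr fun x => ?_
  exact lintegral_add_right _ (hB.comp measurable_prodMk_left)

theorem nonloc_split {n : ℕ} {u : Eu n → ℝ} (hum : Measurable u) {a β γ : ℝ} {t t' : ℝ} {h : Eu n} :
    (∫⁻ x in ball (0 : Eu n) t, ∫⁻ y in (ball (0 : Eu n) t')ᶜ,
      ENNReal.ofReal ((|u (x + h) - u (y + h)| ^ a + |u x - u y| ^ a) *
        |u (x + h) - u x| ^ β / dist x y ^ γ)) =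
     (∫⁻ x in ball (0 : Eu n) t, ∫⁻ y in (ball (0 : Eu n) t')ᶜ,
      ENNReal.ofReal (|u (x + h) - u (y + h)| ^ a * |u (x + h) - u x| ^ β / dist x y ^ γ)) +
      (∫⁻ x in ball (0 : Eu n) t, ∫⁻ y in (ball (0 : Eu n) t')ᶜ,
      ENNReal.ofReal (|u x - u y| ^ a * |u (x + h) - u x| ^ β / dist x y ^ γ)) := by
  have hdm : Measurable fun z : Eu n × Eu n => dist z.1 z.2 ^ γ :=
    (measurable_fst.dist measurable_snd).pow_const _
  have hm : Measurable (fun z : Eu n × Eu n =>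
    ENNReal.ofReal (|u z.1 - u z.2| ^ a * |u (z.1 + h) - u z.1| ^ β / dist z.1 z.2 ^ γ)) :=
    Measurable.ennreal_ofReal (Measurable.div (by fun_prop) hdm)
  rw [← dbl_add (B := fun x y =>
    ENNReal.ofReal (|u x - u y| ^ a * |u (x + h) - u x| ^ β / dist x y ^ γ)) hm]
  refine lintegral_congr fun x => lintegral_congr fun y => ?_
  rw [← ENNReal.ofReal_add (by positivity) (by positivity), ← add_div, ← add_mul]

theorem nonloc_total {n : ℕ} {u : Eu n → ℝ} {Ω : Set (Eu n)} (hΩ : IsOpen Ω)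
    (hu : ContDiffOn ℝ 1 u Ω) (hum : Measurable u) (hB : closedBall 0 2 ⊆ Ω) {a β γ : ℝ} (ha : 0 < a)
    (hβ : 1 ≤ β) (hγ : 0 ≤ γ) {t t' r : ℝ} {h : Eu n} (hh : h ≠ 0) (hh1 : ‖h‖ ≤ 1)
    (htr : t + ‖h‖ ≤ r) (hr : r ≤ 2) {r' : ℝ} (htr' : t + ‖h‖ ≤ r')
    (hd : 0 < t' - t) (hd1 : t' - t ≤ 1) (c : ℝ) :
    ∫⁻ x in ball (0 : Eu n) t, ∫⁻ y in (ball (0 : Eu n) t')ᶜ,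
      ENNReal.ofReal ((|u (x + h) - u (y + h)| ^ a + |u x - u y| ^ a) *
        |u (x + h) - u x| ^ β / dist x y ^ γ) ≤
    ENNReal.ofReal (2 ^ a * (4 / (t' - t)) ^ γ) * (ENNReal.ofReal (‖h‖ ^ β) *
      (2 * (kF n γ + 1 + (1 + ENNReal.ofReal (2 ^ γ)) ^ ((a + β) / a) * volume (ball (0 : Eu n) 2)) *
       ((∫⁻ x in ball (0 : Eu n) r, gP u (a + β) x) +
        (∫⁻ x in ball (0 : Eu n) r', ENNReal.ofReal (|u x - c| ^ (a + β))) +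
        tailI γ a (fun y => u y - c) ^ ((a + β) / a)))) := by
  have n1 := nonloc_one hΩ hu hum hB ha hβ hγ hh htr hr hd hd1 hum c
  have n2 := nonloc_one hΩ hu hum hB ha hβ hγ hh htr hr hd hd1
    (v := fun x => u (x + h)) (by fun_prop) c
  have ht : t ≤ 2 := by have := norm_nonneg h; linarith
  have htr2 : t ≤ r' := by have := norm_nonneg h; linarith
  have hab : 0 ≤ (a + β) / a := by have : 0 < a + β := by linarith
                                   positivity
  set G := ∫⁻ x in ball (0 : Eu n) r, gP u (a + β) x
  set T := tailI γ a (fun y => u y - c) with hT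
  set U := ∫⁻ x in ball (0 : Eu n) r', ENNReal.ofReal (|u x - c| ^ (a + β))
  have u1 : ∫⁻ x in ball (0 : Eu n) t, ENNReal.ofReal (|u x - c| ^ (a + β)) ≤ U :=
    lintegral_mono_set (ball_subset_ball htr2)
  have u2 : ∫⁻ x in ball (0 : Eu n) t, ENNReal.ofReal (|u (x + h) - c| ^ (a + β)) ≤ U :=
    shift_le htr' (fun x => ENNReal.ofReal (|u x - c| ^ (a + β)))
  have t2 : tailI γ a (fun y => u (y + h) - c) ≤ ENNReal.ofReal (2 ^ γ) * T :=
    tailI_shift hγ hh1 (fun y => u y - c)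
  have vb : volume (ball (0 : Eu n) t) ≤ volume (ball (0 : Eu n) 2) :=
    measure_mono (ball_subset_ball ht)
  set V := volume (ball (0 : Eu n) 2)
  set k := kF n γ
  set M := (1 + ENNReal.ofReal (2 ^ γ)) ^ ((a + β) / a)
  have T1 : T ^ ((a + β) / a) ≤ M * T ^ ((a + β) / a) := by
    rw [← ENNReal.mul_rpow_of_nonneg _ _ hab]
    gcongr
    calc T = 1 * T := (one_mul T).symm
      _ ≤ _ := by gcongr; exact le_add_right le_rfl
  have T2 : tailI γ a (fun y => u (y + h) - c) ^ ((a + β) / a) ≤ M * T ^ ((a + β) / a) := by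
    rw [← ENNReal.mul_rpow_of_nonneg _ _ hab]
    gcongr
    exact t2.trans (by gcongr; exact le_add_left le_rfl)
  have key : ∀ X Y : ℝ≥0∞, X ≤ U → Y ≤ M * T ^ ((a + β) / a) →
      k * (G + X) + (G + Y * volume (ball (0 : Eu n) t)) ≤
      (k + 1 + M * V) * (G + U + T ^ ((a + β) / a)) := 
    fun X Y hX hY => key_alg hX hY vb
  calc _ = (∫⁻ x in ball (0 : Eu n) t, ∫⁻ y in (ball (0 : Eu n) t')ᶜ,
      ENNReal.ofReal (|u (x + h) - u (y + h)| ^ a * |u (x + h) - u x| ^ β / dist x y ^ γ)) +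
      (∫⁻ x in ball (0 : Eu n) t, ∫⁻ y in (ball (0 : Eu n) t')ᶜ,
      ENNReal.ofReal (|u x - u y| ^ a * |u (x + h) - u x| ^ β / dist x y ^ γ)) := by
        exact nonloc_split hum
    _ ≤ _ := add_le_add n2 n1
    _ ≤ ENNReal.ofReal (2 ^ a * (4 / (t' - t)) ^ γ) * (ENNReal.ofReal (‖h‖ ^ β) *
          ((k + 1 + M * V) * (G + U + T ^ ((a + β) / a)))) +
        ENNReal.ofReal (2 ^ a * (4 / (t' - t)) ^ γ) * (ENNReal.ofReal (‖h‖ ^ β) *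
          ((k + 1 + M * V) * (G + U + T ^ ((a + β) / a)))) := by
        gcongr
        · exact key _ _ u2 T2
        · exact key _ _ u1 T1
    _ = _ := by ring

theorem f_int {n : ℕ} {u f : Eu n → ℝ} {Ω : Set (Eu n)} (hΩ : IsOpen Ω)
    (hu : ContDiffOn ℝ 1 u Ω) (hum : Measurable u) (hB : closedBall 0 2 ⊆ Ω) {a β : ℝ} (ha : 0 < a)
    (hβ : 1 ≤ β) {t r : ℝ} {h k : Eu n} (hh : h ≠ 0) (htr : t + ‖h‖ ≤ r) (hr : r ≤ 2)
    (hk : t + ‖k‖ ≤ 2) :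
    ∫⁻ x in ball (0 : Eu n) t, ENNReal.ofReal (|u (x + h) - u x| ^ β) * ENNReal.ofReal |f (x + k)| ≤
      ENNReal.ofReal (‖h‖ ^ β) * ((∫⁻ x in ball (0 : Eu n) r, gP u (a + β) x) +
        ∫⁻ x in ball (0 : Eu n) 2, ENNReal.ofReal (|f x| ^ ((a + β) / a))) := by
  refine le_trans (weight_int hΩ hu hum hB ha hβ hh htr hr (fun x => ENNReal.ofReal |f (x + k)|)) ?_
  refine mul_le_mul' le_rfl (add_le_add le_rfl ?_)
  have : 0 < a + β := by linarith
  have e : ∀ x, ENNReal.ofReal |f x| ^ ((a+β)/a) = ENNReal.ofReal (|f x| ^ ((a + β) / a)) := by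
    intro x
    rw [ENNReal.ofReal_rpow_of_nonneg (by positivity) (by positivity)]
  refine le_trans (le_of_eq (lintegral_congr fun x => e (x + k))) ?_
  exact shift_le hk (fun x => ENNReal.ofReal (|f x| ^ ((a + β) / a)))

def WeakId {n : ℕ} (p γ : ℝ) (u f : Eu n → ℝ) : Prop :=
  ∀ φ : Eu n → ℝ, (∃ K : ℝ, ∀ x y, |φ x - φ y| ≤ K * dist x y) →
    (∃ t < (2:ℝ), ∀ x ∉ ball (0 : Eu n) t, φ x = 0) →
    ∫ x, ∫ y, Jp p (u x - u y) * (φ x - φ y) / dist x y ^ γ = ∫ x, f x * φ x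

theorem shift_identity {n : ℕ} {u f : Eu n → ℝ} {Ω : Set (Eu n)} (hΩ : IsOpen Ω)
    (hu : ContDiffOn ℝ 1 u Ω) (hum : Measurable u) (hB : closedBall 0 2 ⊆ Ω)
    {p γ : ℝ} (hp : 1 < p) (hγ : (n:ℝ) < γ) (hγ2 : γ < n + p)
    (htail : tailI γ (p - 1) u < ⊤) (hweak : WeakId p γ u f)
    {t t' K M : ℝ} {h : Eu n} (hd : 0 < t' - t) (hd1 : t' - t ≤ 1) (ht'h : t' + ‖h‖ ≤ 2)
    (hh1 : ‖h‖ ≤ 1)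
    {ψ : Eu n → ℝ} (hψm : Measurable ψ) (hK0 : 0 ≤ K) (hK : ∀ x y, |ψ x - ψ y| ≤ K * dist x y)
    (hM : ∀ x, |ψ x| ≤ M) (hψ0 : ∀ x ∉ ball (0 : Eu n) t, ψ x = 0) :
    Integrable (fun z : Eu n × Eu n => (Jp p (u (z.1 + h) - u (z.2 + h)) - Jp p (u z.1 - u z.2)) *
      (ψ z.1 - ψ z.2) / dist z.1 z.2 ^ γ) (volume.prod volume) ∧
    ∫ z : Eu n × Eu n, (Jp p (u (z.1 + h) - u (z.2 + h)) - Jp p (u z.1 - u z.2)) *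
      (ψ z.1 - ψ z.2) / dist z.1 z.2 ^ γ ∂(volume.prod volume) =
      (∫ x, f (x + h) * ψ x) - ∫ x, f x * ψ x := by
  have hh0 := norm_nonneg h
  have hn : (0:ℝ) ≤ n := Nat.cast_nonneg n
  obtain ⟨L, hL0, -, hLb, hLL⟩ := lip_ball hΩ hu hB
  have ht' : t' ≤ 2 := by linarith
  have ht : t ≤ 2 := by linarith
  have mem1 : ∀ x ∈ ball (0 : Eu n) t', x ∈ closedBall (0 : Eu n) 2 := fun x hx =>
    ball_subset_closedBall (ball_subset_ball ht' hx)
  have mem2 : ∀ x ∈ ball (0 : Eu n) t', x + h ∈ closedBall (0 : Eu n) 2 := fun x hx =>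
    ball_subset_closedBall (shift_mem ht'h hx)
  have htt : ball (0 : Eu n) t ⊆ ball 0 t' := ball_subset_ball (by linarith)
  have I1 := integrable_form hp ht ht' hd hd1 hγ hγ2 hum hψm hψ0
    (fun x hx y hy => hLL x (mem1 x hx) y (mem1 y hy)) hK hK0 hL0 hM
    (fun x hx => hLb x (mem1 x (htt hx))) htail
  have I2 := integrable_form (u := fun x => u (x + h)) hp ht ht' hd hd1 hγ hγ2 (by fun_prop) hψm hψ0
    (fun x hx y hy => by
      have := hLL _ (mem2 x hx) _ (mem2 y hy)
      rwa [dist_add_right] at this) hK hK0 hL0 hM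
    (fun x hx => hLb _ (mem2 x (htt hx)))
    (lt_of_le_of_lt (tailI_shift (by linarith) hh1 u) (ENNReal.mul_lt_top (by simp) htail))
  have e : (fun z : Eu n × Eu n => (Jp p (u (z.1 + h) - u (z.2 + h)) - Jp p (u z.1 - u z.2)) *
      (ψ z.1 - ψ z.2) / dist z.1 z.2 ^ γ) = fun z =>
      Jp p (u (z.1 + h) - u (z.2 + h)) * (ψ z.1 - ψ z.2) / dist z.1 z.2 ^ γ -
      Jp p (u z.1 - u z.2) * (ψ z.1 - ψ z.2) / dist z.1 z.2 ^ γ := by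
    ext z; ring
  rw [e]
  refine ⟨I2.sub I1, ?_⟩
  rw [integral_sub I2 I1, integral_prod _ I2, integral_prod _ I1]
  have w1 := hweak ψ ⟨K, hK⟩ ⟨t, by linarith, hψ0⟩
  have w2 := hweak (fun x => ψ (x - h)) ⟨K, fun x y => by
      have := hK (x - h) (y - h)
      rwa [dist_sub_right] at this⟩ ⟨t + ‖h‖, by linarith, fun x hx => by
      apply hψ0
      intro hx'
      apply hx
      have := shift_mem (h := h) (le_refl (t + ‖h‖)) hx'
      rwa [sub_add_cancel] at this⟩
  rw [w1]
  congr 1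
  have e2 : ∫ x, f x * ψ (x - h) = ∫ x, f (x + h) * ψ x := by
    rw [← integral_add_right_eq_self _ h]
    simp
  rw [← e2, ← w2, ← integral_add_right_eq_self
    (fun x => ∫ y, Jp p (u x - u y) * (ψ (x - h) - ψ (y - h)) / dist x y ^ γ) h]
  refine integral_congr_ae (Filter.Eventually.of_forall fun x => ?_)
  simp only
  rw [← integral_add_right_eq_self (fun y => Jp p (u (x + h) - u y) * (ψ (x + h - h) - ψ (y - h)) /
    dist (x + h) y ^ γ) h]
  simp only [add_sub_cancel_right, dist_add_right]

/-- cutoff function -/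
def cut {n : ℕ} (t d : ℝ) (x : Eu n) : ℝ := max 0 (min 1 ((t - ‖x‖) * (4 / d)))

theorem cut_nonneg {n : ℕ} (t d : ℝ) (x : Eu n) : 0 ≤ cut t d x := le_max_left _ _

theorem cut_le_one {n : ℕ} (t d : ℝ) (x : Eu n) : cut t d x ≤ 1 :=
  max_le zero_le_one (min_le_left _ _)

theorem cut_eq_one {n : ℕ} {t d : ℝ} (hd : 0 < d) {x : Eu n} (hx : x ∈ ball (0 : Eu n) (t - d/4)) :
    cut t d x = 1 := by
  rw [mem_ball_zero_iff] at hx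
  have : 1 ≤ (t - ‖x‖) * (4 / d) := by
    rw [← mul_div_assoc, le_div_iff₀ hd]; linarith
  unfold cut
  rw [min_eq_left this]; simp

theorem cut_eq_zero {n : ℕ} {t d : ℝ} (hd : 0 < d) {x : Eu n} (hx : x ∉ ball (0 : Eu n) t) :
    cut t d x = 0 := by
  rw [mem_ball_zero_iff, not_lt] at hx
  have : (t - ‖x‖) * (4 / d) ≤ 0 := mul_nonpos_of_nonpos_of_nonneg (by linarith) (by positivity)
  unfold cut
  exact max_eq_left ((min_le_right _ _).trans this)

theorem cut_lip {n : ℕ} {t d : ℝ} (hd : 0 < d) (x y : Eu n) :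
    |cut t d x - cut t d y| ≤ 4 / d * dist x y := by
  unfold cut
  have h1 : ∀ a b : ℝ, |max 0 a - max 0 b| ≤ |a - b| := fun a b => by
    have := abs_max_sub_max_le_max 0 a 0 b
    simpa using this
  have h2 : ∀ a b : ℝ, |min 1 a - min 1 b| ≤ |a - b| := fun a b => by
    have := abs_min_sub_min_le_max 1 a 1 b
    simpa using this
  refine (h1 _ _).trans ((h2 _ _).trans ?_)
  rw [← sub_mul, abs_mul, abs_of_pos (by positivity : 0 < 4 / d), mul_comm]
  gcongr
  rw [sub_sub_sub_cancel_left, dist_comm, dist_eq_norm]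
  exact abs_norm_sub_norm_le _ _

theorem measurable_cut {n : ℕ} (t d : ℝ) : Measurable (cut t d : Eu n → ℝ) := by
  unfold cut; fun_prop

/-- Lipschitz property of the test function -/
theorem test_lip {n : ℕ} {t d L M β : ℝ} (hd : 0 < d) (hβ : 1 ≤ β) (hL0 : 0 ≤ L) (hM0 : 0 ≤ M) {w : Eu n → ℝ}
    (hw : ∀ x ∈ ball (0 : Eu n) (t + d/4), ∀ y ∈ ball (0 : Eu n) (t + d/4), |w x - w y| ≤ L * dist x y)
    (hwM : ∀ x ∈ ball (0 : Eu n) (t + d/4), |w x| ≤ M) :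
    ∀ x y, |cut t d x * Jp (β + 1) (w x) - cut t d y * Jp (β + 1) (w y)| ≤
      (β * M ^ (β - 1) * L + M ^ β * (4/d)) * dist x y := by
  have hbt : ball (0 : Eu n) t ⊆ ball 0 (t + d/4) := ball_subset_ball (by linarith)
  have hJ : ∀ x ∈ ball (0 : Eu n) (t + d/4), |Jp (β + 1) (w x)| ≤ M ^ β := fun x hx => by
    rw [abs_Jp (by linarith), add_sub_cancel_right]
    exact Real.rpow_le_rpow (abs_nonneg _) (hwM x hx) (by linarith)
  have far : ∀ x ∈ ball (0 : Eu n) t, ∀ y ∉ ball (0 : Eu n) (t + d/4),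
      |cut t d x * Jp (β + 1) (w x) - cut t d y * Jp (β + 1) (w y)| ≤
      (β * M ^ (β - 1) * L + M ^ β * (4/d)) * dist x y := by
    intro x hx y hy
    rw [cut_eq_zero hd (fun h => hy (hbt h)), zero_mul, sub_zero, abs_mul, abs_of_nonneg (cut_nonneg _ _ _)]
    have h1 := hJ x (hbt hx)
    have h2 := cut_le_one t d x
    have h3 : 1 ≤ 4 / d * dist x y := by
      rw [mem_ball_zero_iff] at hx
      rw [mem_ball_zero_iff, not_lt] at hy
      have := norm_sub_norm_le y x
      rw [dist_comm, dist_eq_norm, div_mul_eq_mul_div, le_div_iff₀ hd]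
      linarith
    calc _ ≤ 1 * M ^ β := by gcongr
      _ ≤ M ^ β * (4 / d * dist x y) := by
        rw [one_mul]; exact le_mul_of_one_le_right (by positivity) h3
      _ ≤ _ := by
        rw [add_mul, mul_assoc (M ^ β)]
        exact le_add_of_nonneg_left (by positivity)
  intro x y
  by_cases hx : x ∈ ball (0 : Eu n) (t + d/4) <;> by_cases hy : y ∈ ball (0 : Eu n) (t + d/4)
  · have e : cut t d x * Jp (β + 1) (w x) - cut t d y * Jp (β + 1) (w y) =
      cut t d x * (Jp (β + 1) (w x) - Jp (β + 1) (w y)) + Jp (β + 1) (w y) * (cut t d x - cut t d y) := by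
      ring
    rw [e]
    have h1 := Jp_lip (p := β + 1) (by linarith) (hwM x hx) (hwM y hy)
    have h2 := cut_le_one t d x
    have e1 : β + 1 - 1 = β := by ring
    have e2 : β + 1 - 2 = β - 1 := by ring
    rw [e1, e2] at h1
    calc _ ≤ |cut t d x| * |Jp (β + 1) (w x) - Jp (β + 1) (w y)| +
          |Jp (β + 1) (w y)| * |cut t d x - cut t d y| := by
          rw [← abs_mul, ← abs_mul]; exact abs_add_le _ _
      _ ≤ 1 * (β * M ^ (β - 1) * (L * dist x y)) + M ^ β * (4 / d * dist x y) := by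
          rw [abs_of_nonneg (cut_nonneg t d x)]
          gcongr
          · exact h1.trans (by gcongr; exact hw x hx y hy)
          · exact hJ y hy
          · exact cut_lip hd x y
      _ = _ := by ring
  · by_cases hx' : x ∈ ball (0 : Eu n) t
    · exact far x hx' y hy
    · rw [cut_eq_zero hd hx', cut_eq_zero hd (fun h => hy (hbt h))]; simp; positivity
  · by_cases hy' : y ∈ ball (0 : Eu n) t
    · rw [abs_sub_comm, dist_comm]; exact far y hy' x hx
    · rw [cut_eq_zero hd hy', cut_eq_zero hd (fun h => hx (hbt h))]; simp; positivity
  · rw [cut_eq_zero hd (fun h => hx (hbt h)), cut_eq_zero hd (fun h => hy (hbt h))]; simp; positivity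

theorem loc_real {J1 J2 g1 g2 e1 e2 A1 A2 B1 B2 κ m D : ℝ} (hJ1 : |J1| ≤ A1) (hJ2 : |J2| ≤ A2)
    (hg1 : |g1| ≤ B1) (hg2 : |g2| ≤ B2) (hpos : 0 ≤ (J1 - J2) * (g1 - g2))
    (he : |e1 - e2| ≤ κ) (hm : m ≤ (e1 + e2) / 2) (hD : 0 ≤ D) :
    (J1 - J2) * (g1 - g2) * m * D ≤ (J1 - J2) * (e1 * g1 - e2 * g2) * D +
      (A1 + A2) * ((B1 + B2) / 2) * κ * D := by
  rw [← add_mul]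
  refine mul_le_mul_of_nonneg_right ?_ hD
  have h1 : (J1 - J2) * (g1 - g2) * m ≤ (J1 - J2) * (g1 - g2) * ((e1 + e2) / 2) := by gcongr
  have h2 : |(J1 - J2) * ((g1 + g2) / 2) * (e1 - e2)| ≤ (A1 + A2) * ((B1 + B2) / 2) * κ := by
    rw [abs_mul, abs_mul, abs_div, abs_two]
    have a1 : |J1 - J2| ≤ A1 + A2 := (abs_sub _ _).trans (by linarith)
    have a2 : |g1 + g2| ≤ B1 + B2 := (abs_add_le _ _).trans (by linarith)
    have a3 := (abs_nonneg (J1 - J2)).trans a1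
    have a4 := (abs_nonneg (g1 + g2)).trans a2
    gcongr
  have h3 := neg_abs_le ((J1 - J2) * ((g1 + g2) / 2) * (e1 - e2))
  have h4 : (J1 - J2) * (e1 * g1 - e2 * g2) = (J1 - J2) * (g1 - g2) * ((e1 + e2) / 2) +
    (J1 - J2) * ((g1 + g2) / 2) * (e1 - e2) := by ring
  linarith

/-- the good density -/
def goodR {n : ℕ} (u : Eu n → ℝ) (h : Eu n) (p β γ : ℝ) (z : Eu n × Eu n) : ℝ :=
  (Jp p (u (z.1 + h) - u (z.2 + h)) - Jp p (u z.1 - u z.2)) *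
    (Jp (β + 1) (u (z.1 + h) - u z.1) - Jp (β + 1) (u (z.2 + h) - u z.2)) / dist z.1 z.2 ^ γ

theorem good_pos {n : ℕ} (u : Eu n → ℝ) (h : Eu n) {p β : ℝ} (hp : 1 < p) (hβ : 1 ≤ β) (x y : Eu n) :
    0 ≤ (Jp p (u (x + h) - u (y + h)) - Jp p (u x - u y)) *
    (Jp (β + 1) (u (x + h) - u x) - Jp (β + 1) (u (y + h) - u y)) :=
  Jp_prod_nonneg hp hβ _ _ _ _ (by ring)

/-- nonlocal dominating density -/
def farH {n : ℕ} (u : Eu n → ℝ) (h : Eu n) (p β γ : ℝ) (z : Eu n × Eu n) : ℝ :=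
  (|u (z.1 + h) - u (z.2 + h)| ^ (p-1) + |u z.1 - u z.2| ^ (p-1)) *
        |u (z.1 + h) - u z.1| ^ β / dist z.1 z.2 ^ γ

def formF {n : ℕ} (u ψ : Eu n → ℝ) (h : Eu n) (p γ : ℝ) (z : Eu n × Eu n) : ℝ :=
  (Jp p (u (z.1 + h) - u (z.2 + h)) - Jp p (u z.1 - u z.2)) * (ψ z.1 - ψ z.2) / dist z.1 z.2 ^ γ

def testψ {n : ℕ} (u : Eu n → ℝ) (h : Eu n) (β t d : ℝ) (x : Eu n) : ℝ :=
  cut t d x * Jp (β + 1) (u (x + h) - u x)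

theorem testψ_abs {n : ℕ} (u : Eu n → ℝ) (h : Eu n) {β : ℝ} (hβ : 1 ≤ β) (t d : ℝ) (x : Eu n) :
    |testψ u h β t d x| ≤ |u (x + h) - u x| ^ β := by
  unfold testψ
  rw [abs_mul, abs_Jp (by linarith), add_sub_cancel_right, abs_of_nonneg (cut_nonneg _ _ _)]
  exact mul_le_of_le_one_left (by positivity) (cut_le_one _ _ _)

theorem far_bound {n : ℕ} (u : Eu n → ℝ) (h : Eu n) {p β γ t d : ℝ} (hp : 1 < p) (hβ : 1 ≤ β)
    (x y : Eu n) (hy : testψ u h β t d y = 0) :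
    |formF u (testψ u h β t d) h p γ (x, y)| ≤ farH u h p β γ (x, y) := by
  unfold formF farH
  simp only
  rw [hy, sub_zero, abs_div, abs_mul, abs_of_nonneg (by positivity : 0 ≤ dist x y ^ γ)]
  gcongr
  · refine (abs_sub _ _).trans ?_
    rw [abs_Jp hp, abs_Jp hp]
  · exact testψ_abs u h hβ t d x

theorem far_symm {n : ℕ} (u ψ : Eu n → ℝ) (h : Eu n) {p γ : ℝ} (x y : Eu n) :
    formF u ψ h p γ (x, y) = formF u ψ h p γ (y, x) := by
  unfold formF
  simp only
  rw [← neg_sub (u (y + h)), ← neg_sub (u y), Jp_neg, Jp_neg, dist_comm]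
  ring

theorem energy_pointwise {n : ℕ} (u : Eu n → ℝ) (h : Eu n) {p β γ t d : ℝ} (hp : 1 < p) (hβ : 1 ≤ β)
    (hd : 0 < d) (z : Eu n × Eu n) :
    (ball (0 : Eu n) (t - d/4) ×ˢ ball (0 : Eu n) (t - d/4)).indicator
      (fun z => ENNReal.ofReal (goodR u h p β γ z)) z +
      ENNReal.ofReal (- formF u (testψ u h β t d) h p γ z) ≤
    ENNReal.ofReal (formF u (testψ u h β t d) h p γ z) +
      QT t (t + d/4) (fun z => ENNReal.ofReal (badA u h p β γ (4/d) z))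
        (fun z => ENNReal.ofReal (farH u h p β γ z)) z := by
  obtain ⟨x, y⟩ := z
  have hbt : ball (0 : Eu n) t ⊆ ball 0 (t + d/4) := ball_subset_ball (by linarith)
  have hbi : ball (0 : Eu n) (t - d/4) ⊆ ball 0 (t + d/4) := ball_subset_ball (by linarith)
  have hz : ∀ x ∉ ball (0 : Eu n) t, testψ u h β t d x = 0 := fun x hx => by
    unfold testψ; rw [cut_eq_zero hd hx, zero_mul]
  have hneg : ∀ a : ℝ, ENNReal.ofReal (-a) ≤ ENNReal.ofReal |a| := fun a =>
    ENNReal.ofReal_le_ofReal (neg_le_abs a)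
  by_cases hx' : x ∈ ball (0 : Eu n) (t + d/4) <;> by_cases hy' : y ∈ ball (0 : Eu n) (t + d/4)
  · have hmem : (x, y) ∈ ball (0 : Eu n) (t + d/4) ×ˢ ball (0 : Eu n) (t + d/4) := ⟨hx', hy'⟩
    unfold QT
    rw [indicator_of_mem hmem]
    refine le_trans ?_ (add_le_add le_rfl (le_trans (le_add_right le_rfl) (le_add_right le_rfl)))
    set m : ℝ := (ball (0 : Eu n) (t - d/4) ×ˢ ball (0 : Eu n) (t - d/4)).indicator (fun _ => (1:ℝ)) (x, y)
      with hm
    have hm0 : 0 ≤ m := indicator_nonneg (fun _ _ => zero_le_one) _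
    have hmle : m ≤ (cut t d x + cut t d y) / 2 := by
      by_cases hin : (x, y) ∈ ball (0 : Eu n) (t - d/4) ×ˢ ball (0 : Eu n) (t - d/4)
      · rw [hm, indicator_of_mem hin, cut_eq_one hd hin.1, cut_eq_one hd hin.2]; norm_num
      · rw [hm, indicator_of_notMem hin]
        have := cut_nonneg t d x; have := cut_nonneg t d y; linarith
    have e1 : (ball (0 : Eu n) (t - d/4) ×ˢ ball (0 : Eu n) (t - d/4)).indicator
      (fun z => ENNReal.ofReal (goodR u h p β γ z)) (x, y) =
      ENNReal.ofReal ((Jp p (u (x + h) - u (y + h)) - Jp p (u x - u y)) *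
    (Jp (β + 1) (u (x + h) - u x) - Jp (β + 1) (u (y + h) - u y)) * m * (dist x y ^ γ)⁻¹) := by
      by_cases hin : (x, y) ∈ ball (0 : Eu n) (t - d/4) ×ˢ ball (0 : Eu n) (t - d/4)
      · rw [hm, indicator_of_mem hin, indicator_of_mem hin, mul_one, goodR, div_eq_mul_inv]
      · rw [hm, indicator_of_notMem hin, indicator_of_notMem hin]; simp
    rw [e1]
    have hpos := good_pos u h hp hβ x y
    refine comp_pointwise (by positivity) ?_ ?_
    · unfold badA; positivity
    · have := loc_real (J1 := Jp p (u (x + h) - u (y + h))) (J2 := Jp p (u x - u y))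
        (g1 := Jp (β + 1) (u (x + h) - u x)) (g2 := Jp (β + 1) (u (y + h) - u y))
        (abs_Jp hp _).le (abs_Jp hp _).le (abs_Jp (by linarith) _).le (abs_Jp (by linarith) _).le
        hpos (cut_lip hd x y) hmle (by positivity : 0 ≤ (dist x y ^ γ)⁻¹)
      rw [add_sub_cancel_right] at this
      unfold formF badA testψ
      simpa only [div_eq_mul_inv] using this
  · have hin : (x, y) ∉ ball (0 : Eu n) (t - d/4) ×ˢ ball (0 : Eu n) (t - d/4) :=
      fun hh => hy' (hbi hh.2)
    have hψy := hz y (fun h => hy' (hbt h))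
    rw [indicator_of_notMem hin, zero_add]
    by_cases hx : x ∈ ball (0 : Eu n) t
    · have hmem : (x, y) ∈ ball (0 : Eu n) t ×ˢ (ball (0 : Eu n) (t + d/4))ᶜ := ⟨hx, hy'⟩
      unfold QT
      rw [indicator_of_mem hmem]
      refine le_trans ?_ (le_trans (le_trans (le_add_left le_rfl) (le_add_right le_rfl)) (le_add_left le_rfl))
      exact (hneg _).trans (ENNReal.ofReal_le_ofReal (far_bound u h hp hβ x y hψy))
    · simp [formF, hψy, hz x hx]
  · have hin : (x, y) ∉ ball (0 : Eu n) (t - d/4) ×ˢ ball (0 : Eu n) (t - d/4) :=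
      fun hh => hx' (hbi hh.1)
    have hψx := hz x (fun h => hx' (hbt h))
    rw [indicator_of_notMem hin, zero_add]
    by_cases hy : y ∈ ball (0 : Eu n) t
    · have hmem : (y, x) ∈ ball (0 : Eu n) t ×ˢ (ball (0 : Eu n) (t + d/4))ᶜ := ⟨hy, hx'⟩
      unfold QT
      rw [Prod.swap_prod_mk, indicator_of_mem hmem]
      refine le_trans ?_ (le_trans (le_add_left le_rfl) (le_add_left le_rfl))
      rw [far_symm]
      exact (hneg _).trans (ENNReal.ofReal_le_ofReal (far_bound u h hp hβ y x hψx))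
    · simp [formF, hψx, hz y hy]
  · have hin : (x, y) ∉ ball (0 : Eu n) (t - d/4) ×ˢ ball (0 : Eu n) (t - d/4) :=
      fun hh => hx' (hbi hh.1)
    rw [indicator_of_notMem hin, zero_add]
    simp [formF, hz x (fun h => hx' (hbt h)), hz y (fun h => hy' (hbt h))]

theorem f_term {n : ℕ} {u f : Eu n → ℝ} {Ω : Set (Eu n)} (hΩ : IsOpen Ω)
    (hu : ContDiffOn ℝ 1 u Ω) (hum : Measurable u) (hB : closedBall 0 2 ⊆ Ω) {a β d : ℝ} (ha : 0 < a)
    (hβ : 1 ≤ β) (hd : 0 < d) {t r : ℝ} {h k : Eu n} (hh : h ≠ 0) (htr : t + ‖h‖ ≤ r) (hr : r ≤ 2)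
    (hk : t + ‖k‖ ≤ 2) :
    ENNReal.ofReal |∫ x, f (x + k) * testψ u h β t d x| ≤
      ENNReal.ofReal (‖h‖ ^ β) * ((∫⁻ x in ball (0 : Eu n) r, gP u (a + β) x) +
        ∫⁻ x in ball (0 : Eu n) 2, ENNReal.ofReal (|f x| ^ ((a + β) / a))) := by
  refine le_trans ?_ (f_int (f := f) hΩ hu hum hB ha hβ hh htr hr hk)
  rw [← Real.norm_eq_abs, ofReal_norm]
  refine (enorm_integral_le_lintegral_enorm _).trans ?_
  rw [← lintegral_indicator measurableSet_ball]
  refine lintegral_mono fun x => ?_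
  by_cases hx : x ∈ ball (0 : Eu n) t
  · rw [indicator_of_mem hx, ← ofReal_norm, norm_mul, Real.norm_eq_abs, Real.norm_eq_abs, mul_comm,
      ENNReal.ofReal_mul (abs_nonneg _)]
    gcongr
    exact testψ_abs u h hβ t d x
  · rw [indicator_of_notMem hx]
    simp [testψ, cut_eq_zero hd hx]

theorem measurable_goodR {n : ℕ} {u : Eu n → ℝ} (hum : Measurable u) (h : Eu n) (p β γ : ℝ) :
    Measurable (goodR u h p β γ) := by
  have hJ := measurable_Jp p
  have hJ2 := measurable_Jp (β + 1)
  have hdm : Measurable fun z : Eu n × Eu n => dist z.1 z.2 ^ γ :=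
    (measurable_fst.dist measurable_snd).pow_const _
  unfold goodR
  exact ((hJ.comp (by fun_prop)).sub (hJ.comp (by fun_prop)) |>.mul
    ((hJ2.comp (by fun_prop)).sub (hJ2.comp (by fun_prop)))).div hdm

theorem measurable_testψ {n : ℕ} {u : Eu n → ℝ} (hum : Measurable u) (h : Eu n) (β t d : ℝ) :
    Measurable (testψ u h β t d) := by
  unfold testψ
  exact (measurable_cut t d).mul ((measurable_Jp (β+1)).comp (by fun_prop))

theorem measurable_formF {n : ℕ} {u ψ : Eu n → ℝ} (hum : Measurable u) (hψ : Measurable ψ) (h : Eu n)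
    (p γ : ℝ) : Measurable (formF u ψ h p γ) := by
  have hJ := measurable_Jp p
  have hdm : Measurable fun z : Eu n × Eu n => dist z.1 z.2 ^ γ :=
    (measurable_fst.dist measurable_snd).pow_const _
  unfold formF
  exact (((hJ.comp (by fun_prop)).sub (hJ.comp (by fun_prop))).mul (by fun_prop)).div hdm

theorem measurable_badA {n : ℕ} {u : Eu n → ℝ} (hum : Measurable u) (h : Eu n) (p β γ K : ℝ) :
    Measurable (badA u h p β γ K) := by
  have hdm : Measurable fun z : Eu n × Eu n => dist z.1 z.2 ^ γ :=
    (measurable_fst.dist measurable_snd).pow_const _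
  have hdm' : Measurable fun z : Eu n × Eu n => dist z.1 z.2 :=
    (measurable_fst.dist measurable_snd)
  unfold badA
  exact ((by fun_prop : Measurable _).mul (hdm'.const_mul K)).div hdm

theorem measurable_farH {n : ℕ} {u : Eu n → ℝ} (hum : Measurable u) (h : Eu n) (p β γ : ℝ) :
    Measurable (farH u h p β γ) := by
  have hdm : Measurable fun z : Eu n × Eu n => dist z.1 z.2 ^ γ :=
    (measurable_fst.dist measurable_snd).pow_const _
  unfold farH
  exact (by fun_prop : Measurable _).div hdm

def cEn (n : ℕ) (p β γ : ℝ) : ℝ≥0∞ :=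
  2 + 16 * kL n (p - γ) + ENNReal.ofReal (2 ^ (p-1) * 16 ^ γ) * (4 * (kF n γ + 1 +
    (1 + ENNReal.ofReal (2 ^ γ)) ^ ((p - 1 + β) / (p-1)) * volume (ball (0 : Eu n) 2)))

theorem cEn_fin {n : ℕ} {p β γ : ℝ} (hp : 1 < p) (hβ : 1 ≤ β) (hγ : (n:ℝ) < γ) (hγ2 : γ < n + p) :
    cEn n p β γ < ⊤ := by
  unfold cEn
  have h1 : kL n (p - γ) < ⊤ := kL_fin (by linarith)
  have h2 : kF n γ < ⊤ := kerFar n hγ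
  have h3 : volume (ball (0 : Eu n) 2) < ⊤ := measure_ball_lt_top
  have h4 : (1 + ENNReal.ofReal (2 ^ γ)) ^ ((p - 1 + β) / (p-1)) < ⊤ := by
    apply ENNReal.rpow_lt_top_of_nonneg
    · exact div_nonneg (by linarith) (by linarith)
    · simp
  refine ENNReal.add_lt_top.2 ⟨ENNReal.add_lt_top.2 ⟨by simp, ENNReal.mul_lt_top (by simp) h1⟩,
    ENNReal.mul_lt_top (by simp) (ENNReal.mul_lt_top (by simp) (ENNReal.add_lt_top.2
      ⟨ENNReal.add_lt_top.2 ⟨h2, by simp⟩, ENNReal.mul_lt_top h4 h3⟩))⟩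

theorem energy_alg {X I1 I2 A H hb hbd κ κ2 k K2 G U T F : ℝ≥0∞}
    (hX : X ≤ (I1 + I2) + (A + 2 * H))
    (hI1 : I1 ≤ hb * (G + F)) (hI2 : I2 ≤ hb * (G + F)) (hA : A ≤ κ * (4 * k * G))
    (hH : H ≤ κ2 * (hb * (2 * K2 * (G + U + T)))) {c : ℝ≥0∞}
    (e1 : hb ≤ hbd) (e2 : κ ≤ 4 * hbd) (e3 : κ2 * hb ≤ c * hbd) :
    X ≤ (2 + 16 * k + c * (4 * K2)) * hbd * (G + U + T + F) := by
  have h1 : G + F ≤ G + U + T + F := by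
    refine add_le_add ?_ le_rfl
    exact le_add_right (le_add_right le_rfl)
  have h2 : G ≤ G + U + T + F := le_add_right (le_add_right (le_add_right le_rfl))
  have h3 : G + U + T ≤ G + U + T + F := le_add_right le_rfl
  calc X ≤ (hb * (G + F) + hb * (G + F)) + (κ * (4 * k * G) + 2 * (κ2 * (hb * (2 * K2 * (G + U + T))))) := by
        refine hX.trans ?_; gcongr
    _ = 2 * hb * (G + F) + 4 * κ * k * G + (κ2 * hb) * (4 * K2) * (G + U + T) := by ring
    _ ≤ 2 * hbd * (G + U + T + F) + 4 * (4 * hbd) * k * (G + U + T + F) +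
        (c * hbd) * (4 * K2) * (G + U + T + F) := by gcongr
    _ = _ := by ring

theorem energy {n : ℕ} {u f : Eu n → ℝ} {Ω : Set (Eu n)} (hΩ : IsOpen Ω)
    (hu : ContDiffOn ℝ 1 u Ω) (hum : Measurable u) (hB : closedBall 0 2 ⊆ Ω)
    {p β γ : ℝ} (hp : 1 < p) (hβ : 1 ≤ β) (hγ : (n:ℝ) < γ) (hγ2 : γ < n + p)
    (htail : tailI γ (p - 1) u < ⊤) (hweak : WeakId p γ u f) (c : ℝ)
    {ρ d : ℝ} {h : Eu n} (hd : 0 < d) (hd1 : d ≤ 1) (hρ : ρ + d ≤ 2) (hh : h ≠ 0)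
    (hhd : ‖h‖ ≤ d / 16) :
    ∫⁻ x in ball (0 : Eu n) (ρ + d/4), ∫⁻ y in ball (0 : Eu n) (ρ + d/4),
      ENNReal.ofReal (goodR u h p β γ (x, y)) ≤
    cEn n p β γ * ENNReal.ofReal (d ^ (-(γ + 1)) * ‖h‖ ^ β) *
      ((∫⁻ x in ball (0 : Eu n) (ρ + d), gP u (p - 1 + β) x) +
       (∫⁻ x in ball (0 : Eu n) (ρ + 3/4*d), ENNReal.ofReal (|u x - c| ^ (p - 1 + β))) +
       tailI γ (p - 1) (fun y => u y - c) ^ ((p - 1 + β) / (p - 1)) +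
       ∫⁻ x in ball (0 : Eu n) 2, ENNReal.ofReal (|f x| ^ ((p - 1 + β) / (p - 1)))) := by
  have hn : (0:ℝ) ≤ n := Nat.cast_nonneg n
  have hh0 : 0 < ‖h‖ := norm_pos_iff.2 hh
  set t := ρ + d/2 with ht
  have et : ρ + d/4 = t - d/4 := by rw [ht]; ring
  have hp1 : 0 < p - 1 := by linarith
  obtain ⟨L, hL0, -, hLb, hLL⟩ := lip_ball hΩ hu hB
  have mem1 : ∀ x ∈ ball (0 : Eu n) (t + d/4), x ∈ closedBall (0 : Eu n) 2 := fun x hx =>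
    ball_subset_closedBall (ball_subset_ball (by linarith) hx)
  have mem2 : ∀ x ∈ ball (0 : Eu n) (t + d/4), x + h ∈ closedBall (0 : Eu n) 2 := fun x hx =>
    ball_subset_closedBall (shift_mem (by linarith) hx)
  have hwM : ∀ x ∈ ball (0 : Eu n) (t + d/4), |u (x + h) - u x| ≤ 2 * L := fun x hx => by
    have h1 := hLb _ (mem1 x hx)
    have h2 := hLb _ (mem2 x hx)
    exact (abs_sub _ _).trans (by linarith)
  have hwL : ∀ x ∈ ball (0 : Eu n) (t + d/4), ∀ y ∈ ball (0 : Eu n) (t + d/4),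
      |(u (x + h) - u x) - (u (y + h) - u y)| ≤ 2 * L * dist x y := fun x hx y hy => by
    have h1 := hLL _ (mem1 x hx) _ (mem1 y hy)
    have h2 := hLL _ (mem2 x hx) _ (mem2 y hy)
    rw [dist_add_right] at h2
    have e : (u (x + h) - u x) - (u (y + h) - u y) = (u (x+h) - u (y+h)) - (u x - u y) := by ring
    rw [e]
    exact (abs_sub _ _).trans (by linarith)
  have hψL := test_lip (t := t) hd hβ (by positivity : 0 ≤ 2 * L) (by positivity : 0 ≤ 2 * L) hwL hwM
  have hψm := measurable_testψ hum h β t d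
  have hψ0 : ∀ x ∉ ball (0 : Eu n) t, testψ u h β t d x = 0 := fun x hx => by
    unfold testψ; rw [cut_eq_zero hd hx, zero_mul]
  have hψM : ∀ x, |testψ u h β t d x| ≤ (2 * L) ^ β := fun x => by
    by_cases hx : x ∈ ball (0 : Eu n) t
    · refine (testψ_abs u h hβ t d x).trans ?_
      exact Real.rpow_le_rpow (abs_nonneg _) (hwM x (ball_subset_ball (by linarith) hx)) (by linarith)
    · rw [hψ0 x hx, abs_zero]; positivity
  obtain ⟨hint, hid⟩ := shift_identity hΩ hu hum hB hp hγ hγ2 htail hweak (t := t) (t' := t + d/4)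
    (h := h) (by linarith) (by linarith) (by linarith) (by linarith) hψm (by positivity) hψL hψM hψ0
  have hFm := measurable_formF hum hψm h p γ
  have hAm := (measurable_badA hum h p β γ (4/d)).ennreal_ofReal
  have hHm := (measurable_farH hum h p β γ).ennreal_ofReal
  have hGm := (measurable_goodR hum h p β γ).ennreal_ofReal
  have hcomp := comp_integral (F := formF u (testψ u h β t d) h p γ) hint hFm
    (fun z => energy_pointwise u h (γ := γ) (t := t) hp hβ hd z)
  rw [lintegral_QT _ _ hAm hHm] at hcomp
  have hS : MeasurableSet (ball (0 : Eu n) (t - d/4) ×ˢ ball (0 : Eu n) (t - d/4)) :=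
    measurableSet_ball.prod measurableSet_ball
  rw [lintegral_indicator hS, setLIntegral_prod _ hGm.aemeasurable] at hcomp
  have hb := bad_integral (γ := γ) (K := 4/d) (t' := t + d/4) (r := ρ + d) (h := h) hΩ hu hum hB hp hβ hh
    (by positivity) (by linarith) hρ
  have hf := nonloc_total (γ := γ) (t := t) (t' := t + d/4) (r := ρ + d) (r' := ρ + 3/4*d) (h := h)
    hΩ hu hum hB hp1 hβ (by linarith) hh (by linarith) (by linarith) hρ (by linarith) (by linarith)
    (by linarith) c
  have i1 := f_term (f := f) (k := h) hΩ hu hum hB hp1 hβ hd hh (t := t) (r := ρ + d) (by linarith) hρ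
    (by linarith)
  have i2 := f_term (f := f) (k := 0) hΩ hu hum hB hp1 hβ hd hh (t := t) (r := ρ + d) (by linarith) hρ
    (by simp; linarith)
  simp only [add_zero] at i2
  have hid' : ENNReal.ofReal |∫ z, formF u (testψ u h β t d) h p γ z ∂(volume.prod volume)| ≤
      ENNReal.ofReal |∫ x, f (x + h) * testψ u h β t d x| +
      ENNReal.ofReal |∫ x, f x * testψ u h β t d x| := by
    rw [← ENNReal.ofReal_add (abs_nonneg _) (abs_nonneg _)]
    apply ENNReal.ofReal_le_ofReal
    have : ∫ z, formF u (testψ u h β t d) h p γ z ∂(volume.prod volume) = _ := hid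
    rw [this]
    exact abs_sub _ _
  rw [et]
  unfold cEn
  have hdp : 1 ≤ d ^ (-(γ + 1)) :=
    Real.one_le_rpow_of_pos_of_le_one_of_nonpos hd hd1 (by linarith)
  refine energy_alg (hcomp.trans (add_le_add hid' le_rfl)) i1 i2 hb hf ?_ ?_ ?_
  · apply ENNReal.ofReal_le_ofReal
    exact le_mul_of_one_le_left (by positivity) hdp
  · have : (4 : ℝ≥0∞) = ENNReal.ofReal 4 := by simp
    rw [this, ← ENNReal.ofReal_mul (by norm_num)]
    apply ENNReal.ofReal_le_ofReal
    rw [← mul_assoc]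
    gcongr
    rw [div_eq_mul_inv]
    gcongr
    rw [← Real.rpow_neg_one]
    exact Real.rpow_le_rpow_of_exponent_ge hd hd1 (by linarith)
  · have e4 : 4 / (t + d/4 - t) = 16 * d⁻¹ := by
      rw [add_sub_cancel_left, div_div_eq_mul_div, div_eq_mul_inv]; norm_num
    rw [e4, ← ENNReal.ofReal_mul (by positivity), ← ENNReal.ofReal_mul (by positivity)]
    apply ENNReal.ofReal_le_ofReal
    rw [← mul_assoc]
    gcongr ?_ * ‖h‖ ^ β
    rw [mul_assoc]
    gcongr ?_ * ?_
    rw [Real.mul_rpow (by norm_num) (by positivity)]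
    gcongr
    rw [Real.inv_rpow hd.le, ← Real.rpow_neg hd.le]
    exact Real.rpow_le_rpow_of_exponent_ge hd hd1 (by linarith)

theorem en_add_rpow (a b : ℝ≥0∞) {q : ℝ} (hq : 1 ≤ q) : (a + b) ^ q ≤ 2 ^ q * (a ^ q + b ^ q) := by
  refine (ENNReal.rpow_add_le_mul_rpow_add_rpow a b hq).trans ?_
  refine mul_le_mul' ?_ le_rfl
  exact ENNReal.rpow_le_rpow_of_exponent_le (by norm_num) (by linarith)

theorem ofReal_rpow_mul (t : ℝ) {p q : ℝ} (hq : 0 ≤ q) :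
    ENNReal.ofReal (|t| ^ p) ^ q = ENNReal.ofReal (|t| ^ (p * q)) := by
  rw [ENNReal.ofReal_rpow_of_nonneg (by positivity) hq, Real.rpow_mul (abs_nonneg _)]

theorem ofReal_tri (a b c : ℝ) {p : ℝ} (hp : 0 ≤ p) :
    ENNReal.ofReal (|a - c| ^ p) ≤
      ENNReal.ofReal (2 ^ p) * (ENNReal.ofReal (|b - a| ^ p) + ENNReal.ofReal (|b - c| ^ p)) := by
  rw [← ENNReal.ofReal_add (by positivity) (by positivity), ← ENNReal.ofReal_mul (by positivity)]
  apply ENNReal.ofReal_le_ofReal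
  refine le_trans ?_ (add_rpow_le_two (abs_nonneg _) (abs_nonneg _) hp)
  apply Real.rpow_le_rpow (abs_nonneg _) _ hp
  rw [abs_sub_comm b a]
  exact abs_sub_le a b c

theorem vol_ball_scale {n : ℕ} {l : ℝ} (hl : 0 < l) :
    volume (ball (0 : Eu n) l) = ENNReal.ofReal (l ^ (n:ℝ)) * volume (ball (0 : Eu n) 1) := by
  rw [Measure.addHaar_ball_of_pos _ _ hl]
  simp

theorem interp_pt {n : ℕ} {u : Eu n → ℝ} (hum : Measurable u) {p q : ℝ} (hp : 1 ≤ p) (hq : 1 ≤ q)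
    {t l : ℝ} (htl : t + l ≤ 2) (c : ℝ) {x : Eu n} (hx : x ∈ ball (0 : Eu n) t) :
    volume (ball (0 : Eu n) l) ^ q * ENNReal.ofReal (|u x - c| ^ (p * q)) ≤
      ENNReal.ofReal (2 ^ p) ^ q * 2 ^ q * (volume (ball (0 : Eu n) l) ^ (q - 1) *
        (∫⁻ z in ball (0 : Eu n) l, ENNReal.ofReal (|u (x + z) - u x| ^ (p * q))) +
       (∫⁻ y in ball (0 : Eu n) 2, ENNReal.ofReal (|u y - c| ^ p)) ^ q) := by
  have hq0 : 0 ≤ q := by linarith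
  have hm1 : Measurable fun z => ENNReal.ofReal (|u (x + z) - u x| ^ p) := by fun_prop
  have h1 : volume (ball (0 : Eu n) l) * ENNReal.ofReal (|u x - c| ^ p) ≤
      ENNReal.ofReal (2 ^ p) * ((∫⁻ z in ball (0 : Eu n) l, ENNReal.ofReal (|u (x + z) - u x| ^ p)) +
        ∫⁻ y in ball (0 : Eu n) 2, ENNReal.ofReal (|u y - c| ^ p)) := by
    have : ∫⁻ z in ball (0 : Eu n) l, ENNReal.ofReal (|u (z + x) - c| ^ p) ≤
        ∫⁻ y in ball (0 : Eu n) 2, ENNReal.ofReal (|u y - c| ^ p) := by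
      apply shift_le _ (fun y => ENNReal.ofReal (|u y - c| ^ p))
      rw [mem_ball_zero_iff] at hx; linarith
    calc volume (ball (0 : Eu n) l) * ENNReal.ofReal (|u x - c| ^ p) =
        ∫⁻ z in ball (0 : Eu n) l, ENNReal.ofReal (|u x - c| ^ p) := by
          rw [setLIntegral_const, mul_comm]
      _ ≤ ∫⁻ z in ball (0 : Eu n) l, ENNReal.ofReal (2 ^ p) *
          (ENNReal.ofReal (|u (x + z) - u x| ^ p) + ENNReal.ofReal (|u (z + x) - c| ^ p)) := by
          apply lintegral_mono
          intro z
          have := ofReal_tri (u x) (u (x + z)) c (p := p) (by linarith)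
          beta_reduce; rw [add_comm z x]
          exact this
      _ = ENNReal.ofReal (2 ^ p) * ((∫⁻ z in ball (0 : Eu n) l, ENNReal.ofReal (|u (x + z) - u x| ^ p)) +
          ∫⁻ z in ball (0 : Eu n) l, ENNReal.ofReal (|u (z + x) - c| ^ p)) := by
          rw [lintegral_const_mul' _ _ (by simp), lintegral_add_left hm1]
      _ ≤ _ := mul_le_mul' le_rfl (add_le_add le_rfl this)
  have h2 := ENNReal.rpow_le_rpow h1 hq0
  rw [ENNReal.mul_rpow_of_nonneg _ _ hq0, ENNReal.mul_rpow_of_nonneg _ _ hq0, ofReal_rpow_mul _ hq0] at h2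
  refine h2.trans ?_
  rw [mul_assoc]
  refine mul_le_mul' le_rfl ((en_add_rpow _ _ hq).trans (mul_le_mul' le_rfl (add_le_add ?_ le_rfl)))
  have h3 := jensen_lintegral (volume.restrict (ball (0 : Eu n) l)) hq hm1.aemeasurable
  simp only [ofReal_rpow_mul _ hq0, Measure.restrict_apply_univ] at h3
  exact h3

theorem interp_alg {V K X I G A : ℝ≥0∞} {r : ℝ} (hr : 1 ≤ r) (hV0 : V ≠ 0) (hVt : V ≠ ⊤)
    (h : V ^ r * X ≤ K * (V ^ (r - 1) * (V * G) + A * I)) :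
    X ≤ K * (G + V ^ (-r) * A * I) := by
  have h0 : V ^ r ≠ 0 := by simp [ENNReal.rpow_eq_zero_iff, hV0, hVt]
  have ht : V ^ r ≠ ⊤ := ENNReal.rpow_ne_top_of_nonneg (by linarith) hVt
  have e : V ^ (r - 1) * V = V ^ r := by
    nth_rewrite 2 [← ENNReal.rpow_one V]
    rw [← ENNReal.rpow_add _ _ hV0 hVt]; simp
  have e2 : V ^ r * V ^ (-r) = 1 := by
    rw [← ENNReal.rpow_add _ _ hV0 hVt]; simp
  rw [← ENNReal.mul_le_mul_iff_right h0 ht]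
  refine h.trans (le_of_eq ?_)
  calc K * (V ^ (r - 1) * (V * G) + A * I) = K * ((V ^ (r - 1) * V) * G + 1 * (A * I)) := by ring
    _ = _ := by rw [e, ← e2]; ring

theorem interp {n : ℕ} {u : Eu n → ℝ} {Ω : Set (Eu n)} (hΩ : IsOpen Ω)
    (hu : ContDiffOn ℝ 1 u Ω) (hum : Measurable u) (hB : closedBall 0 2 ⊆ Ω)
    {p q : ℝ} (hp : 1 ≤ p) (hq : 1 ≤ q)
    {t l r : ℝ} (hl : 0 < l) (htl : t + l ≤ r) (hr : r ≤ 2) (c : ℝ) :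
    ∫⁻ x in ball (0 : Eu n) t, ENNReal.ofReal (|u x - c| ^ (p * q)) ≤
      ENNReal.ofReal (2 ^ p) ^ q * 2 ^ q * (
        ENNReal.ofReal (l ^ (p * q)) * (∫⁻ x in ball (0 : Eu n) r, gP u (p * q) x) +
        volume (ball (0 : Eu n) l) ^ (-q) * volume (ball (0 : Eu n) 2) *
       (∫⁻ y in ball (0 : Eu n) 2, ENNReal.ofReal (|u y - c| ^ p)) ^ q) := by
  have hq0 : 0 ≤ q := by linarith
  have hP : 1 ≤ p * q := by nlinarith
  set V := volume (ball (0 : Eu n) l) with hV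
  have hV0 : V ≠ 0 := ball_vol_pos _ hl
  have hVt : V ≠ ⊤ := ball_vol_fin _ _
  refine interp_alg hq hV0 hVt ?_
  set I := (∫⁻ y in ball (0 : Eu n) 2, ENNReal.ofReal (|u y - c| ^ p)) ^ q with hI
  have hcon : V ^ q ≠ ⊤ := ENNReal.rpow_ne_top_of_nonneg hq0 hVt
  have hcon1 : V ^ (q-1) ≠ ⊤ := ENNReal.rpow_ne_top_of_nonneg (by linarith) hVt
  have hcon2 : ENNReal.ofReal (2 ^ p) ^ q * 2 ^ q ≠ ⊤ :=
    ENNReal.mul_ne_top (ENNReal.rpow_ne_top_of_nonneg hq0 (by simp))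
      (ENNReal.rpow_ne_top_of_nonneg hq0 (by simp))
  have hDm : Measurable fun z : Eu n × Eu n => ENNReal.ofReal (|u (z.1 + z.2) - u z.1| ^ (p * q)) := by
    fun_prop
  rw [← lintegral_const_mul' _ _ hcon]
  calc ∫⁻ x in ball (0 : Eu n) t, V ^ q * ENNReal.ofReal (|u x - c| ^ (p * q)) ≤
      ∫⁻ x in ball (0 : Eu n) t, ENNReal.ofReal (2 ^ p) ^ q * 2 ^ q * (V ^ (q - 1) *
        (∫⁻ z in ball (0 : Eu n) l, ENNReal.ofReal (|u (x + z) - u x| ^ (p * q))) + I) :=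
        setLIntegral_mono' measurableSet_ball
          (fun x hx => interp_pt hum hp hq (t := t) (by linarith) c hx)
    _ = ENNReal.ofReal (2 ^ p) ^ q * 2 ^ q * (V ^ (q - 1) *
        (∫⁻ x in ball (0 : Eu n) t, ∫⁻ z in ball (0 : Eu n) l,
          ENNReal.ofReal (|u (x + z) - u x| ^ (p * q))) + I * volume (ball (0 : Eu n) t)) := by
        rw [lintegral_const_mul' _ _ hcon2, lintegral_add_right _ measurable_const,
          lintegral_const_mul' _ _ hcon1, setLIntegral_const]
    _ ≤ _ := by
        refine mul_le_mul' le_rfl (add_le_add (mul_le_mul' le_rfl ?_) ?_)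
        · rw [lintegral_lintegral_swap hDm.aemeasurable]
          calc _ ≤ ∫⁻ z in ball (0 : Eu n) l, ENNReal.ofReal (l ^ (p * q)) *
                (∫⁻ x in ball (0 : Eu n) r, gP u (p * q) x) := by
                apply setLIntegral_mono' measurableSet_ball
                intro z hz
                rw [mem_ball_zero_iff] at hz
                refine (dlt_int hΩ hu hB hP (t := t) (r := r) (h := z) (by linarith) hr).trans ?_
                refine mul_le_mul' (ENNReal.ofReal_le_ofReal ?_) le_rfl
                exact Real.rpow_le_rpow (norm_nonneg _) hz.le (by linarith)
            _ = _ := by rw [setLIntegral_const, mul_comm]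
        · rw [mul_comm]
          refine mul_le_mul' (measure_mono (ball_subset_ball (by linarith))) le_rfl

/-- truncated power of the difference -/
def kW {n : ℕ} (w : Eu n → ℝ) (P η : ℝ) (z : Eu n × Eu n) : ℝ≥0∞ :=
  (ball (0 : Eu n) (2 * η)).indicator (fun _ => ENNReal.ofReal (|w z.1 - w z.2| ^ P)) (z.2 - z.1)

theorem kW_eq {n : ℕ} (w : Eu n → ℝ) (P η : ℝ) (z : Eu n × Eu n) : kW w P η z =
    ENNReal.ofReal (|w z.1 - w z.2| ^ P) * (ball (0 : Eu n) (2 * η)).indicator 1 (z.2 - z.1) := by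
  unfold kW
  by_cases h : z.2 - z.1 ∈ ball (0 : Eu n) (2 * η)
  · simp only [indicator_of_mem h, Pi.one_apply, mul_one]
  · simp only [indicator_of_notMem h, mul_zero]

theorem kW_of_lt {n : ℕ} (w : Eu n → ℝ) (P η : ℝ) {x z : Eu n} (h : ‖z - x‖ < 2 * η) :
    kW w P η (x, z) = ENNReal.ofReal (|w x - w z| ^ P) := by
  unfold kW
  rw [indicator_of_mem]
  simpa using h

theorem measurable_kW {n : ℕ} {w : Eu n → ℝ} (hw : Measurable w) (P η : ℝ) : Measurable (kW w P η) := by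
  have : kW w P η = fun z => ENNReal.ofReal (|w z.1 - w z.2| ^ P) *
    (ball (0 : Eu n) (2 * η)).indicator 1 (z.2 - z.1) := funext (kW_eq w P η)
  rw [this]
  have h1 : Measurable ((ball (0 : Eu n) (2 * η)).indicator (1 : Eu n → ℝ≥0∞)) :=
    measurable_one.indicator measurableSet_ball
  have h2 : Measurable fun z : Eu n × Eu n => z.2 - z.1 := by fun_prop
  have h3 : Measurable fun z : Eu n × Eu n => ENNReal.ofReal (|w z.1 - w z.2| ^ P) := by fun_prop
  exact h3.mul (h1.comp h2)

theorem sd_avg {n : ℕ} {w : Eu n → ℝ} (hw : Measurable w) {P ρ t : ℝ} (hP : 0 ≤ P) {h : Eu n}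
    (hρ : ρ + ‖h‖ ≤ t) :
    volume (ball (0 : Eu n) ‖h‖) * ∫⁻ x in ball (0 : Eu n) ρ, ENNReal.ofReal (|w (x + h) - w x| ^ P) ≤
      ENNReal.ofReal (2 ^ P) * (2 * ∫⁻ x in ball (0 : Eu n) t, ∫⁻ z in ball (0 : Eu n) t,
        kW w P ‖h‖ (x, z)) := by
  have hkm := measurable_kW hw P ‖h‖
  have hkx : ∀ x, Measurable fun z => kW w P ‖h‖ (x, z) := fun x => hkm.comp measurable_prodMk_left
  have hi : Measurable fun x => ∫⁻ z in ball (0 : Eu n) t, kW w P ‖h‖ (x, z) :=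
    hkm.lintegral_prod_right'
  have hpt : ∀ x ∈ ball (0 : Eu n) ρ,
      volume (ball (0 : Eu n) ‖h‖) * ENNReal.ofReal (|w (x + h) - w x| ^ P) ≤
      ENNReal.ofReal (2 ^ P) * ((∫⁻ z in ball (0 : Eu n) t, kW w P ‖h‖ (x + h, z)) +
        ∫⁻ z in ball (0 : Eu n) t, kW w P ‖h‖ (x, z)) := by
    intro x hx
    rw [mem_ball_zero_iff] at hx
    rw [← lintegral_add_left (hkx _), ← lintegral_const_mul' _ _ (by simp)]
    calc volume (ball (0 : Eu n) ‖h‖) * ENNReal.ofReal (|w (x + h) - w x| ^ P) =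
        ∫⁻ z in ball (0 : Eu n) ‖h‖, ENNReal.ofReal (|w (x + h) - w x| ^ P) := by
          rw [setLIntegral_const, mul_comm]
      _ ≤ ∫⁻ k in ball (0 : Eu n) ‖h‖, ENNReal.ofReal (2 ^ P) *
          (kW w P ‖h‖ (x + h, k + x) + kW w P ‖h‖ (x, k + x)) := by
          apply setLIntegral_mono' measurableSet_ball
          intro k hk
          rw [mem_ball_zero_iff] at hk
          have h1 : ‖(k + x) - (x + h)‖ < 2 * ‖h‖ := by
            have : (k + x) - (x + h) = k - h := by abel
            rw [this]
            have := norm_sub_le k h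
            linarith
          have h2 : ‖(k + x) - x‖ < 2 * ‖h‖ := by
            rw [add_sub_cancel_right]
            have := norm_nonneg h
            linarith
          rw [kW_of_lt _ _ _ h1, kW_of_lt _ _ _ h2, abs_sub_comm (w (x + h)) (w (k + x)),
            abs_sub_comm (w x) (w (k + x))]
          exact ofReal_tri (w (x + h)) (w (k + x)) (w x) hP
      _ ≤ _ := by
          apply shift_le (by linarith) (fun z => ENNReal.ofReal (2 ^ P) *
            (kW w P ‖h‖ (x + h, z) + kW w P ‖h‖ (x, z)))
  rw [← lintegral_const_mul' _ _ (ball_vol_fin _ _)]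
  calc _ ≤ ∫⁻ x in ball (0 : Eu n) ρ, ENNReal.ofReal (2 ^ P) *
        ((∫⁻ z in ball (0 : Eu n) t, kW w P ‖h‖ (x + h, z)) +
        ∫⁻ z in ball (0 : Eu n) t, kW w P ‖h‖ (x, z)) := setLIntegral_mono' measurableSet_ball hpt
    _ = ENNReal.ofReal (2 ^ P) * ((∫⁻ x in ball (0 : Eu n) ρ, ∫⁻ z in ball (0 : Eu n) t, kW w P ‖h‖ (x + h, z)) +
        ∫⁻ x in ball (0 : Eu n) ρ, ∫⁻ z in ball (0 : Eu n) t, kW w P ‖h‖ (x, z)) := by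
        rw [lintegral_const_mul' _ _ (by simp), lintegral_add_right _ hi]
    _ ≤ _ := by
        rw [two_mul]
        refine mul_le_mul' le_rfl (add_le_add ?_ ?_)
        · exact shift_le hρ (fun x => ∫⁻ z in ball (0 : Eu n) t, kW w P ‖h‖ (x, z))
        · exact lintegral_mono_set (ball_subset_ball (by have := norm_nonneg h; linarith))

theorem pairs_kW {n : ℕ} {u : Eu n → ℝ} {Ω : Set (Eu n)} (hΩ : IsOpen Ω)
    (hu : ContDiffOn ℝ 1 u Ω) (hum : Measurable u) {t : ℝ} (ht : t ≤ 2) (hB : ball 0 t ⊆ Ω)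
    {P η : ℝ} (hP : 1 ≤ P) :
    ∫⁻ x in ball (0 : Eu n) t, ∫⁻ z in ball (0 : Eu n) t, kW u P η (x, z) ≤
      ENNReal.ofReal ((2 * η) ^ P) * volume (ball (0 : Eu n) (2 * η)) *
        ∫⁻ x in ball (0 : Eu n) t, gP u P x := by
  simp only [kW_eq]
  refine (pairs_integral hΩ hu hum hB measurableSet_ball (convex_ball _ _) (ball_subset_ball ht) hP
    (measurable_one.indicator measurableSet_ball)).trans ?_
  refine mul_le_mul' ?_ le_rfl
  calc _ ≤ ∫⁻ k : Eu n, (ball (0 : Eu n) (2 * η)).indicator 1 k * ENNReal.ofReal (‖k‖ ^ P) :=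
        setLIntegral_le_lintegral _ _
    _ ≤ ∫⁻ k : Eu n, (ball (0 : Eu n) (2 * η)).indicator (fun _ => ENNReal.ofReal ((2 * η) ^ P)) k := by
        apply lintegral_mono
        intro k
        by_cases hk : k ∈ ball (0 : Eu n) (2 * η)
        · simp only [indicator_of_mem hk, Pi.one_apply, one_mul]
          apply ENNReal.ofReal_le_ofReal
          rw [mem_ball_zero_iff] at hk
          exact Real.rpow_le_rpow (norm_nonneg _) hk.le (by linarith)
        · simp only [indicator_of_notMem hk, zero_mul, le_refl]
    _ = _ := by
        rw [lintegral_indicator measurableSet_ball, setLIntegral_const]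

theorem kW_pointwise {n : ℕ} (u : Eu n → ℝ) (h : Eu n) {p β γ C τ l η : ℝ} (hp : 1 < p) (hβ : 1 ≤ β)
    (hγ : 0 < γ) (hC : 0 < C) (hl : 1 ≤ l)
    (H : ∀ l a b s t : ℝ, 1 ≤ l → a - b = s - t →
      |a - b| ^ (p + β - 1) ≤ C * l * ((Jp p a - Jp p b) * (Jp (β + 1) s - Jp (β + 1) t))
        + l ^ (-τ) * (|a| + |b|) ^ (p + β - 1)) (z : Eu n × Eu n) :
    kW (fun x => u (x + h) - u x) (p - 1 + β) η z ≤
      ENNReal.ofReal (C * l * (2 * η) ^ γ) * ENNReal.ofReal (goodR u h p β γ z) +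
      ENNReal.ofReal (l ^ (-τ) * 2 ^ (p - 1 + β)) * (kW (fun x => u (x + h)) (p - 1 + β) η z +
        kW u (p - 1 + β) η z) := by
  obtain ⟨x, y⟩ := z
  by_cases hz : ‖y - x‖ < 2 * η
  swap
  · have : kW (fun x => u (x + h) - u x) (p - 1 + β) η (x, y) = 0 := by
      unfold kW; rw [indicator_of_notMem]; simpa using hz
    rw [this]; exact zero_le
  rw [kW_of_lt _ _ _ hz, kW_of_lt _ _ _ hz, kW_of_lt _ _ _ hz]
  have hη : 0 < 2 * η := (norm_nonneg _).trans_lt hz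
  have hl0 : 0 < l := by linarith
  have hPn : 0 ≤ p - 1 + β := by linarith
  have hg := good_pos u h hp hβ x y
  rw [← ENNReal.ofReal_add (by positivity) (by positivity), ← ENNReal.ofReal_mul (by positivity),
    ← ENNReal.ofReal_mul (by positivity)]
  have hg2 : 0 ≤ goodR u h p β γ (x, y) := div_nonneg hg (by positivity)
  rw [← ENNReal.ofReal_add (by positivity) (by positivity)]
  apply ENNReal.ofReal_le_ofReal
  have key := H l (u (x + h) - u (y + h)) (u x - u y) (u (x + h) - u x) (u (y + h) - u y) hl (by ring)
  have e1 : u (x + h) - u x - (u (y + h) - u y) = u (x + h) - u (y + h) - (u x - u y) := by ring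
  have e2 : p - 1 + β = p + β - 1 := by ring
  rw [e1, e2]
  refine key.trans (add_le_add ?_ ?_)
  · rw [mul_assoc (C * l)]
    refine mul_le_mul_of_nonneg_left ?_ (by positivity)
    by_cases hxy : x = y
    · subst hxy; simp [goodR]
    have hd : 0 < dist x y := dist_pos.2 hxy
    unfold goodR
    simp only
    rw [mul_div_assoc', le_div_iff₀ (by positivity), mul_comm]
    refine mul_le_mul_of_nonneg_right ?_ hg
    apply Real.rpow_le_rpow hd.le _ hγ.le
    rw [dist_comm, dist_eq_norm]; exact hz.le
  · rw [mul_assoc]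
    refine mul_le_mul_of_nonneg_left ?_ (by positivity)
    exact add_rpow_le_two (abs_nonneg _) (abs_nonneg _) (by linarith)

theorem sd_kW {n : ℕ} {u : Eu n → ℝ} {Ω : Set (Eu n)} (hΩ : IsOpen Ω)
    (hu : ContDiffOn ℝ 1 u Ω) (hum : Measurable u) (hB : closedBall 0 2 ⊆ Ω)
    {p β γ C τ l : ℝ} (hp : 1 < p) (hβ : 1 ≤ β)
    (hγ : 0 < γ) (hC : 0 < C) (hl : 1 ≤ l)
    (H : ∀ l a b s t : ℝ, 1 ≤ l → a - b = s - t →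
      |a - b| ^ (p + β - 1) ≤ C * l * ((Jp p a - Jp p b) * (Jp (β + 1) s - Jp (β + 1) t))
        + l ^ (-τ) * (|a| + |b|) ^ (p + β - 1)) {h : Eu n} {t r : ℝ} (htr : t + ‖h‖ ≤ r) (hr : r ≤ 2) :
    ∫⁻ x in ball (0 : Eu n) t, ∫⁻ z in ball (0 : Eu n) t,
      kW (fun x => u (x + h) - u x) (p - 1 + β) ‖h‖ (x, z) ≤
      ENNReal.ofReal (C * l * (2 * ‖h‖) ^ γ) * (∫⁻ x in ball (0 : Eu n) t, ∫⁻ z in ball (0 : Eu n) t,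
        ENNReal.ofReal (goodR u h p β γ (x, z))) +
      ENNReal.ofReal (l ^ (-τ) * 2 ^ (p - 1 + β)) * (2 * (ENNReal.ofReal ((2 * ‖h‖) ^ (p - 1 + β)) *
        volume (ball (0 : Eu n) (2 * ‖h‖)) * ∫⁻ x in ball (0 : Eu n) r, gP u (p - 1 + β) x)) := by
  have hh0 := norm_nonneg h
  have hP : 1 ≤ p - 1 + β := by linarith
  have humh : Measurable fun x => u (x + h) := by fun_prop
  have hG := (measurable_goodR hum h p β γ).ennreal_ofReal
  have hk1 := measurable_kW humh (p - 1 + β) ‖h‖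
  have hk2 := measurable_kW hum (p - 1 + β) ‖h‖
  have a2 : ∫⁻ x in ball (0 : Eu n) t, ∫⁻ z in ball (0 : Eu n) t, kW u (p - 1 + β) ‖h‖ (x, z) ≤
      ENNReal.ofReal ((2 * ‖h‖) ^ (p - 1 + β)) *
        volume (ball (0 : Eu n) (2 * ‖h‖)) * ∫⁻ x in ball (0 : Eu n) r, gP u (p - 1 + β) x := by
    refine (pairs_kW hΩ hu hum (by linarith) (fun x hx => hB (ball_subset_closedBall
      (ball_subset_ball (by linarith) hx))) hP).trans ?_
    exact mul_le_mul' le_rfl (lintegral_mono_set (ball_subset_ball (by linarith)))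
  have a1 : ∫⁻ x in ball (0 : Eu n) t, ∫⁻ z in ball (0 : Eu n) t,
        kW (fun x => u (x + h)) (p - 1 + β) ‖h‖ (x, z) ≤
      ENNReal.ofReal ((2 * ‖h‖) ^ (p - 1 + β)) *
        volume (ball (0 : Eu n) (2 * ‖h‖)) * ∫⁻ x in ball (0 : Eu n) r, gP u (p - 1 + β) x := by
    refine (pairs_kW (hΩ.preimage (by fun_prop)) (shift_C1 hu h) humh (by linarith) (fun x hx => ?_) hP).trans ?_
    · exact hB (ball_subset_closedBall (ball_subset_ball hr (shift_mem htr hx)))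
    · simp only [shift_gP]
      exact mul_le_mul' le_rfl (shift_le htr (gP u (p - 1 + β)))
  calc _ ≤ ∫⁻ x in ball (0 : Eu n) t, ∫⁻ z in ball (0 : Eu n) t,
        (ENNReal.ofReal (C * l * (2 * ‖h‖) ^ γ) * ENNReal.ofReal (goodR u h p β γ (x, z)) +
        ENNReal.ofReal (l ^ (-τ) * 2 ^ (p - 1 + β)) * (kW (fun x => u (x + h)) (p - 1 + β) ‖h‖ (x, z) +
        kW u (p - 1 + β) ‖h‖ (x, z))) := by
        apply lintegral_mono; intro x
        apply lintegral_mono; intro z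
        exact kW_pointwise u h hp hβ hγ hC hl H (x, z)
    _ = ENNReal.ofReal (C * l * (2 * ‖h‖) ^ γ) * (∫⁻ x in ball (0 : Eu n) t, ∫⁻ z in ball (0 : Eu n) t,
        ENNReal.ofReal (goodR u h p β γ (x, z))) +
        ENNReal.ofReal (l ^ (-τ) * 2 ^ (p - 1 + β)) *
          ((∫⁻ x in ball (0 : Eu n) t, ∫⁻ z in ball (0 : Eu n) t,
            kW (fun x => u (x + h)) (p - 1 + β) ‖h‖ (x, z)) +
          ∫⁻ x in ball (0 : Eu n) t, ∫⁻ z in ball (0 : Eu n) t, kW u (p - 1 + β) ‖h‖ (x, z)) := by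
        have m1 : ∀ x, Measurable fun z => ENNReal.ofReal (C * l * (2 * ‖h‖) ^ γ) *
            ENNReal.ofReal (goodR u h p β γ (x, z)) := fun x =>
          (hG.comp measurable_prodMk_left).const_mul _
        have m2 : ∀ x, Measurable fun z => kW (fun x => u (x + h)) (p - 1 + β) ‖h‖ (x, z) := fun x =>
          hk1.comp measurable_prodMk_left
        have m3 : Measurable fun x => ∫⁻ z in ball (0 : Eu n) t,
            ENNReal.ofReal (goodR u h p β γ (x, z)) := hG.lintegral_prod_right'
        have m4 : Measurable fun x => ∫⁻ z in ball (0 : Eu n) t,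
            kW (fun x => u (x + h)) (p - 1 + β) ‖h‖ (x, z) := hk1.lintegral_prod_right'
        simp_rw [lintegral_add_left (m1 _), lintegral_const_mul' _ _ ENNReal.ofReal_ne_top,
          lintegral_add_left (m2 _)]
        rw [lintegral_add_left (m3.const_mul _), lintegral_const_mul' _ _ ENNReal.ofReal_ne_top,
          lintegral_const_mul' _ _ ENNReal.ofReal_ne_top, lintegral_add_left m4]
    _ ≤ _ := by
        exact add_le_add le_rfl (mul_le_mul' le_rfl ((add_le_add a1 a2).trans_eq (two_mul _).symm))

theorem sd_alg {V V1 V2 X K A B D G Q Good c e c1 c2 c3 N m : ℝ≥0∞} (hV0 : V ≠ 0) (hVt : V ≠ ⊤)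
    (h10 : V1 ≠ 0) (h1t : V1 ≠ ⊤)
    (h : V * X ≤ K * (2 * (A * Good + B * (2 * (D * V2 * G)))))
    (hg : Good ≤ c * e * Q) (hG : G ≤ Q) (hA : A * e ≤ c1 * N * m) (hN : V = N * V1)
    (hB : B * D ≤ c2 * m) (h2 : V2 = c3 * V) :
    X ≤ K * 2 * (c * c1 * V1⁻¹ + 2 * c2 * c3) * m * Q := by
  rw [← ENNReal.mul_le_mul_iff_right hV0 hVt]
  have e1 : N = V * V1⁻¹ := by rw [hN, mul_assoc, ENNReal.mul_inv_cancel h10 h1t, mul_one]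
  calc V * X ≤ K * (2 * (A * (c * e * Q) + B * (2 * (D * V2 * Q)))) := by
        refine h.trans ?_; gcongr
    _ = K * 2 * ((A * e) * (c * Q) + (B * D) * (2 * V2 * Q)) := by ring
    _ ≤ K * 2 * ((c1 * N * m) * (c * Q) + (c2 * m) * (2 * V2 * Q)) := by gcongr
    _ = _ := by rw [h2, e1]; ring

theorem secdiff (n : ℕ) {p β γ : ℝ} (hp : 1 < p) (hβ : 1 ≤ β) (hγ : (n:ℝ) + p - 1 < γ)
    (hγ2 : γ < n + p) :
    ∃ (C : ℝ≥0∞) (ε : ℝ), C ≠ ⊤ ∧ 0 < ε ∧ ∀ (u f : Eu n → ℝ) (Ω : Set (Eu n)), IsOpen Ω →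
      ContDiffOn ℝ 1 u Ω → Measurable u → closedBall 0 2 ⊆ Ω →
      tailI γ (p - 1) u < ⊤ → WeakId p γ u f → ∀ (c ρ d : ℝ) (h : Eu n), 0 < d → d ≤ 1 → ρ + d ≤ 2 →
      h ≠ 0 → ‖h‖ ≤ d / 16 →
      ∫⁻ x in ball (0 : Eu n) ρ, ENNReal.ofReal (|(u (x + h + h) - u (x + h)) - (u (x + h) - u x)| ^ (p - 1 + β)) ≤
      C * ENNReal.ofReal (d ^ (-(γ + 1)) * ‖h‖ ^ (p - 1 + β + ε)) *
      ((∫⁻ x in ball (0 : Eu n) (ρ + d), gP u (p - 1 + β) x) +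
       (∫⁻ x in ball (0 : Eu n) (ρ + 3/4*d), ENNReal.ofReal (|u x - c| ^ (p - 1 + β))) +
       tailI γ (p - 1) (fun y => u y - c) ^ ((p - 1 + β) / (p - 1)) +
       ∫⁻ x in ball (0 : Eu n) 2, ENNReal.ofReal (|f x| ^ ((p - 1 + β) / (p - 1)))) := by
  have hn : (0:ℝ) ≤ n := Nat.cast_nonneg n
  obtain ⟨C, τ, hC, hτ, H⟩ := Jp_key hp hβ
  set ε0 := γ - n - p + 1 with hε0
  have hepos : 0 < ε0 := by rw [hε0]; linarith
  have hγn : (n:ℝ) < γ := by linarith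
  refine ⟨ENNReal.ofReal (2 ^ (p - 1 + β)) * 2 * (cEn n p β γ * ENNReal.ofReal (C * 2 ^ γ) *
    (volume (ball (0 : Eu n) 1))⁻¹ + 2 * ENNReal.ofReal (4 ^ (p - 1 + β)) * ENNReal.ofReal (2 ^ (n:ℝ))),
    min (ε0/2) (τ * ε0 / 2), ?_, by positivity, ?_⟩
  · have h1 := (cEn_fin hp hβ hγn hγ2).ne
    have h2 : (volume (ball (0 : Eu n) 1))⁻¹ ≠ ⊤ := ENNReal.inv_ne_top.2 (ball_vol_pos _ one_pos)
    refine ENNReal.mul_ne_top (ENNReal.mul_ne_top (by simp) (by simp)) (ENNReal.add_ne_top.2 ⟨?_, ?_⟩)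
    · exact ENNReal.mul_ne_top (ENNReal.mul_ne_top h1 (by simp)) h2
    · exact ENNReal.mul_ne_top (ENNReal.mul_ne_top (by simp) (by simp)) (by simp)
  intro u f Ω hΩ hu hum hB htail hweak c ρ d h hd hd1 hρ hh hhd
  set ε := min (ε0/2) (τ * ε0 / 2) with hε
  have hη : 0 < ‖h‖ := norm_pos_iff.2 hh
  have hη1 : ‖h‖ ≤ 1 := by linarith
  set η := ‖h‖ with hηd
  have hl : 1 ≤ η ^ (-(ε0/2)) := Real.one_le_rpow_of_pos_of_le_one_of_nonpos hη hη1 (by linarith)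
  have en := energy hΩ hu hum hB hp hβ hγn hγ2 htail hweak c hd hd1 hρ hh hhd
  have s1 := sd_avg (w := fun x => u (x + h) - u x) (by fun_prop) (P := p - 1 + β) (ρ := ρ)
    (t := ρ + d/4) (by linarith) (h := h) (by linarith)
  have s2 := sd_kW hΩ hu hum hB hp hβ (by linarith : 0 < γ) hC hl H (h := h) (t := ρ + d/4) (r := ρ + d)
    (by linarith) hρ
  have hdp : 1 ≤ d ^ (-(γ + 1)) :=
    Real.one_le_rpow_of_pos_of_le_one_of_nonpos hd hd1 (by linarith)
  refine sd_alg (ball_vol_pos _ hη) (ball_vol_fin _ _) (ball_vol_pos (0 : Eu n) one_pos) (ball_vol_fin _ _)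
    (s1.trans (mul_le_mul' le_rfl (mul_le_mul' le_rfl s2))) en
    (le_add_right (le_add_right (le_add_right le_rfl))) (N := ENNReal.ofReal (η ^ (n:ℝ))) ?_
    (vol_ball_scale hη) ?_ ?_
  · rw [← ENNReal.ofReal_mul (by positivity), ← ENNReal.ofReal_mul (by positivity),
      ← ENNReal.ofReal_mul (by positivity)]
    apply ENNReal.ofReal_le_ofReal
    rw [Real.mul_rpow (by norm_num) hη.le]
    calc _ = C * 2 ^ γ * d ^ (-(γ+1)) * (η ^ (-(ε0/2)) * η ^ γ * η ^ β) := by ring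
      _ = C * 2 ^ γ * d ^ (-(γ+1)) * η ^ (-(ε0/2) + γ + β) := by
          rw [Real.rpow_add hη, Real.rpow_add hη]
      _ ≤ C * 2 ^ γ * d ^ (-(γ+1)) * η ^ ((n:ℝ) + (p - 1 + β + ε)) := by
          refine mul_le_mul_of_nonneg_left ?_ (by positivity)
          apply Real.rpow_le_rpow_of_exponent_ge hη hη1
          have : ε ≤ ε0/2 := min_le_left _ _
          linarith
      _ = _ := by rw [Real.rpow_add hη]; ring
  · rw [← ENNReal.ofReal_mul (by positivity), ← ENNReal.ofReal_mul (by positivity)]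
    apply ENNReal.ofReal_le_ofReal
    rw [Real.mul_rpow (by norm_num) hη.le, ← Real.rpow_mul hη.le]
    have e4 : (4:ℝ) ^ (p - 1 + β) = 2 ^ (p - 1 + β) * 2 ^ (p - 1 + β) := by
      rw [← Real.mul_rpow (by norm_num) (by norm_num)]; norm_num
    calc _ = 4 ^ (p - 1 + β) * (1 * (η ^ (-(ε0/2) * -τ) * η ^ (p - 1 + β))) := by rw [e4]; ring
      _ = 4 ^ (p - 1 + β) * (1 * η ^ (-(ε0/2) * -τ + (p - 1 + β))) := by
        rw [Real.rpow_add hη _ (p - 1 + β)]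
      _ ≤ _ := by
        refine mul_le_mul_of_nonneg_left (mul_le_mul hdp ?_ (by positivity) (by positivity)) (by positivity)
        · apply Real.rpow_le_rpow_of_exponent_ge hη hη1
          have : ε ≤ τ * ε0/2 := min_le_right _ _
          linarith
  · rw [Measure.addHaar_ball_mul_of_pos _ _ (by norm_num)]
    simp [hηd]

theorem eLp_eq {n : ℕ} (w : Eu n → ℝ) {P : ℝ} (hP : 0 < P) (μ : Measure (Eu n)) :
    ∫⁻ x, ENNReal.ofReal (|w x| ^ P) ∂μ = eLpNorm' w P μ ^ P := by
  unfold eLpNorm'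
  rw [← ENNReal.rpow_mul, one_div, inv_mul_cancel₀ hP.ne', ENNReal.rpow_one]
  simp_rw [ofReal_abs_rpow _ hP.le]

theorem tele_lim {n : ℕ} {u : Eu n → ℝ} {v x : Eu n} (hd : DifferentiableAt ℝ u x) :
    Filter.Tendsto (fun j : ℕ => (2:ℝ) ^ j * (u (x + ((2:ℝ) ^ j)⁻¹ • v) - u x)) Filter.atTop
      (nhds (fderiv ℝ u x v)) := by
  have := hd.hasFDerivAt.lim v (c := fun j : ℕ => (2:ℝ) ^ j) (l := Filter.atTop) (by
    simp only [norm_pow, Real.norm_ofNat]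
    exact tendsto_pow_atTop_atTop_of_one_lt (by norm_num))
  simpa using this

theorem tele {n : ℕ} {u : Eu n → ℝ} (hum : Measurable u) {P σ : ℝ} (hP : 1 ≤ P) (hσ : 0 < σ)
    {μ : Measure (Eu n)} {v : Eu n} (hd : ∀ᵐ x ∂μ, DifferentiableAt ℝ u x) {M : ℝ≥0∞}
    (H : ∀ j : ℕ, eLpNorm' (fun x => (u (x + ((2:ℝ) ^ (j+1))⁻¹ • v + ((2:ℝ) ^ (j+1))⁻¹ • v) -
        u (x + ((2:ℝ) ^ (j+1))⁻¹ • v)) - (u (x + ((2:ℝ) ^ (j+1))⁻¹ • v) - u x)) P μ ≤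
      M * ENNReal.ofReal (((2:ℝ) ^ (j+1))⁻¹ ^ (1 + σ))) :
    eLpNorm' (fun x => fderiv ℝ u x v) P μ ≤ eLpNorm' (fun x => u (x + v) - u x) P μ +
      M * (1 - ENNReal.ofReal (2 ^ (-σ)))⁻¹ := by
  set r := ENNReal.ofReal (2 ^ (-σ)) with hr
  set a : ℕ → Eu n → ℝ := fun j x => (2:ℝ) ^ j * (u (x + ((2:ℝ) ^ j)⁻¹ • v) - u x) with ha
  have ham : ∀ j, Measurable (a j) := fun j => by rw [ha]; fun_prop
  have hstep : ∀ j, eLpNorm' (a (j+1)) P μ ≤ eLpNorm' (a j) P μ + M * r ^ j := by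
    intro j
    set h := ((2:ℝ) ^ (j+1))⁻¹ • v with hh
    have e2 : ((2:ℝ) ^ j)⁻¹ • v = h + h := by
      rw [hh, ← add_smul]; congr 1; rw [pow_succ]; field_simp; norm_num
    set δ : Eu n → ℝ := fun x => (u (x + h + h) - u (x + h)) - (u (x + h) - u x) with hδ
    have hδm : Measurable δ := by rw [hδ]; fun_prop
    have e3 : a (j+1) = a j + (-(2:ℝ) ^ j) • δ := by
      funext x
      simp only [ha, hδ, Pi.add_apply, Pi.smul_apply, smul_eq_mul]
      rw [e2, ← add_assoc, pow_succ]
      rw [pow_succ] at hh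
      rw [← hh]
      ring
    rw [e3]
    refine (eLpNorm'_add_le (ham j).aestronglyMeasurable
      (hδm.const_smul _).aestronglyMeasurable hP).trans (add_le_add le_rfl ?_)
    rw [eLpNorm'_const_smul _ (by linarith)]
    refine (mul_le_mul' le_rfl (H j)).trans ?_
    rw [mul_left_comm]
    refine mul_le_mul' le_rfl ?_
    have e5 : ‖(-(2:ℝ) ^ j)‖ₑ = ENNReal.ofReal (2 ^ j) := by
      rw [Real.enorm_eq_ofReal_abs, abs_neg, abs_of_pos (by positivity)]
    rw [e5, hr, ← ENNReal.ofReal_pow (by positivity), ← ENNReal.ofReal_mul (by positivity)]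
    apply ENNReal.ofReal_le_ofReal
    have h2 : (0:ℝ) < 2 := by norm_num
    rw [← Real.rpow_natCast 2 (j+1), ← Real.rpow_neg h2.le, ← Real.rpow_mul h2.le, ← Real.rpow_natCast,
      ← Real.rpow_natCast, ← Real.rpow_mul h2.le, ← Real.rpow_add h2]
    apply Real.rpow_le_rpow_of_exponent_le (by norm_num)
    push_cast
    nlinarith
  have hind : ∀ j, eLpNorm' (a j) P μ ≤ eLpNorm' (a 0) P μ + M * ∑ i ∈ Finset.range j, r ^ i := by
    intro j
    induction j with
    | zero => simp
    | succ k ih =>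
      refine (hstep k).trans ((add_le_add ih le_rfl).trans_eq ?_)
      rw [Finset.sum_range_succ]; ring
  have ha0 : a 0 = fun x => u (x + v) - u x := by funext x; simp [ha]
  have hb : ∀ j, eLpNorm' (a j) P μ ≤ eLpNorm' (fun x => u (x + v) - u x) P μ + M * (1 - r)⁻¹ := by
    intro j
    refine (hind j).trans ?_
    rw [ha0]
    refine add_le_add le_rfl (mul_le_mul' le_rfl ?_)
    rw [← ENNReal.tsum_geometric]
    exact ENNReal.sum_le_tsum _
  have hF := Lp.eLpNorm'_lim_le_liminf_eLpNorm' (μ := μ) (p := P) (f := a) (by linarith)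
    (fun j => (ham j).aestronglyMeasurable) (f_lim := fun x => fderiv ℝ u x v)
    (hd.mono fun x hx => tele_lim hx)
  refine hF.trans ?_
  refine (Filter.liminf_le_liminf (v := fun _ => eLpNorm' (fun x => u (x + v) - u x) P μ + M * (1 - r)⁻¹)
    (Filter.Eventually.of_forall hb)).trans_eq ?_
  simp

theorem tele_int {n : ℕ} {u : Eu n → ℝ} (hum : Measurable u) {P ε : ℝ} (hP : 1 ≤ P) (hε : 0 < ε)
    {μ : Measure (Eu n)} {v : Eu n} (hd : ∀ᵐ x ∂μ, DifferentiableAt ℝ u x) {A : ℝ≥0∞}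
    (H : ∀ j : ℕ, ∫⁻ x, ENNReal.ofReal (|(u (x + ((2:ℝ) ^ (j+1))⁻¹ • v + ((2:ℝ) ^ (j+1))⁻¹ • v) -
        u (x + ((2:ℝ) ^ (j+1))⁻¹ • v)) - (u (x + ((2:ℝ) ^ (j+1))⁻¹ • v) - u x)| ^ P) ∂μ ≤
      A * ENNReal.ofReal (((2:ℝ) ^ (j+1))⁻¹ ^ (P + ε))) :
    ∫⁻ x, ENNReal.ofReal (|fderiv ℝ u x v| ^ P) ∂μ ≤
      2 ^ P * ((∫⁻ x, ENNReal.ofReal (|u (x + v) - u x| ^ P) ∂μ) +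
        A * (1 - ENNReal.ofReal (2 ^ (-(ε / P))))⁻¹ ^ P) := by
  have hP0 : 0 < P := by linarith
  have key := tele (σ := ε / P) hum hP (by positivity) hd (M := A ^ (1/P)) (fun j => by
    have h1 := H j
    rw [eLp_eq _ hP0] at h1
    have h2 := ENNReal.rpow_le_rpow h1 (by positivity : 0 ≤ 1/P)
    rw [← ENNReal.rpow_mul, mul_one_div_cancel hP0.ne', ENNReal.rpow_one,
      ENNReal.mul_rpow_of_nonneg _ _ (by positivity),
      ENNReal.ofReal_rpow_of_nonneg (by positivity) (by positivity), ← Real.rpow_mul (by positivity)] at h2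
    have e : (P + ε) * (1/P) = 1 + ε / P := by field_simp
    rwa [e] at h2)
  rw [eLp_eq _ hP0, eLp_eq _ hP0]
  refine (ENNReal.rpow_le_rpow key hP0.le).trans ((en_add_rpow _ _ hP).trans_eq ?_)
  rw [ENNReal.mul_rpow_of_nonneg (A ^ (1/P)) _ hP0.le, ← ENNReal.rpow_mul A, one_div_mul_cancel hP0.ne',
    ENNReal.rpow_one]

def Gr {n : ℕ} (u : Eu n → ℝ) (P r : ℝ) : ℝ≥0∞ := ∫⁻ x in ball (0 : Eu n) r, gP u P x

def Iq {n : ℕ} (u : Eu n → ℝ) (p c : ℝ) : ℝ≥0∞ :=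
  ∫⁻ y in ball (0 : Eu n) 2, ENNReal.ofReal (|u y - c| ^ p)

def Dq {n : ℕ} (u f : Eu n → ℝ) (p q γ c : ℝ) : ℝ≥0∞ :=
  Iq u p c ^ q + tailI γ (p - 1) (fun y => u y - c) ^ (p * q / (p - 1)) +
    ∫⁻ x in ball (0 : Eu n) 2, ENNReal.ofReal (|f x| ^ (p * q / (p - 1)))

theorem vol_neg {n : ℕ} {l : ℝ} (hl : 0 < l) (q : ℝ) : volume (ball (0 : Eu n) l) ^ (-q) =
    ENNReal.ofReal (l ^ (-(n * q))) * volume (ball (0 : Eu n) 1) ^ (-q) := by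
  rw [vol_ball_scale hl, ENNReal.mul_rpow_of_ne_top (by simp) (ball_vol_fin _ _),
    ENNReal.ofReal_rpow_of_pos (by positivity), ← Real.rpow_mul hl.le]
  congr 3; ring

def cI (n : ℕ) (p q : ℝ) : ℝ≥0∞ := ENNReal.ofReal (2 ^ p) ^ q * 2 ^ q *
  (1 + volume (ball (0 : Eu n) 1) ^ (-q) * volume (ball (0 : Eu n) 2))

theorem cI_fin {n : ℕ} {p q : ℝ} (hq : 1 ≤ q) : cI n p q ≠ ⊤ := by
  unfold cI
  refine ENNReal.mul_ne_top (ENNReal.mul_ne_top (ENNReal.rpow_ne_top_of_nonneg (by linarith) (by simp))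
      (ENNReal.rpow_ne_top_of_nonneg (by linarith) (by simp)))
      (ENNReal.add_ne_top.2 ⟨by simp, ENNReal.mul_ne_top ?_ (ball_vol_fin _ _)⟩)
  exact ENNReal.rpow_ne_top_of_ne_zero (ball_vol_pos _ one_pos) (ball_vol_fin _ _)

theorem interp2 {n : ℕ} {u : Eu n → ℝ} {Ω : Set (Eu n)} (hΩ : IsOpen Ω)
    (hu : ContDiffOn ℝ 1 u Ω) (hum : Measurable u) (hB : closedBall 0 2 ⊆ Ω)
    {p q : ℝ} (hp : 1 ≤ p) (hq : 1 ≤ q)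
    {t l r : ℝ} (hl : 0 < l) (htl : t + l ≤ r) (hr : r ≤ 2) (c : ℝ) :
    ∫⁻ x in ball (0 : Eu n) t, ENNReal.ofReal (|u x - c| ^ (p * q)) ≤
      cI n p q * (ENNReal.ofReal (l ^ (p * q)) * Gr u (p * q) r +
        ENNReal.ofReal (l ^ (-(n * q))) * Iq u p c ^ q) := by
  refine (interp hΩ hu hum hB hp hq hl htl hr c).trans ?_
  rw [vol_neg hl]
  unfold cI Gr Iq
  rw [mul_assoc (ENNReal.ofReal (2 ^ p) ^ q * 2 ^ q)]
  refine mul_le_mul' le_rfl ?_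
  set a := volume (ball (0 : Eu n) 1) ^ (-q)
  set b := volume (ball (0 : Eu n) 2)
  rw [mul_add]
  refine add_le_add ?_ ?_
  · refine le_mul_of_one_le_left zero_le (le_add_right le_rfl)
  · rw [← mul_assoc]
    refine mul_le_mul' ?_ le_rfl
    calc _ = (a * b) * ENNReal.ofReal (l ^ (-(n * q))) := by ring
      _ ≤ _ := mul_le_mul' (le_add_left le_rfl) le_rfl

theorem U_bound {n : ℕ} {u f : Eu n → ℝ} {Ω : Set (Eu n)} (hΩ : IsOpen Ω)
    (hu : ContDiffOn ℝ 1 u Ω) (hum : Measurable u) (hB : closedBall 0 2 ⊆ Ω)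
    {p q γ : ℝ} (hp : 1 ≤ p) (hq : 1 ≤ q) {ρ d : ℝ} (hd : 0 < d) (hd1 : d ≤ 1) (hρ : ρ + d ≤ 2) (c : ℝ) :
    Gr u (p * q) (ρ + d) +
       (∫⁻ x in ball (0 : Eu n) (ρ + 3/4*d), ENNReal.ofReal (|u x - c| ^ (p * q))) +
       tailI γ (p - 1) (fun y => u y - c) ^ (p * q / (p - 1)) +
       ∫⁻ x in ball (0 : Eu n) 2, ENNReal.ofReal (|f x| ^ (p * q / (p - 1))) ≤
    (1 + cI n p q * ENNReal.ofReal (4 ^ (n * q))) * ENNReal.ofReal (d ^ (-(n * q))) *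
      (Gr u (p * q) (ρ + d) + Dq u f p q γ c) := by
  have hn : (0:ℝ) ≤ n := Nat.cast_nonneg n
  have i1 := interp2 hΩ hu hum hB hp hq (t := ρ + 3/4*d) (l := d/4) (r := ρ + d) (by positivity)
    (by linarith) hρ c
  unfold Dq
  set G := Gr u (p * q) (ρ + d)
  set I := Iq u p c ^ q
  set T := tailI γ (p - 1) (fun y => u y - c) ^ (p * q / (p - 1))
  set F := ∫⁻ x in ball (0 : Eu n) 2, ENNReal.ofReal (|f x| ^ (p * q / (p - 1)))
  set U := ∫⁻ x in ball (0 : Eu n) (ρ + 3/4*d), ENNReal.ofReal (|u x - c| ^ (p * q))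
  have hdp : 1 ≤ d ^ (-(n * q)) :=
    Real.one_le_rpow_of_pos_of_le_one_of_nonpos hd hd1 (by nlinarith)
  have hdp' : 1 ≤ ENNReal.ofReal (d ^ (-(n * q))) := by
    rw [← ENNReal.ofReal_one]; exact ENNReal.ofReal_le_ofReal hdp
  have h4 : (d/4) ^ (-(n * q)) = 4 ^ (n * q) * d ^ (-(n * q)) := by
    rw [Real.div_rpow hd.le (by norm_num), Real.rpow_neg (by norm_num : (0:ℝ) ≤ 4), div_inv_eq_mul, mul_comm]
  have h4' : 1 ≤ (4:ℝ) ^ (n * q) := Real.one_le_rpow (by norm_num) (by nlinarith)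
  have i2 : U ≤ cI n p q * (ENNReal.ofReal (4 ^ (n * q)) * ENNReal.ofReal (d ^ (-(n * q))) * (G + I)) := by
    refine i1.trans (mul_le_mul' le_rfl ?_)
    rw [mul_add, ← ENNReal.ofReal_mul (by positivity), ← h4]
    refine add_le_add (mul_le_mul' (ENNReal.ofReal_le_ofReal ?_) le_rfl) le_rfl
    refine (Real.rpow_le_one (by positivity) (by linarith) (by nlinarith)).trans ?_
    rw [h4]; nlinarith
  set X := ENNReal.ofReal (d ^ (-(n * q)))
  set Y := ENNReal.ofReal ((4:ℝ) ^ (n * q))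
  calc G + U + T + F ≤ (G + (I + T + F)) + U := by
        have : G + U + T + F = (G + (T + F)) + U := by ring
        rw [this]
        refine add_le_add (add_le_add le_rfl ?_) le_rfl
        rw [add_assoc]; exact le_add_left le_rfl
    _ ≤ X * (G + (I + T + F)) + cI n p q * (Y * X * (G + (I + T + F))) := by
        refine add_le_add (le_mul_of_one_le_left zero_le hdp') (i2.trans ?_)
        refine mul_le_mul' le_rfl (mul_le_mul' le_rfl (add_le_add le_rfl ?_))
        rw [add_assoc]; exact le_add_right le_rfl
    _ = _ := by ring

theorem dv_bound {n : ℕ} {u : Eu n → ℝ} (hum : Measurable u) {P ρ : ℝ} (hP : 0 ≤ P) (v : Eu n) (c : ℝ) :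
    ∫⁻ x in ball (0 : Eu n) ρ, ENNReal.ofReal (|u (x + v) - u x| ^ P) ≤
      ENNReal.ofReal (2 ^ P) * (2 * ∫⁻ x in ball (0 : Eu n) (ρ + ‖v‖), ENNReal.ofReal (|u x - c| ^ P)) := by
  calc _ ≤ ∫⁻ x in ball (0 : Eu n) ρ, ENNReal.ofReal (2 ^ P) *
        (ENNReal.ofReal (|u (x + v) - c| ^ P) + ENNReal.ofReal (|u x - c| ^ P)) := by
        apply lintegral_mono; intro x
        have := ofReal_tri (u (x + v)) c (u x) hP
        rwa [abs_sub_comm c, abs_sub_comm c] at this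
    _ = ENNReal.ofReal (2 ^ P) * ((∫⁻ x in ball (0 : Eu n) ρ, ENNReal.ofReal (|u (x + v) - c| ^ P)) +
        ∫⁻ x in ball (0 : Eu n) ρ, ENNReal.ofReal (|u x - c| ^ P)) := by
        rw [lintegral_const_mul' _ _ (by simp), lintegral_add_right _ (by fun_prop)]
    _ ≤ _ := by
        rw [two_mul]
        refine mul_le_mul' le_rfl (add_le_add ?_ ?_)
        · exact shift_le le_rfl (fun x => ENNReal.ofReal (|u x - c| ^ P))
        · exact lintegral_mono_set (ball_subset_ball (by have := norm_nonneg v; linarith))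

theorem fderiv_coord {n : ℕ} (L : Eu n →L[ℝ] ℝ) {P t : ℝ} (hP : 1 ≤ P) (ht : 0 < t) :
    t ^ P * ‖L‖ ^ P ≤ (n:ℝ) ^ (P - 1) * ∑ i : Fin n, |L (t • EuclideanSpace.single i 1)| ^ P := by
  have h1 : ‖L‖ ≤ ∑ i : Fin n, |L (EuclideanSpace.single i 1)| := by
    apply L.opNorm_le_bound (Finset.sum_nonneg fun i _ => abs_nonneg _)
    intro y
    have hy : y = ∑ i : Fin n, y i • EuclideanSpace.single i (1:ℝ) := by
      ext j
      simp [Finset.sum_apply, Pi.single_apply]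
    have e : L y = ∑ i : Fin n, y i * L (EuclideanSpace.single i 1) := by
      conv_lhs => rw [hy]
      simp [map_sum]
    rw [e, Real.norm_eq_abs, Finset.sum_mul]
    refine (Finset.abs_sum_le_sum_abs _ _).trans (Finset.sum_le_sum fun i _ => ?_)
    rw [abs_mul, mul_comm]
    exact mul_le_mul_of_nonneg_left (PiLp.norm_apply_le y i) (abs_nonneg _)
  have h2 := Real.rpow_sum_le_const_mul_sum_rpow Finset.univ
    (fun i : Fin n => L (EuclideanSpace.single i 1)) hP
  rw [Finset.card_univ, Fintype.card_fin] at h2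
  have h3 := (Real.rpow_le_rpow (norm_nonneg _) h1 (by linarith : 0 ≤ P)).trans h2
  have e4 : ∀ i : Fin n, |L (t • EuclideanSpace.single i 1)| ^ P =
      t ^ P * |L (EuclideanSpace.single i 1)| ^ P := fun i => by
    rw [map_smul, smul_eq_mul, abs_mul, abs_of_pos ht, Real.mul_rpow ht.le (abs_nonneg _)]
  simp_rw [e4]
  rw [← Finset.mul_sum, mul_left_comm]
  exact mul_le_mul_of_nonneg_left h3 (by positivity)

theorem dir_alg {X Y A K c2 cI l G I li P2 C e Q c4 dn : ℝ≥0∞} {L : ℝ≥0∞}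
    (h : X ≤ P2 * (Y + A * K)) (hY : Y ≤ c2 * (2 * (cI * (l * G + li * I))))
    (hA : A = C * e * Q) (hQ : Q ≤ c4 * dn * L) :
    X ≤ P2 * (c2 * 2 * cI + C * c4 * K) * (l * G + li * I + e * dn * L) := by
  subst hA
  calc X ≤ P2 * (c2 * (2 * (cI * (l * G + li * I))) + C * e * (c4 * dn * L) * K) := by
        refine h.trans ?_; gcongr
    _ = P2 * ((c2 * 2 * cI) * (l * G + li * I) + (C * c4 * K) * (e * dn * L)) := by ring
    _ ≤ P2 * ((c2 * 2 * cI + C * c4 * K) * (l * G + li * I) +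
        (c2 * 2 * cI + C * c4 * K) * (e * dn * L)) := by
        gcongr
        · exact le_add_right le_rfl
        · exact le_add_left le_rfl
    _ = _ := by ring

theorem dir_step (n : ℕ) {p q γ : ℝ} (hp : 1 < p) (hq : 1 < q) (hγ : (n:ℝ) + p - 1 < γ)
    (hγ2 : γ < n + p) :
    ∃ (C : ℝ≥0∞) (ε : ℝ), C ≠ ⊤ ∧ 0 < ε ∧ ∀ (u f : Eu n → ℝ) (Ω : Set (Eu n)), IsOpen Ω →
      ContDiffOn ℝ 1 u Ω → Measurable u → closedBall 0 2 ⊆ Ω →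
      tailI γ (p - 1) u < ⊤ → WeakId p γ u f → ∀ (c ρ d l : ℝ) (v : Eu n), 0 < d → d ≤ 1 → ρ + d ≤ 2 →
      v ≠ 0 → ‖v‖ ≤ d / 16 → 0 < l → l ≤ d / 16 →
      ∫⁻ x in ball (0 : Eu n) ρ, ENNReal.ofReal (|fderiv ℝ u x v| ^ (p * q)) ≤
      C * (ENNReal.ofReal (l ^ (p * q)) * Gr u (p * q) (ρ + d) +
        ENNReal.ofReal (l ^ (-(n * q))) * Iq u p c ^ q +
        ENNReal.ofReal (d ^ (-(γ + 1)) * ‖v‖ ^ (p * q + ε)) * ENNReal.ofReal (d ^ (-(n * q))) *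
          (Gr u (p * q) (ρ + d) + Dq u f p q γ c)) := by
  have hP : 1 ≤ p * q := by nlinarith
  have eP : p - 1 + (p * q - p + 1) = p * q := by ring
  obtain ⟨C, ε, hC, hε, H⟩ := secdiff n hp (β := p * q - p + 1) (by nlinarith) hγ hγ2
  simp only [eP] at H
  refine ⟨2 ^ (p * q) * (ENNReal.ofReal (2 ^ (p * q)) * 2 * cI n p q +
    C * (1 + cI n p q * ENNReal.ofReal (4 ^ (n * q))) *
      (1 - ENNReal.ofReal (2 ^ (-(ε / (p * q)))))⁻¹ ^ (p * q)), ε, ?_, hε, ?_⟩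
  · have hcI := cI_fin (n := n) (p := p) hq.le
    have h1 : (1 - ENNReal.ofReal (2 ^ (-(ε / (p * q)))))⁻¹ ≠ ⊤ := by
      rw [ENNReal.inv_ne_top, ← pos_iff_ne_zero, tsub_pos_iff_lt, ENNReal.ofReal_lt_one]
      apply Real.rpow_lt_one_of_one_lt_of_neg (by norm_num)
      have : 0 < ε / (p * q) := by positivity
      linarith
    refine ENNReal.mul_ne_top (ENNReal.rpow_ne_top_of_nonneg (by linarith) (by simp))
      (ENNReal.add_ne_top.2 ⟨ENNReal.mul_ne_top (by simp [ENNReal.mul_eq_top]) hcI, ENNReal.mul_ne_top (ENNReal.mul_ne_top hC ?_) ?_⟩)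
    · exact ENNReal.add_ne_top.2 ⟨by simp, ENNReal.mul_ne_top hcI (by simp)⟩
    · exact ENNReal.rpow_ne_top_of_nonneg (by linarith) h1
  intro u f Ω hΩ hu hum hB htail hweak c ρ d l v hd hd1 hρ hv hvd hl hld
  have hη : 0 < ‖v‖ := norm_pos_iff.2 hv
  have hdiff : ∀ᵐ x ∂(volume.restrict (ball (0 : Eu n) ρ)), DifferentiableAt ℝ u x := by
    refine (ae_restrict_mem measurableSet_ball).mono fun x hx => ?_
    have hx2 : x ∈ Ω := hB (ball_subset_closedBall (ball_subset_ball (by linarith) hx))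
    exact (hu.differentiableOn one_ne_zero x hx2).differentiableAt (hΩ.mem_nhds hx2)
  have key := tele_int hum hP hε (v := v) hdiff
    (A := C * ENNReal.ofReal (d ^ (-(γ + 1)) * ‖v‖ ^ (p * q + ε)) *
      ((∫⁻ x in ball (0 : Eu n) (ρ + d), gP u (p * q) x) +
        (∫⁻ x in ball (0 : Eu n) (ρ + 3 / 4 * d), ENNReal.ofReal (|u x - c| ^ (p * q))) +
        tailI γ (p - 1) (fun y => u y - c) ^ (p * q / (p - 1)) +
        ∫⁻ x in ball (0 : Eu n) 2, ENNReal.ofReal (|f x| ^ (p * q / (p - 1))))) (fun j => by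
      have hs : 0 < ((2:ℝ) ^ (j+1))⁻¹ := by positivity
      have hs1 : ((2:ℝ) ^ (j+1))⁻¹ ≤ 1 := inv_le_one_of_one_le₀ (one_le_pow₀ (by norm_num))
      have hnorm : ‖((2:ℝ) ^ (j+1))⁻¹ • v‖ = ((2:ℝ) ^ (j+1))⁻¹ * ‖v‖ := by
        rw [norm_smul, Real.norm_of_nonneg hs.le]
      refine (H u f Ω hΩ hu hum hB htail hweak c ρ d (((2:ℝ) ^ (j+1))⁻¹ • v) hd hd1 hρ
        (smul_ne_zero hs.ne' hv) (by rw [hnorm]; nlinarith)).trans_eq ?_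
      rw [hnorm, Real.mul_rpow hs.le hη.le, mul_left_comm, ENNReal.ofReal_mul (by positivity)]
      ring)
  refine dir_alg key ((dv_bound hum (by linarith) v c).trans (mul_le_mul' le_rfl (mul_le_mul' le_rfl
    (interp2 hΩ hu hum hB hp.le hq.le hl (by linarith : ρ + ‖v‖ + l ≤ ρ + d) hρ c)))) rfl ?_
  exact U_bound hΩ hu hum hB hp.le hq.le hd hd1 hρ c

theorem grad_step (n : ℕ) {p q γ : ℝ} (hp : 1 < p) (hq : 1 < q) (hγ : (n:ℝ) + p - 1 < γ)
    (hγ2 : γ < n + p) :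
    ∃ (C : ℝ≥0∞) (ε : ℝ), C ≠ ⊤ ∧ 0 < ε ∧ ∀ (u f : Eu n → ℝ) (Ω : Set (Eu n)), IsOpen Ω →
      ContDiffOn ℝ 1 u Ω → Measurable u → closedBall 0 2 ⊆ Ω →
      tailI γ (p - 1) u < ⊤ → WeakId p γ u f → ∀ (c ρ d l t : ℝ), 0 < d → d ≤ 1 → ρ + d ≤ 2 →
      0 < t → t ≤ d / 16 → 0 < l → l ≤ d / 16 →
      ENNReal.ofReal (t ^ (p * q)) * Gr u (p * q) ρ ≤
      C * (ENNReal.ofReal (l ^ (p * q)) * Gr u (p * q) (ρ + d) +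
        ENNReal.ofReal (l ^ (-(n * q))) * Iq u p c ^ q +
        ENNReal.ofReal (d ^ (-(γ + 1)) * t ^ (p * q + ε)) * ENNReal.ofReal (d ^ (-(n * q))) *
          (Gr u (p * q) (ρ + d) + Dq u f p q γ c)) := by
  have hP : 1 ≤ p * q := by nlinarith
  obtain ⟨C, ε, hC, hε, H⟩ := dir_step n hp hq hγ hγ2
  refine ⟨ENNReal.ofReal ((n:ℝ) ^ (p * q - 1)) * (n * C), ε,
    ENNReal.mul_ne_top (by simp) (ENNReal.mul_ne_top (by simp) hC), hε, ?_⟩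
  intro u f Ω hΩ hu hum hB htail hweak c ρ d l t hd hd1 hρ ht htd hl hld
  set Z := (ENNReal.ofReal (l ^ (p * q)) * Gr u (p * q) (ρ + d) +
        ENNReal.ofReal (l ^ (-(n * q))) * Iq u p c ^ q +
        ENNReal.ofReal (d ^ (-(γ + 1)) * t ^ (p * q + ε)) * ENNReal.ofReal (d ^ (-(n * q))) *
          (Gr u (p * q) (ρ + d) + Dq u f p q γ c)) with hZ
  have hi : ∀ i : Fin n, ∫⁻ x in ball (0 : Eu n) ρ,
      ENNReal.ofReal (|fderiv ℝ u x (t • EuclideanSpace.single i 1)| ^ (p * q)) ≤ C * Z := by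
    intro i
    have hnorm : ‖(t • EuclideanSpace.single i 1 : Eu n)‖ = t := by
      rw [norm_smul, Real.norm_of_nonneg ht.le]; simp
    have := H u f Ω hΩ hu hum hB htail hweak c ρ d l (t • EuclideanSpace.single i 1) hd hd1 hρ
      (by rw [← norm_ne_zero_iff, hnorm]; exact ht.ne') (by rw [hnorm]; exact htd) hl hld
    rwa [hnorm] at this
  have hm : ∀ i : Fin n, Measurable fun x =>
      ENNReal.ofReal (|fderiv ℝ u x (t • EuclideanSpace.single i 1)| ^ (p * q)) := by
    intro i
    have := measurable_fderiv_apply_const ℝ u (t • EuclideanSpace.single i (1:ℝ))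
    fun_prop
  unfold Gr
  rw [← lintegral_const_mul' _ _ (by simp)]
  calc _ ≤ ∫⁻ x in ball (0 : Eu n) ρ, ENNReal.ofReal ((n:ℝ) ^ (p * q - 1)) *
        ∑ i : Fin n, ENNReal.ofReal (|fderiv ℝ u x (t • EuclideanSpace.single i 1)| ^ (p * q)) := by
        apply lintegral_mono; intro x
        beta_reduce
        unfold gP
        rw [← ENNReal.ofReal_mul (by positivity), ← ENNReal.ofReal_sum_of_nonneg (fun i _ => by positivity),
          ← ENNReal.ofReal_mul (by positivity)]
        exact ENNReal.ofReal_le_ofReal (fderiv_coord _ hP ht)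
    _ = ENNReal.ofReal ((n:ℝ) ^ (p * q - 1)) * ∑ i : Fin n, ∫⁻ x in ball (0 : Eu n) ρ,
          ENNReal.ofReal (|fderiv ℝ u x (t • EuclideanSpace.single i 1)| ^ (p * q)) := by
        rw [lintegral_const_mul' _ _ (by simp), lintegral_finsetSum _ (fun i _ => hm i)]
    _ ≤ ENNReal.ofReal ((n:ℝ) ^ (p * q - 1)) * ∑ i : Fin n, C * Z :=
        mul_le_mul' le_rfl (Finset.sum_le_sum fun i _ => hi i)
    _ = _ := by simp [mul_assoc]

theorem absorb_num {C0 P ε κ a : ℝ} (hC : 0 < C0) (hP : 0 < P) (hε : 0 < ε) (hκ : 0 < κ) (ha : 0 ≤ a) :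
    ∃ N C' : ℝ, 0 < N ∧ 0 < C' ∧ ∀ d : ℝ, 0 < d → d ≤ 1 → ∃ t l : ℝ, 0 < t ∧ t ≤ d / 16 ∧ 0 < l ∧ l ≤ d / 16 ∧
      C0 * l ^ P * t ^ (-P) + C0 * (d ^ (-κ) * t ^ ε) ≤ 2 ^ (-N - 1) ∧
      C0 * l ^ (-a) * t ^ (-P) ≤ C' * d ^ (-N) ∧ C0 * (d ^ (-κ) * t ^ ε) ≤ C' * d ^ (-N) := by
  set m := max (κ / ε) 1 with hm
  have hm1 : 1 ≤ m := le_max_right _ _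
  have hmε : κ ≤ m * ε := by
    have : κ / ε ≤ m := le_max_left _ _
    rwa [div_le_iff₀ hε] at this
  set N := m * (P + a) with hN
  have hN0 : 0 < N := by positivity
  set θ : ℝ := 2 ^ (-N - 1) with hθ
  have hθ0 : 0 < θ := by positivity
  have hθ1 : θ ≤ 1 := Real.rpow_le_one_of_one_le_of_nonpos (by norm_num) (by linarith)
  set c1 := min 1 ((θ / (2 * C0)) ^ (1 / P)) with hc1
  set c2 := min (1/16) ((θ / (2 * C0)) ^ (1 / ε)) with hc2
  have c1p : 0 < c1 := lt_min one_pos (by positivity)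
  have c2p : 0 < c2 := lt_min (by norm_num) (by positivity)
  have h1 : C0 * c1 ^ P ≤ θ / 2 := by
    have : c1 ^ P ≤ θ / (2 * C0) := by
      calc c1 ^ P ≤ ((θ / (2 * C0)) ^ (1 / P)) ^ P := Real.rpow_le_rpow c1p.le (min_le_right _ _) hP.le
        _ = _ := by rw [← Real.rpow_mul (by positivity), one_div_mul_cancel hP.ne', Real.rpow_one]
    calc C0 * c1 ^ P ≤ C0 * (θ / (2 * C0)) := by gcongr
      _ = _ := by field_simp
  have h2 : C0 * c2 ^ ε ≤ θ / 2 := by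
    have : c2 ^ ε ≤ θ / (2 * C0) := by
      calc c2 ^ ε ≤ ((θ / (2 * C0)) ^ (1 / ε)) ^ ε := Real.rpow_le_rpow c2p.le (min_le_right _ _) hε.le
        _ = _ := by rw [← Real.rpow_mul (by positivity), one_div_mul_cancel hε.ne', Real.rpow_one]
    calc C0 * c2 ^ ε ≤ C0 * (θ / (2 * C0)) := by gcongr
      _ = _ := by field_simp
  refine ⟨N, C0 * c1 ^ (-a) * c2 ^ (-(P + a)) + 1, hN0, by positivity, ?_⟩
  intro d hd hd1
  have hdN : 1 ≤ d ^ (-N) := Real.one_le_rpow_of_pos_of_le_one_of_nonpos hd hd1 (by linarith)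
  have hdm : d ^ m ≤ d := by
    calc d ^ m ≤ d ^ (1:ℝ) := Real.rpow_le_rpow_of_exponent_ge hd hd1 hm1
      _ = d := Real.rpow_one d
  have tp : 0 < c2 * d ^ m := by positivity
  have htd : c2 * d ^ m ≤ d / 16 := by
    have : c2 ≤ 1/16 := min_le_left _ _
    calc c2 * d ^ m ≤ 1/16 * d := by gcongr
      _ = _ := by ring
  have h3 : C0 * (d ^ (-κ) * (c2 * d ^ m) ^ ε) ≤ θ / 2 := by
    rw [Real.mul_rpow c2p.le (by positivity), ← Real.rpow_mul hd.le]
    have : d ^ (-κ) * d ^ (m * ε) ≤ 1 := by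
      rw [← Real.rpow_add hd]
      exact Real.rpow_le_one hd.le hd1 (by linarith)
    calc C0 * (d ^ (-κ) * (c2 ^ ε * d ^ (m * ε))) = C0 * c2 ^ ε * (d ^ (-κ) * d ^ (m * ε)) := by ring
      _ ≤ C0 * c2 ^ ε * 1 := by gcongr
      _ ≤ _ := by rw [mul_one]; exact h2
  refine ⟨c2 * d ^ m, c1 * (c2 * d ^ m), tp, htd, by positivity, ?_, ?_, ?_, ?_⟩
  · have : c1 ≤ 1 := min_le_left _ _
    nlinarith
  · have : C0 * (c1 * (c2 * d ^ m)) ^ P * (c2 * d ^ m) ^ (-P) = C0 * c1 ^ P := by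
      rw [Real.mul_rpow c1p.le tp.le, mul_assoc, mul_assoc, ← Real.rpow_add tp]
      simp
    rw [this]; linarith
  · have : C0 * (c1 * (c2 * d ^ m)) ^ (-a) * (c2 * d ^ m) ^ (-P) =
        C0 * c1 ^ (-a) * c2 ^ (-(P + a)) * d ^ (-N) := by
      rw [Real.mul_rpow c1p.le tp.le]
      have : (c2 * d ^ m) ^ (-a) * (c2 * d ^ m) ^ (-P) = c2 ^ (-(P + a)) * d ^ (-N) := by
        rw [← Real.rpow_add tp, Real.mul_rpow c2p.le (by positivity), ← Real.rpow_mul hd.le]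
        congr 2
        · ring
        · rw [hN]; ring
      calc _ = C0 * c1 ^ (-a) * ((c2 * d ^ m) ^ (-a) * (c2 * d ^ m) ^ (-P)) := by ring
        _ = _ := by rw [this]; ring
    rw [this]
    gcongr
    linarith
  · calc _ ≤ θ / 2 := h3
      _ ≤ 1 * 1 := by linarith
      _ ≤ _ := by
        gcongr
        have : 0 < C0 * c1 ^ (-a) * c2 ^ (-(P + a)) := by positivity
        linarith

theorem iter_lem {g : ℝ → ℝ≥0∞} {N C' : ℝ} {D : ℝ≥0∞} (hC' : 0 < C') (hmono : Monotone g)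
    (h2 : g 2 ≠ ⊤)
    (H : ∀ ρ d : ℝ, 0 < d → d ≤ 1 → ρ + d ≤ 2 →
      g ρ ≤ ENNReal.ofReal (2 ^ (-N - 1)) * g (ρ + d) + ENNReal.ofReal (C' * d ^ (-N)) * D)
    (hN : 0 < N) :
    g 1 ≤ ENNReal.ofReal (C' * 2 ^ N * 2) * D := by
  set θ : ℝ := 2 ^ (-N - 1) with hθ
  have hθ0 : 0 < θ := by positivity
  have hθ1 : θ < 1 := Real.rpow_lt_one_of_one_lt_of_neg (by norm_num) (by linarith)
  have hθN : θ * 2 ^ N = 1 / 2 := by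
    rw [hθ, ← Real.rpow_add (by norm_num)]
    rw [show -N - 1 + N = -1 by ring, Real.rpow_neg_one]; norm_num
  have key : ∀ K : ℕ, g 1 ≤ ENNReal.ofReal (θ ^ K) * g (2 - (1/2) ^ K) +
      ENNReal.ofReal (C' * 2 ^ N * (2 - 2 * (1/2) ^ K)) * D := by
    intro K
    induction K with
    | zero => norm_num
    | succ k ih =>
      have hk1 : ((1:ℝ)/2) ^ k ≤ 1 := pow_le_one₀ (by norm_num) (by norm_num)
      have hk0 : 0 < ((1:ℝ)/2) ^ k := by positivity
      have hd := H (2 - (1/2) ^ k) ((1/2) ^ (k+1)) (by positivity)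
        (pow_le_one₀ (by norm_num) (by norm_num)) (by rw [pow_succ]; linarith)
      have e1 : (2:ℝ) - (1/2) ^ k + (1/2) ^ (k+1) = 2 - (1/2) ^ (k+1) := by rw [pow_succ]; ring
      rw [e1] at hd
      have e2 : ((1:ℝ)/2) ^ (k+1) ^ (1:ℕ) = (1/2) ^ (k+1) := by simp
      have e3 : (((1:ℝ)/2) ^ (k+1)) ^ (-N) = (2 ^ N) ^ (k+1) := by
        rw [one_div, inv_pow, Real.inv_rpow (by positivity), Real.rpow_neg (by positivity), inv_inv,
          ← Real.rpow_natCast, ← Real.rpow_natCast, ← Real.rpow_mul (by norm_num),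
          ← Real.rpow_mul (by norm_num), mul_comm]
      have e4 : θ ^ k * (C' * (2 ^ N) ^ (k+1)) = C' * 2 ^ N * (1/2) ^ k := by
        rw [← hθN]; rw [mul_pow, pow_succ]; ring
      calc g 1 ≤ _ := ih
        _ ≤ ENNReal.ofReal (θ ^ k) * (ENNReal.ofReal θ * g (2 - (1/2)^(k+1)) +
            ENNReal.ofReal (C' * (((1:ℝ)/2) ^ (k+1)) ^ (-N)) * D) +
            ENNReal.ofReal (C' * 2 ^ N * (2 - 2 * (1/2) ^ k)) * D :=
            add_le_add (mul_le_mul' le_rfl hd) le_rfl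
        _ = ENNReal.ofReal (θ ^ k) * ENNReal.ofReal θ * g (2 - (1/2)^(k+1)) +
            (ENNReal.ofReal (θ ^ k) * ENNReal.ofReal (C' * (2 ^ N) ^ (k+1)) +
            ENNReal.ofReal (C' * 2 ^ N * (2 - 2 * (1/2) ^ k))) * D := by rw [e3]; ring
        _ = _ := by
          rw [← ENNReal.ofReal_mul (by positivity), ← ENNReal.ofReal_mul (by positivity), e4,
            ← ENNReal.ofReal_add (by positivity)
              (mul_nonneg (by positivity) (by linarith)), ← pow_succ]
          congr 3
          rw [pow_succ (1/2 : ℝ)]; ring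
  have key2 : ∀ K : ℕ, g 1 ≤ ENNReal.ofReal (θ ^ K) * g 2 + ENNReal.ofReal (C' * 2 ^ N * 2) * D := by
    intro K
    refine (key K).trans (add_le_add (mul_le_mul' le_rfl (hmono ?_)) (mul_le_mul' (ENNReal.ofReal_le_ofReal ?_) le_rfl))
    · have : 0 < ((1:ℝ)/2) ^ K := by positivity
      linarith
    · have : 0 < ((1:ℝ)/2) ^ K := by positivity
      gcongr
      linarith
  have lim : Filter.Tendsto (fun K : ℕ => ENNReal.ofReal (θ ^ K) * g 2 + ENNReal.ofReal (C' * 2 ^ N * 2) * D)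
      Filter.atTop (nhds (ENNReal.ofReal 0 * g 2 + ENNReal.ofReal (C' * 2 ^ N * 2) * D)) := by
    refine Filter.Tendsto.add (ENNReal.Tendsto.mul_const ?_ (Or.inr h2)) tendsto_const_nhds
    exact ENNReal.tendsto_ofReal (tendsto_pow_atTop_nhds_zero_of_lt_one hθ0.le hθ1)
  have := ge_of_tendsto' lim key2
  simpa using this

theorem absorb_alg {tP C L G1 G2 X I Y D tm : ℝ≥0∞} {θ K : ℝ≥0∞} (ht : tm * tP = 1)
    (h : tP * G1 ≤ C * (L * G2 + X * I + Y * (G2 + D))) (hID : I ≤ D)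
    (h1 : C * L * tm + C * (Y * tm) ≤ θ) (h2 : C * X * tm ≤ K) (h3 : C * (Y * tm) ≤ K) :
    G1 ≤ θ * G2 + (2 * K) * D := by
  calc G1 = tm * (tP * G1) := by rw [← mul_assoc, ht, one_mul]
    _ ≤ tm * (C * (L * G2 + X * I + Y * (G2 + D))) := by gcongr
    _ = (C * L * tm + C * (Y * tm)) * G2 + (C * X * tm) * I + C * (Y * tm) * D := by ring
    _ ≤ θ * G2 + K * D + K * D := by gcongr
    _ = _ := by ring

theorem Gr_fin {n : ℕ} {u : Eu n → ℝ} {Ω : Set (Eu n)} (hΩ : IsOpen Ω)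
    (hu : ContDiffOn ℝ 1 u Ω) (hB : closedBall 0 2 ⊆ Ω) {P : ℝ} (hP : 0 ≤ P) : Gr u P 2 ≠ ⊤ := by
  have hc : ContinuousOn (fderiv ℝ u) (closedBall 0 2) :=
    (hu.continuousOn_fderiv_of_isOpen hΩ le_rfl).mono hB
  obtain ⟨M, hM⟩ := (isCompact_closedBall (0 : Eu n) 2).exists_bound_of_continuousOn hc
  have : Gr u P 2 ≤ ∫⁻ x in ball (0 : Eu n) 2, ENNReal.ofReal (M ^ P) := by
    unfold Gr gP
    refine setLIntegral_mono measurable_const fun x hx => ENNReal.ofReal_le_ofReal ?_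
    exact Real.rpow_le_rpow (norm_nonneg _) (hM x (ball_subset_closedBall hx)) hP
  refine ne_top_of_le_ne_top ?_ this
  rw [setLIntegral_const]
  exact ENNReal.mul_ne_top (by simp) (ball_vol_fin _ _)

theorem iterated (n : ℕ) {p q γ : ℝ} (hp : 1 < p) (hq : 1 < q) (hγ : (n:ℝ) + p - 1 < γ)
    (hγ2 : γ < n + p) :
    ∃ C : ℝ≥0∞, C ≠ ⊤ ∧ ∀ (u f : Eu n → ℝ) (Ω : Set (Eu n)), IsOpen Ω →
      ContDiffOn ℝ 1 u Ω → Measurable u → closedBall 0 2 ⊆ Ω →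
      tailI γ (p - 1) u < ⊤ → WeakId p γ u f → ∀ c : ℝ, Gr u (p * q) 1 ≤ C * Dq u f p q γ c := by
  obtain ⟨C, ε, hC, hε, H⟩ := grad_step n hp hq hγ hγ2
  have hn0 : (0:ℝ) ≤ n := Nat.cast_nonneg n
  have hP : 0 < p * q := by nlinarith
  obtain ⟨N, C', hN, hC', A⟩ := absorb_num (C0 := C.toReal + 1) (P := p * q) (ε := ε) (κ := γ + 1 + n * q)
    (a := n * q) (by positivity) hP hε (by nlinarith) (by nlinarith)
  refine ⟨ENNReal.ofReal (2 * C' * 2 ^ N * 2), by simp, ?_⟩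
  intro u f Ω hΩ hu hum hB htail hweak c
  refine iter_lem (g := Gr u (p * q)) (by positivity) ?_ (Gr_fin hΩ hu hB hP.le) ?_ hN
  · intro a b hab
    exact lintegral_mono_set (ball_subset_ball hab)
  intro ρ d hd hd1 hρ
  obtain ⟨t, l, ht, htd, hl, hld, h1, h2, h3⟩ := A d hd hd1
  have hCle : C ≤ ENNReal.ofReal (C.toReal + 1) := by
    rw [ENNReal.le_ofReal_iff_toReal_le hC (by positivity)]; linarith
  have hY : ENNReal.ofReal (d ^ (-(γ + 1)) * t ^ (p * q + ε)) * ENNReal.ofReal (d ^ (-(n * q))) *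
      ENNReal.ofReal (t ^ (-(p * q))) = ENNReal.ofReal (d ^ (-(γ + 1 + n * q)) * t ^ ε) := by
    rw [← ENNReal.ofReal_mul (by positivity), ← ENNReal.ofReal_mul (by positivity)]
    congr 1
    have e1 : d ^ (-(γ + 1 + n * q)) = d ^ (-(γ + 1)) * d ^ (-(n * q)) := by
      rw [← Real.rpow_add hd]; congr 1; ring
    have e2 : t ^ ε = t ^ (p * q + ε) * t ^ (-(p * q)) := by
      rw [← Real.rpow_add ht]; congr 1; ring
    rw [e1, e2]; ring
  have := absorb_alg (tm := ENNReal.ofReal (t ^ (-(p * q)))) (θ := ENNReal.ofReal (2 ^ (-N - 1)))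
    (K := ENNReal.ofReal (C' * d ^ (-N))) ?_
    ((H u f Ω hΩ hu hum hB htail hweak c ρ d l t hd hd1 hρ ht htd hl hld).trans
      (mul_le_mul' hCle le_rfl)) (I := Iq u p c ^ q) ?_ ?_ ?_ ?_
  · refine this.trans_eq ?_
    congr 2
    rw [mul_assoc 2, ENNReal.ofReal_mul (p := 2) (by norm_num)]
    simp
  · rw [← ENNReal.ofReal_mul (by positivity), ← Real.rpow_add ht]; simp
  · unfold Dq
    rw [add_assoc]
    exact le_add_right le_rfl
  · rw [hY, ← ENNReal.ofReal_mul (by positivity), ← ENNReal.ofReal_mul (by positivity),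
      ← ENNReal.ofReal_mul (by positivity), ← ENNReal.ofReal_add (by positivity) (by positivity)]
    exact ENNReal.ofReal_le_ofReal h1
  · rw [← ENNReal.ofReal_mul (by positivity), ← ENNReal.ofReal_mul (by positivity)]
    exact ENNReal.ofReal_le_ofReal h2
  · rw [hY, ← ENNReal.ofReal_mul (by positivity)]
    exact ENNReal.ofReal_le_ofReal h3

def TT {n : ℕ} (γ p c : ℝ) (u : Eu n → ℝ) : ℝ≥0∞ :=
  ∫⁻ y in (ball (0 : Eu n) 2)ᶜ, ENNReal.ofReal (|u y - c| ^ (p - 1) / dist y 0 ^ γ)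

theorem tailI_split {n : ℕ} {γ p c : ℝ} (hp : 1 < p) (hγ : 0 ≤ γ) (u : Eu n → ℝ) :
    tailI γ (p - 1) (fun y => u y - c) ≤
      (∫⁻ y in ball (0 : Eu n) 2, ENNReal.ofReal (|u y - c| ^ (p - 1))) + TT γ p c u := by
  unfold tailI TT
  rw [← lintegral_add_compl _ (measurableSet_ball (x := (0 : Eu n)) (ε := 2))]
  refine add_le_add ?_ ?_
  · refine lintegral_mono fun y => ENNReal.ofReal_le_ofReal ?_
    refine mul_le_of_le_one_right (by positivity) ?_
    exact Real.rpow_le_one_of_one_le_of_nonpos (by linarith [norm_nonneg y]) (by linarith)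
  · refine setLIntegral_mono' measurableSet_ball.compl fun y hy => ENNReal.ofReal_le_ofReal ?_
    rw [mem_compl_iff, mem_ball_zero_iff, not_lt] at hy
    rw [dist_zero_right, div_eq_mul_inv, ← Real.rpow_neg (norm_nonneg _)]
    refine mul_le_mul_of_nonneg_left ?_ (by positivity)
    exact Real.rpow_le_rpow_of_nonpos (by linarith) (by linarith) (by linarith)

theorem loc_tail {n : ℕ} {p q c : ℝ} (hp : 1 < p) (hq : 1 < q) {u : Eu n → ℝ} (hum : Measurable u) :
    (∫⁻ y in ball (0 : Eu n) 2, ENNReal.ofReal (|u y - c| ^ (p - 1))) ^ (p * q / (p - 1)) ≤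
      (volume (ball (0 : Eu n) 2) ^ (p / (p - 1) - 1)) ^ q * Iq u p c ^ q := by
  have hp1 : 0 < p - 1 := by linarith
  have hr : 1 ≤ p / (p - 1) := by rw [le_div_iff₀ hp1]; linarith
  have e : p * q / (p - 1) = p / (p - 1) * q := by ring
  rw [e, ENNReal.rpow_mul, ← ENNReal.mul_rpow_of_nonneg _ _ (by linarith)]
  refine ENNReal.rpow_le_rpow ?_ (by linarith)
  refine (jensen_lintegral (volume.restrict (ball (0 : Eu n) 2)) hr
    (by fun_prop : AEMeasurable (fun y => ENNReal.ofReal (|u y - c| ^ (p - 1))) _)).trans_eq ?_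
  unfold Iq
  rw [Measure.restrict_apply_univ]
  congr 2
  ext y
  rw [ofReal_rpow_mul _ (by positivity), mul_div_cancel₀ _ hp1.ne']

theorem core_alg {G C I Tl F A V T2 E Cp r2 : ℝ≥0∞} (h : G ≤ C * (I + Tl + F))
    (h1 : Tl ≤ r2 * (A + T2)) (h2 : A ≤ V * I) (h3 : I ≤ Cp * E) :
    G ≤ C * (1 + r2 + (1 + r2 * V) * Cp) * (E + T2 + F) := by
  calc G ≤ C * (Cp * E + r2 * (V * (Cp * E) + T2) + F) := by
        refine h.trans ?_
        refine mul_le_mul' le_rfl (add_le_add (add_le_add h3 (h1.trans ?_)) le_rfl)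
        refine mul_le_mul' le_rfl (add_le_add (h2.trans ?_) le_rfl)
        exact mul_le_mul' le_rfl h3
    _ = C * (((1 + r2 * V) * Cp) * E + r2 * T2 + 1 * F) := by ring
    _ ≤ C * ((1 + r2 + (1 + r2 * V) * Cp) * E + (1 + r2 + (1 + r2 * V) * Cp) * T2 +
        (1 + r2 + (1 + r2 * V) * Cp) * F) := by
        gcongr
        · exact le_add_left le_rfl
        · exact le_add_right (le_add_left le_rfl)
        · exact le_add_right (le_add_right le_rfl)
    _ = _ := by ring

theorem core (n : ℕ) {p q γ : ℝ} (hp : 1 < p) (hq : 1 < q) (hγ : (n:ℝ) + p - 1 < γ)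
    (hγ2 : γ < n + p) :
    ∃ C : ℝ≥0∞, C ≠ ⊤ ∧ ∀ (u f : Eu n → ℝ) (Ω : Set (Eu n)), IsOpen Ω →
      ContDiffOn ℝ 1 u Ω → Measurable u → closedBall 0 2 ⊆ Ω →
      tailI γ (p - 1) u < ⊤ → WeakId p γ u f →
      Gr u (p * q) 1 ≤ C * (Gr u p 2 ^ q +
        TT γ p (⨍ y in ball (0 : Eu n) 2, u y) u ^ (p * q / (p - 1)) +
        ∫⁻ x in ball (0 : Eu n) 2, ENNReal.ofReal (|f x| ^ (p * q / (p - 1)))) := by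
  obtain ⟨C, hC, H⟩ := iterated n hp hq hγ hγ2
  obtain ⟨Cp, hCp, HP⟩ := poincare n hp.le
  have hp1 : 0 < p - 1 := by linarith
  have hn0 : (0:ℝ) ≤ n := Nat.cast_nonneg n
  have hr : 1 ≤ p * q / (p - 1) := by rw [le_div_iff₀ hp1]; nlinarith
  have hr' : 0 ≤ p / (p - 1) - 1 := by
    rw [sub_nonneg, le_div_iff₀ hp1]; linarith
  refine ⟨C * (1 + 2 ^ (p * q / (p - 1)) + (1 + 2 ^ (p * q / (p - 1)) *
    (volume (ball (0 : Eu n) 2) ^ (p / (p - 1) - 1)) ^ q) * Cp ^ q), ?_, ?_⟩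
  · have h2 : (2:ℝ≥0∞) ^ (p * q / (p - 1)) ≠ ⊤ := ENNReal.rpow_ne_top_of_nonneg (by linarith) (by simp)
    have hV : (volume (ball (0 : Eu n) 2) ^ (p / (p - 1) - 1)) ^ q ≠ ⊤ :=
      ENNReal.rpow_ne_top_of_nonneg (by linarith) (ENNReal.rpow_ne_top_of_nonneg hr' (ball_vol_fin _ _))
    have hC2 : Cp ^ q ≠ ⊤ := ENNReal.rpow_ne_top_of_nonneg (by linarith) hCp
    exact ENNReal.mul_ne_top hC (ENNReal.add_ne_top.2 ⟨ENNReal.add_ne_top.2 ⟨by simp, h2⟩,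
      ENNReal.mul_ne_top (ENNReal.add_ne_top.2 ⟨by simp, ENNReal.mul_ne_top h2 hV⟩) hC2⟩)
  intro u f Ω hΩ hu hum hB htail hweak
  set c := ⨍ y in ball (0 : Eu n) 2, u y with hc
  refine core_alg (H u f Ω hΩ hu hum hB htail hweak c) ?_ (loc_tail hp hq hum (c := c)) ?_
  · exact (ENNReal.rpow_le_rpow (tailI_split hp (by linarith) u) (by linarith)).trans
      (en_add_rpow _ _ hr)
  · rw [← ENNReal.mul_rpow_of_nonneg _ _ (by linarith)]
    exact ENNReal.rpow_le_rpow (HP u Ω hΩ hu hum hB) (by linarith)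

/-- Translation-dilation. -/
def Tm {n : ℕ} (x₀ : Eu n) (R : ℝ) (x : Eu n) : Eu n := x₀ + R • x

theorem Tm_dist {n : ℕ} (x₀ : Eu n) {R : ℝ} (hR : 0 < R) (x y : Eu n) :
    dist (Tm x₀ R x) (Tm x₀ R y) = R * dist x y := by
  unfold Tm
  rw [dist_add_left, dist_smul₀, Real.norm_of_nonneg hR.le]

theorem Tm_mem {n : ℕ} (x₀ : Eu n) {R : ℝ} (hR : 0 < R) (r : ℝ) (x : Eu n) :
    Tm x₀ R x ∈ ball x₀ (r * R) ↔ x ∈ ball 0 r := by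
  have : dist (Tm x₀ R x) x₀ = R * dist x 0 := by
    rw [← Tm_dist x₀ hR]; simp [Tm]
  rw [mem_ball, mem_ball, this, mul_comm r R, mul_lt_mul_iff_right₀ hR]

theorem ind_scale {n : ℕ} {β : Type*} [Zero β] (x₀ : Eu n) {R : ℝ} (hR : 0 < R) (r : ℝ) (g : Eu n → β) (x : Eu n) :
    (ball (0 : Eu n) r).indicator (fun x => g (Tm x₀ R x)) x =
      (ball x₀ (r * R)).indicator (fun x => g x) (Tm x₀ R x) := by
  by_cases hx : x ∈ ball (0 : Eu n) r
  · rw [indicator_of_mem hx, indicator_of_mem ((Tm_mem x₀ hR r x).2 hx)]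
  · rw [indicator_of_notMem hx, indicator_of_notMem (fun h => hx ((Tm_mem x₀ hR r x).1 h))]

theorem lint_scale {n : ℕ} (x₀ : Eu n) {R : ℝ} (hR : 0 < R) (g : Eu n → ℝ≥0∞) :
    ∫⁻ x, g (Tm x₀ R x) = ENNReal.ofReal (R ^ (-(n:ℝ))) * ∫⁻ x, g x := by
  unfold Tm
  have h1 : ∫⁻ x, g (x₀ + R • x) = ∫⁻ z, g (x₀ + z) ∂(Measure.map (R • ·) (volume : Measure (Eu n))) :=
    (lintegral_map_equiv (fun z => g (x₀ + z)) (Homeomorph.smulOfNeZero R hR.ne').toMeasurableEquiv).symm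
  rw [h1, Measure.map_addHaar_smul _ hR.ne', lintegral_smul_measure, lintegral_add_left_eq_self]
  rw [finrank_euclideanSpace_fin, abs_of_nonneg (by positivity), smul_eq_mul, Real.rpow_neg hR.le,
    Real.rpow_natCast]

theorem lint_scale_ball {n : ℕ} (x₀ : Eu n) {R : ℝ} (hR : 0 < R) (r : ℝ) (g : Eu n → ℝ≥0∞) :
    ∫⁻ x in ball (0 : Eu n) r, g (Tm x₀ R x) =
      ENNReal.ofReal (R ^ (-(n:ℝ))) * ∫⁻ x in ball x₀ (r * R), g x := by
  rw [← lintegral_indicator measurableSet_ball, ← lintegral_indicator measurableSet_ball, ← lint_scale x₀ hR]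
  congr 1; ext x
  exact ind_scale x₀ hR r g x

theorem lint_scale_compl {n : ℕ} (x₀ : Eu n) {R : ℝ} (hR : 0 < R) (r : ℝ) (g : Eu n → ℝ≥0∞) :
    ∫⁻ x in (ball (0 : Eu n) r)ᶜ, g (Tm x₀ R x) =
      ENNReal.ofReal (R ^ (-(n:ℝ))) * ∫⁻ x in (ball x₀ (r * R))ᶜ, g x := by
  rw [← lintegral_indicator measurableSet_ball.compl, ← lintegral_indicator measurableSet_ball.compl,
    ← lint_scale x₀ hR]
  congr 1; ext x
  by_cases hx : x ∈ ball (0 : Eu n) r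
  · rw [indicator_of_notMem (not_not.2 hx), indicator_of_notMem (not_not.2 ((Tm_mem x₀ hR r x).2 hx))]
  · rw [indicator_of_mem hx, indicator_of_mem (show Tm x₀ R x ∈ (ball x₀ (r * R))ᶜ from fun h => hx ((Tm_mem x₀ hR r x).1 h))]

theorem int_scale {n : ℕ} (x₀ : Eu n) {R : ℝ} (hR : 0 < R) (g : Eu n → ℝ) :
    ∫ x, g (Tm x₀ R x) = R ^ (-(n:ℝ)) * ∫ x, g x := by
  unfold Tm
  rw [Measure.integral_comp_smul volume (fun z => g (x₀ + z)) R, integral_add_left_eq_self,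
    finrank_euclideanSpace_fin, abs_of_nonneg (by positivity), smul_eq_mul, Real.rpow_neg hR.le,
    Real.rpow_natCast]

theorem vol_scale {n : ℕ} (x₀ : Eu n) {R : ℝ} (hR : 0 < R) {r : ℝ} :
    volume (ball (0 : Eu n) r) = ENNReal.ofReal (R ^ (-(n:ℝ))) * volume (ball x₀ (r * R)) := by
  have := lint_scale_ball x₀ hR r (fun _ => 1)
  simpa using this

theorem avg_scale {n : ℕ} (x₀ : Eu n) {R : ℝ} (hR : 0 < R) (r : ℝ) (u : Eu n → ℝ) :
    ⨍ x in ball (0 : Eu n) r, u (Tm x₀ R x) = ⨍ x in ball x₀ (r * R), u x := by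
  rw [setAverage_eq, setAverage_eq]
  have h1 : ∫ x in ball (0 : Eu n) r, u (Tm x₀ R x) = R ^ (-(n:ℝ)) * ∫ x in ball x₀ (r * R), u x := by
    rw [← integral_indicator measurableSet_ball, ← integral_indicator measurableSet_ball, ← int_scale x₀ hR]
    congr 1; ext x
    exact ind_scale x₀ hR r u x
  rw [h1, measureReal_def, measureReal_def, vol_scale x₀ hR, ENNReal.toReal_mul,
    ENNReal.toReal_ofReal (by positivity), mul_inv, smul_eq_mul, smul_eq_mul]
  have : R ^ (-(n:ℝ)) ≠ 0 := by positivity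
  field_simp

theorem gP_scale {n : ℕ} (x₀ : Eu n) {R : ℝ} (hR : 0 < R) (u : Eu n → ℝ) (P : ℝ) (x : Eu n) :
    gP (fun x => u (Tm x₀ R x)) P x = ENNReal.ofReal (R ^ P) * gP u P (Tm x₀ R x) := by
  unfold gP Tm
  have h := fderiv_comp_smul (𝕜 := ℝ) (f := fun z => u (x₀ + z)) (x := x) R
  rw [h, fderiv_comp_add_left, norm_smul, Real.norm_of_nonneg hR.le, Real.mul_rpow hR.le (norm_nonneg _),
    ENNReal.ofReal_mul (by positivity)]

theorem tail_scale {n : ℕ} (x₀ : Eu n) {R : ℝ} (hR : 0 < R) {γ a : ℝ} (hγ : 0 ≤ γ) {u : Eu n → ℝ}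
    (h : ∫⁻ x, ENNReal.ofReal (|u x| ^ a / (1 + ‖x‖) ^ γ) < ⊤) :
    tailI γ a (fun x => u (Tm x₀ R x)) < ⊤ := by
  set M := 1 + ‖x₀‖ + R with hM
  have hM0 : 0 < M := by positivity
  have : tailI γ a (fun x => u (Tm x₀ R x)) ≤
      ∫⁻ x, (fun z => ENNReal.ofReal (M ^ γ) * ENNReal.ofReal (|u z| ^ a / (1 + ‖z‖) ^ γ)) (Tm x₀ R x) := by
    unfold tailI
    refine lintegral_mono fun x => ?_
    beta_reduce
    rw [← ENNReal.ofReal_mul (by positivity)]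
    refine ENNReal.ofReal_le_ofReal ?_
    have h1 : 1 + ‖Tm x₀ R x‖ ≤ M * (1 + ‖x‖) := by
      have : ‖Tm x₀ R x‖ ≤ ‖x₀‖ + R * ‖x‖ := by
        unfold Tm
        refine (norm_add_le _ _).trans_eq ?_
        rw [norm_smul, Real.norm_of_nonneg hR.le]
      have := norm_nonneg x
      have := norm_nonneg x₀
      rw [hM]; nlinarith [mul_nonneg ‹0 ≤ ‖x‖› ‹0 ≤ ‖x₀‖›]
    have h2 : (1 + ‖x‖) ^ (-γ) ≤ M ^ γ / (1 + ‖Tm x₀ R x‖) ^ γ := by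
      rw [Real.rpow_neg (by positivity), ← one_div, div_le_div_iff₀ (by positivity) (by positivity),
        one_mul, ← Real.mul_rpow hM0.le (by positivity)]
      exact Real.rpow_le_rpow (by positivity) h1 hγ
    calc _ ≤ |u (Tm x₀ R x)| ^ a * (M ^ γ / (1 + ‖Tm x₀ R x‖) ^ γ) := by gcongr
      _ = _ := by ring
  refine this.trans_lt ?_
  rw [lint_scale x₀ hR (fun z => ENNReal.ofReal (M ^ γ) * ENNReal.ofReal (|u z| ^ a / (1 + ‖z‖) ^ γ)),
    lintegral_const_mul' _ _ (by simp)]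
  exact ENNReal.mul_lt_top (by simp) (ENNReal.mul_lt_top (by simp) h)

/-- Finite kernel integral for bounded Lipschitz functions. -/
theorem ker_lip {n : ℕ} {p γ K M : ℝ} (hp : 0 < p) (hγ : (n:ℝ) < γ) (hγ2 : γ < n + p) (hK : 0 ≤ K) (hM : 0 ≤ M) :
    ∫⁻ h : Eu n, ENNReal.ofReal ((min (K * ‖h‖) M) ^ p / ‖h‖ ^ γ) < ⊤ := by
  have h1 := kerLoc n (γ := p - γ + n) (by linarith)
  have h2 := kerFar n hγ
  have hn0 : (0:ℝ) ≤ n := Nat.cast_nonneg n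
  rw [← lintegral_add_compl _ (measurableSet_ball (x := (0 : Eu n)) (ε := 4))]
  refine ENNReal.add_lt_top.2 ⟨?_, ?_⟩
  · calc _ ≤ ∫⁻ k in ball (0 : Eu n) 4, ENNReal.ofReal (K ^ p) * ENNReal.ofReal (‖k‖ ^ (p - γ + n - n)) := by
          refine lintegral_mono fun k => ?_
          beta_reduce
          rw [← ENNReal.ofReal_mul (by positivity)]
          refine ENNReal.ofReal_le_ofReal ?_
          rcases (norm_nonneg k).eq_or_lt with h0 | h0
          · rw [← h0, mul_zero, min_eq_left hM, Real.zero_rpow hp.ne', zero_div]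
            positivity
          · rw [show p - γ + n - n = p - γ by ring, Real.rpow_sub h0, ← mul_div_assoc,
              ← Real.mul_rpow hK h0.le]
            have : min (K * ‖k‖) M ≤ K * ‖k‖ := min_le_left _ _
            have : 0 ≤ min (K * ‖k‖) M := le_min (by positivity) hM
            gcongr
      _ < ⊤ := by
          rw [lintegral_const_mul' _ _ (by simp)]
          exact ENNReal.mul_lt_top (by simp) h1
  · calc _ ≤ ∫⁻ k in (ball (0 : Eu n) 4)ᶜ, ENNReal.ofReal (M ^ p * 2 ^ γ) * ENNReal.ofReal ((1 + ‖k‖) ^ (-γ)) := by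
          refine setLIntegral_mono' measurableSet_ball.compl fun k hk => ?_
          rw [mem_compl_iff, mem_ball_zero_iff, not_lt] at hk
          rw [← ENNReal.ofReal_mul (by positivity)]
          refine ENNReal.ofReal_le_ofReal ?_
          have h0 : 0 < ‖k‖ := by linarith
          have h3 : 0 ≤ min (K * ‖k‖) M := le_min (by positivity) hM
          have h4 : (‖k‖ ^ γ)⁻¹ ≤ 2 ^ γ * (1 + ‖k‖) ^ (-γ) := by
            rw [Real.rpow_neg (by positivity), ← div_eq_mul_inv, ← Real.div_rpow (by norm_num) (by positivity),
              ← Real.inv_rpow h0.le]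
            refine Real.rpow_le_rpow (by positivity) ?_ (by linarith)
            rw [inv_eq_one_div, div_le_div_iff₀ h0 (by positivity)]
            linarith
          rw [div_eq_mul_inv, mul_assoc]
          refine mul_le_mul (Real.rpow_le_rpow h3 (min_le_right _ _) hp.le) h4 (by positivity) (by positivity)
      _ ≤ ∫⁻ k : Eu n, ENNReal.ofReal (M ^ p * 2 ^ γ) * ENNReal.ofReal ((1 + ‖k‖) ^ (-γ)) :=
          setLIntegral_le_lintegral _ _
      _ < ⊤ := by
          rw [lintegral_const_mul' _ _ (by simp)]
          exact ENNReal.mul_lt_top (by simp) h2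

theorem gag_lip {n : ℕ} {p s K M : ℝ} (hp : 1 < p) (hs : 0 < s) (hs2 : s < 1)
    {ψ : Eu n → ℝ} (hL : ∀ x y, |ψ x - ψ y| ≤ K * dist x y) (hK : 0 ≤ K) (hM : ∀ x, |ψ x| ≤ M)
    {x₀ : Eu n} {r : ℝ} (hz : ∀ x ∉ ball x₀ r, ψ x = 0) : gagliardoE n s p univ ψ < ⊤ := by
  have hM0 : 0 ≤ M := (abs_nonneg _).trans (hM 0)
  set k : Eu n → ℝ≥0∞ := fun h => ENNReal.ofReal ((min (K * ‖h‖) (2 * M)) ^ p / ‖h‖ ^ ((n:ℝ) + s * p)) with hk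
  have hkm : Measurable k := by rw [hk]; fun_prop
  have hkf : ∫⁻ h, k h < ⊤ := ker_lip (by linarith) (by nlinarith) (by nlinarith) hK (by linarith)
  unfold gagliardoE
  rw [Measure.restrict_univ]
  have hpt : ∀ x y, ENNReal.ofReal (|ψ x - ψ y| ^ p / dist x y ^ ((n:ℝ) + s * p)) ≤
      (ball x₀ r).indicator 1 x * k (y - x) + (ball x₀ r).indicator 1 y * k (y - x) := by
    intro x y
    have hle : ENNReal.ofReal (|ψ x - ψ y| ^ p / dist x y ^ ((n:ℝ) + s * p)) ≤ k (y - x) := by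
      rw [hk]
      refine ENNReal.ofReal_le_ofReal ?_
      rw [dist_comm, dist_eq_norm]
      have : |ψ x - ψ y| ≤ min (K * ‖y - x‖) (2 * M) := by
        refine le_min ?_ ?_
        · rw [← dist_eq_norm, dist_comm]; exact hL x y
        · have := abs_sub (ψ x) (ψ y); linarith [hM x, hM y]
      gcongr
    by_cases hx : x ∈ ball x₀ r
    · rw [indicator_of_mem hx, Pi.one_apply, one_mul]
      exact hle.trans (le_add_right le_rfl)
    by_cases hy : y ∈ ball x₀ r
    · rw [indicator_of_mem hy, Pi.one_apply, one_mul]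
      exact hle.trans (le_add_left le_rfl)
    rw [hz x hx, hz y hy, sub_zero, abs_zero, Real.zero_rpow (by linarith), zero_div, ENNReal.ofReal_zero]
    exact zero_le
  have hi : Measurable ((ball x₀ r).indicator (1 : Eu n → ℝ≥0∞)) := measurable_one.indicator measurableSet_ball
  calc _ ≤ ∫⁻ x, ∫⁻ y, ((ball x₀ r).indicator 1 x * k (y - x) + (ball x₀ r).indicator 1 y * k (y - x)) :=
        lintegral_mono fun x => lintegral_mono fun y => hpt x y
    _ = (∫⁻ x, ∫⁻ y, (ball x₀ r).indicator 1 x * k (y - x)) +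
        ∫⁻ y, ∫⁻ x, (ball x₀ r).indicator 1 y * k (y - x) := by
        rw [lintegral_lintegral_swap (f := fun y x => (ball x₀ r).indicator 1 y * k (y - x)) (by fun_prop),
          ← lintegral_add_left (by fun_prop)]
        congr 1; ext x
        rw [← lintegral_add_left (by fun_prop)]
    _ = (∫⁻ x, (ball x₀ r).indicator 1 x * ∫⁻ h, k h) + ∫⁻ y, (ball x₀ r).indicator 1 y * ∫⁻ h, k h := by
        congr 1
        · congr 1; ext x
          rw [lintegral_const_mul _ (by fun_prop), lintegral_sub_right_eq_self (fun h => k h)]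
        · congr 1; ext y
          rw [lintegral_const_mul _ (by fun_prop), lintegral_sub_left_eq_self (fun h => k h)]
    _ < ⊤ := by
        rw [lintegral_mul_const _ hi, lintegral_indicator_one measurableSet_ball]
        exact ENNReal.add_lt_top.2 ⟨ENNReal.mul_lt_top (ball_vol_fin _ _).lt_top hkf,
          ENNReal.mul_lt_top (ball_vol_fin _ _).lt_top hkf⟩

theorem weak_scale {n : ℕ} {p s : ℝ} (hp : 1 < p) (hs : 0 < s) (hs2 : s < 1) {Ω : Set (Eu n)}
    {f u : Eu n → ℝ} (hsol : IsLocalWeakSolution n p s Ω f u) (x₀ : Eu n) {R : ℝ} (hR : 0 < R)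
    (hB : closedBall x₀ (2 * R) ⊆ Ω) :
    WeakId p (n + s * p) (fun x => u (Tm x₀ R x)) (fun x => R ^ (s * p) * f (Tm x₀ R x)) := by
  rintro φ ⟨K, hK⟩ ⟨t, ht, hz⟩
  set K' := |K| with hK'
  have hL : ∀ x y, |φ x - φ y| ≤ K' * dist x y := fun x y =>
    (hK x y).trans (mul_le_mul_of_nonneg_right (le_abs_self K) dist_nonneg)
  set ψ : Eu n → ℝ := fun z => φ (R⁻¹ • (z - x₀)) with hψ
  have hψT : ∀ x, ψ (Tm x₀ R x) = φ x := by
    intro x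
    simp [hψ, Tm, smul_smul, inv_mul_cancel₀ hR.ne']
  have hT : ∀ z, Tm x₀ R (R⁻¹ • (z - x₀)) = z := by
    intro z
    simp [Tm, smul_smul, mul_inv_cancel₀ hR.ne']
  have hψz : ∀ z ∉ ball x₀ (2 * R), ψ z = 0 := by
    intro z hzz
    refine hz _ fun h => hzz ?_
    rw [← hT z, Tm_mem x₀ hR]
    exact ball_subset_ball ht.le h
  have hψL : ∀ x y, |ψ x - ψ y| ≤ (K' * R⁻¹) * dist x y := by
    intro x y
    refine (hL _ _).trans_eq ?_
    rw [dist_smul₀, dist_sub_right, Real.norm_of_nonneg (by positivity)]; ring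
  have hφc : Continuous φ := by
    refine (LipschitzWith.of_dist_le_mul (K := K'.toNNReal) fun x y => ?_).continuous
    rw [Real.coe_toNNReal _ (abs_nonneg _), Real.dist_eq]
    exact hL x y
  have hψc : Continuous ψ := by
    rw [hψ]; fun_prop
  obtain ⟨M, hM⟩ : ∃ M, ∀ x, |ψ x| ≤ M := by
    obtain ⟨M, hM⟩ := (isCompact_closedBall x₀ (2 * R)).exists_bound_of_continuousOn hψc.continuousOn
    refine ⟨max M 0, fun x => ?_⟩
    by_cases hx : x ∈ ball x₀ (2 * R)
    · exact (hM x (ball_subset_closedBall hx)).trans (le_max_left _ _)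
    · rw [hψz x hx, abs_zero]; exact le_max_right _ _
  have hM0 : 0 ≤ M := (abs_nonneg _).trans (hM 0)
  have hLp : ∫⁻ x, ENNReal.ofReal (|ψ x| ^ p) < ⊤ := by
    calc _ ≤ ∫⁻ x, (ball x₀ (2 * R)).indicator (fun _ => ENNReal.ofReal (M ^ p)) x := by
          refine lintegral_mono fun x => ?_
          by_cases hx : x ∈ ball x₀ (2 * R)
          · rw [indicator_of_mem hx]
            exact ENNReal.ofReal_le_ofReal (Real.rpow_le_rpow (abs_nonneg _) (hM x) (by linarith))
          · beta_reduce
            rw [indicator_of_notMem hx, hψz x hx, abs_zero, Real.zero_rpow (by linarith), ENNReal.ofReal_zero]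
      _ < ⊤ := by
          rw [lintegral_indicator measurableSet_ball, setLIntegral_const]
          exact ENNReal.mul_lt_top (by simp) (ball_vol_fin _ _).lt_top
  have key := hsol.2.2.2 ψ hψc.measurable ⟨closedBall x₀ (2 * R), isCompact_closedBall _ _, hB,
    Filter.Eventually.of_forall fun x hx => hψz x fun h => hx (ball_subset_closedBall h)⟩ hLp
    (gag_lip hp hs hs2 hψL (by positivity) hM hψz)
  rw [setIntegral_eq_integral_of_forall_compl_eq_zero (fun x hx => by
    rw [hψz x fun h => hx (hB (ball_subset_closedBall h)), mul_zero])] at key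
  set γ : ℝ := n + s * p with hγ
  set H : Eu n → Eu n → ℝ := fun x y => |u x - u y| ^ (p - 2) * (u x - u y) * (ψ x - ψ y) / dist x y ^ γ with hH
  have key' : ∫ x, ∫ y, H x y = ∫ x, f x * ψ x := key
  have e1 : ∀ x y, Jp p (u (Tm x₀ R x) - u (Tm x₀ R y)) * (φ x - φ y) / dist x y ^ γ =
      R ^ γ * H (Tm x₀ R x) (Tm x₀ R y) := by
    intro x y
    simp only [hH, hψT, Tm_dist x₀ hR]
    rw [Real.mul_rpow hR.le dist_nonneg]
    unfold Jp
    have : R ^ γ ≠ 0 := by positivity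
    rw [mul_div_assoc', mul_div_mul_left _ _ this]
  have e2 : ∀ x, ∫ y, H (Tm x₀ R x) (Tm x₀ R y) = R ^ (-(n:ℝ)) * ∫ y, H (Tm x₀ R x) y := fun x =>
    int_scale x₀ hR (fun y => H (Tm x₀ R x) y)
  have e3 : ∀ x, R ^ (s * p) * f (Tm x₀ R x) * φ x = R ^ (s * p) * (fun z => f z * ψ z) (Tm x₀ R x) := by
    intro x
    simp only [hψT]; ring
  simp only [e1, integral_const_mul, e2, e3]
  rw [int_scale x₀ hR (fun x => ∫ y, H x y), int_scale x₀ hR (fun z => f z * ψ z), key']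
  rw [← mul_assoc, ← mul_assoc, ← mul_assoc, ← Real.rpow_add hR, ← Real.rpow_add hR, ← Real.rpow_add hR, hγ]
  congr 2; ring

theorem tail_eq {n : ℕ} {p s : ℝ} (hp : 1 < p) (hs : 0 < s) (x₀ : Eu n) {R : ℝ} (hR : 0 < R) (u : Eu n → ℝ) (c : ℝ) :
    TT (n + s * p) p c (fun x => u (Tm x₀ R x)) ≤
      tailE n s p (fun x => u x - c) x₀ (2 * R) ^ (p - 1) := by
  have hp1 : 0 < p - 1 := by linarith
  unfold TT tailE
  rw [← ENNReal.rpow_mul, one_div_mul_cancel hp1.ne', ENNReal.rpow_one]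
  have e : ∀ y : Eu n, ENNReal.ofReal (|u (Tm x₀ R y) - c| ^ (p - 1) / dist y 0 ^ ((n:ℝ) + s * p)) =
      ENNReal.ofReal (R ^ ((n:ℝ) + s * p)) * (fun z => ENNReal.ofReal (|u z - c| ^ (p - 1) / dist z x₀ ^ ((n:ℝ) + s * p))) (Tm x₀ R y) := by
    intro y
    have : dist (Tm x₀ R y) x₀ = R * dist y 0 := by
      rw [← Tm_dist x₀ hR]; simp [Tm]
    simp only [this]
    rw [← ENNReal.ofReal_mul (by positivity), Real.mul_rpow hR.le dist_nonneg]
    have : R ^ ((n:ℝ) + s * p) ≠ 0 := by positivity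
    rw [mul_div_assoc', mul_div_mul_left _ _ this]
  simp only [e]
  rw [lintegral_const_mul' _ _ (by simp), lint_scale_compl x₀ hR 2
    (fun z => ENNReal.ofReal (|u z - c| ^ (p - 1) / dist z x₀ ^ ((n:ℝ) + s * p))), ← mul_assoc,
    ← ENNReal.ofReal_mul (by positivity), ← Real.rpow_add hR]
  refine mul_le_mul' (ENNReal.ofReal_le_ofReal ?_) le_rfl
  rw [show (n:ℝ) + s * p + -n = s * p by ring]
  exact Real.rpow_le_rpow hR.le (by linarith) (by nlinarith)

theorem final_alg {A1 w G1 C E Tp F w2 AE AF R1 R2 R3 : ℝ≥0∞} {q : ℝ} (hq : 1 < q)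
    (hA : A1 = w * (R1 ^ q * G1)) (hG : G1 ≤ C * (E ^ q + Tp ^ q + F)) (hE : R1 * E = w2 * AE)
    (hF : F = w2 * R2 ^ q * AF) (hR : R1 * R2 = R3) :
    A1 ^ (1 / q) ≤ (w * C) ^ (1 / q) * (1 + w2 + w2 ^ (1 / q)) * AE +
      (w * C) ^ (1 / q) * (1 + w2 + w2 ^ (1 / q)) * R3 * AF ^ (1 / q) +
      (w * C) ^ (1 / q) * (1 + w2 + w2 ^ (1 / q)) * R1 * Tp := by
  have hq0 : 0 < q := by linarith
  have hi : 0 ≤ 1 / q := by positivity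
  have hi1 : 1 / q ≤ 1 := by rw [div_le_one hq0]; exact hq.le
  have pq : ∀ a : ℝ≥0∞, (a ^ q) ^ (1 / q) = a := fun a => by
    rw [← ENNReal.rpow_mul, mul_one_div_cancel hq0.ne', ENNReal.rpow_one]
  set D := (w * C) ^ (1 / q) with hD
  calc A1 ^ (1 / q) ≤ (w * (R1 ^ q * (C * (E ^ q + Tp ^ q + F)))) ^ (1 / q) := by
        rw [hA]; gcongr
    _ = ((w * C) * R1 ^ q * (E ^ q + Tp ^ q + F)) ^ (1 / q) := by congr 1; ring
    _ = D * R1 * (E ^ q + Tp ^ q + F) ^ (1 / q) := by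
        rw [ENNReal.mul_rpow_of_nonneg _ _ hi, ENNReal.mul_rpow_of_nonneg _ _ hi, pq]
    _ ≤ D * R1 * (E + Tp + F ^ (1 / q)) := by
        refine mul_le_mul' le_rfl ?_
        refine (ENNReal.rpow_add_le_add_rpow _ _ hi hi1).trans (add_le_add ?_ le_rfl)
        refine (ENNReal.rpow_add_le_add_rpow _ _ hi hi1).trans_eq ?_
        rw [pq, pq]
    _ = D * (R1 * E) + D * (w2 ^ (1 / q)) * (R1 * R2) * AF ^ (1 / q) + D * 1 * R1 * Tp := by
        rw [hF, ENNReal.mul_rpow_of_nonneg _ _ hi, ENNReal.mul_rpow_of_nonneg _ _ hi, pq]; ring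
    _ = D * w2 * AE + D * (w2 ^ (1 / q)) * R3 * AF ^ (1 / q) + D * 1 * R1 * Tp := by
        rw [hE, hR, mul_assoc D w2]
    _ ≤ _ := by
        gcongr
        · exact le_add_right (le_add_left le_rfl)
        · exact le_add_left le_rfl
        · exact le_add_right (le_add_right le_rfl)

theorem gradient_CZ_estimate (n : ℕ) (p s q : ℝ) (hp : 1 < p)
    (hs₁ : (p - 1) / p < s) (hs₂ : s < 1) (hq : 1 < q) :
    ∃ c : ℝ, 0 < c ∧
      ∀ (Ω : Set (EuclideanSpace ℝ (Fin n))) (u f : EuclideanSpace ℝ (Fin n) → ℝ),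
        IsOpen Ω → Bornology.IsBounded Ω →
        MemLploc n (p * q / (p - 1)) Ω f →
        IsLocalWeakSolution n p s Ω f u →
        ContDiffOn ℝ 1 u Ω →
        ∀ (x₀ : EuclideanSpace ℝ (Fin n)) (R : ℝ), 0 < R →
          closedBall x₀ (2 * R) ⊆ Ω →
          ((volume (ball x₀ R))⁻¹ *
              ∫⁻ x in ball x₀ R, ENNReal.ofReal (‖gradient u x‖ ^ (p * q))) ^ (1 / q) ≤
            ENNReal.ofReal c *
                ((volume (ball x₀ (2 * R)))⁻¹ *
                  ∫⁻ x in ball x₀ (2 * R), ENNReal.ofReal (‖gradient u x‖ ^ p)) +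
              ENNReal.ofReal (c * R ^ (-((1 - s) * p))) *
                ((volume (ball x₀ (2 * R)))⁻¹ *
                  ∫⁻ x in ball x₀ (2 * R),
                    ENNReal.ofReal (|R ^ s * f x| ^ (p * q / (p - 1)))) ^ (1 / q) +
              ENNReal.ofReal (c * R ^ (-p)) *
                tailE n s p (fun x => u x - ⨍ y in ball x₀ (2 * R), u y) x₀ (2 * R) ^ p := by
  have hp0 : 0 < p := by linarith
  have hp1 : 0 < p - 1 := by linarith
  have hq0 : 0 < q := by linarith
  have hsp : p - 1 < s * p := by rwa [div_lt_iff₀ hp0] at hs₁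
  have hs : 0 < s := lt_of_le_of_lt (by positivity) hs₁
  obtain ⟨C, hC, HC⟩ := core n (γ := n + s * p) hp hq (by linarith) (by nlinarith)
  set w := (volume (ball (0 : Eu n) 1))⁻¹ with hw
  set w2 := volume (ball (0 : Eu n) 2) with hw2
  have hw2f : w2 ≠ ⊤ := ball_vol_fin _ _
  have hw20 : w2 ≠ 0 := ball_vol_pos _ (by norm_num)
  have hwf : w ≠ ⊤ := ENNReal.inv_ne_top.2 (ball_vol_pos _ one_pos)
  set CC := (w * C) ^ (1 / q) * (1 + w2 + w2 ^ (1 / q)) with hCC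
  have hi : 0 ≤ 1 / q := by positivity
  have hCCf : CC ≠ ⊤ := ENNReal.mul_ne_top (ENNReal.rpow_ne_top_of_nonneg hi (ENNReal.mul_ne_top hwf hC))
    (ENNReal.add_ne_top.2 ⟨ENNReal.add_ne_top.2 ⟨by simp, hw2f⟩, ENNReal.rpow_ne_top_of_nonneg hi hw2f⟩)
  refine ⟨CC.toReal + 1, by positivity, ?_⟩
  intro Ω u f hΩ _ _ hsol hu x₀ R hR hB
  have hCle : CC ≤ ENNReal.ofReal (CC.toReal + 1) := by
    rw [ENNReal.le_ofReal_iff_toReal_le hCCf (by positivity)]; linarith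
  have hg : ∀ P x, ENNReal.ofReal (‖gradient u x‖ ^ P) = gP u P x := by
    intro P x
    unfold gP gradient
    rw [LinearIsometryEquiv.norm_map]
  simp only [hg]
  set v : Eu n → ℝ := fun x => u (Tm x₀ R x) with hv
  have hTc : ContDiff ℝ 1 (Tm x₀ R) := by
    unfold Tm; fun_prop
  have hTball : ∀ x ∈ closedBall (0 : Eu n) 2, Tm x₀ R x ∈ closedBall x₀ (2 * R) := by
    intro x hx
    have : dist (Tm x₀ R x) x₀ = R * dist x 0 := by
      rw [← Tm_dist x₀ hR]; simp [Tm]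
    rw [mem_closedBall] at hx ⊢
    rw [this]; nlinarith
  have hcore := HC v (fun x => R ^ (s * p) * f (Tm x₀ R x)) (Tm x₀ R ⁻¹' Ω)
    (hΩ.preimage hTc.continuous) (hu.comp hTc.contDiffOn (fun x hx => hx))
    (hsol.1.comp hTc.continuous.measurable) (fun x hx => hB (hTball x hx))
    (tail_scale x₀ hR (by positivity) hsol.2.2.1) (weak_scale hp hs hs₂ hsol x₀ hR hB)
  have hRn : ENNReal.ofReal (R ^ (-(n:ℝ))) ≠ 0 := by
    rw [Ne, ENNReal.ofReal_eq_zero, not_le]; positivity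
  have hRnt : ENNReal.ofReal (R ^ (-(n:ℝ))) ≠ ⊤ := by simp
  -- averages
  have avg : ∀ (r : ℝ), 0 < r → ∀ g : Eu n → ℝ≥0∞, (volume (ball x₀ (r * R)))⁻¹ * ∫⁻ x in ball x₀ (r * R), g x =
      (volume (ball (0 : Eu n) r))⁻¹ * ∫⁻ x in ball (0 : Eu n) r, g (Tm x₀ R x) := by
    intro r hr g
    rw [lint_scale_ball x₀ hR r g, vol_scale x₀ hR, ENNReal.mul_inv (Or.inl hRn) (Or.inl hRnt)]
    calc _ = (ENNReal.ofReal (R ^ (-(n:ℝ))))⁻¹ * ENNReal.ofReal (R ^ (-(n:ℝ))) *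
          ((volume (ball x₀ (r * R)))⁻¹ * ∫⁻ x in ball x₀ (r * R), g x) := by
          rw [ENNReal.inv_mul_cancel hRn hRnt, one_mul]
      _ = _ := by ring
  have hGr : ∀ P r, Gr v P r = ENNReal.ofReal (R ^ P) * ∫⁻ x in ball (0 : Eu n) r, gP u P (Tm x₀ R x) := by
    intro P r
    unfold Gr
    rw [← lintegral_const_mul' _ _ (by simp)]
    congr 1; ext x
    exact gP_scale x₀ hR u P x
  have hR1q : ∀ a, ENNReal.ofReal (R ^ a) ^ q = ENNReal.ofReal (R ^ (a * q)) := by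
    intro a
    rw [ENNReal.ofReal_rpow_of_nonneg (by positivity) hq0.le, ← Real.rpow_mul hR.le]
  have hcanc : ∀ a : ℝ, ENNReal.ofReal (R ^ (-a)) * ENNReal.ofReal (R ^ a) = 1 := by
    intro a
    rw [← ENNReal.ofReal_mul (by positivity), ← Real.rpow_add hR, neg_add_cancel, Real.rpow_zero, ENNReal.ofReal_one]
  set c0 := ⨍ y in ball x₀ (2 * R), u y with hc0
  have hc0' : ⨍ y in ball (0 : Eu n) 2, v y = c0 := avg_scale x₀ hR 2 u
  rw [hc0'] at hcore
  have htail : TT (n + s * p) p c0 v ^ (p * q / (p - 1)) ≤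
      (tailE n s p (fun x => u x - c0) x₀ (2 * R) ^ p) ^ q := by
    refine (ENNReal.rpow_le_rpow (tail_eq hp hs x₀ hR u c0) (by positivity)).trans_eq ?_
    rw [← ENNReal.rpow_mul, ← ENNReal.rpow_mul, mul_div_cancel₀ _ hp1.ne']
  have hfin := final_alg (A1 := (volume (ball x₀ R))⁻¹ * ∫⁻ x in ball x₀ R, gP u (p * q) x)
    (w := w) (G1 := Gr v (p * q) 1) (C := C) (E := Gr v p 2)
    (Tp := tailE n s p (fun x => u x - c0) x₀ (2 * R) ^ p)
    (F := ∫⁻ x in ball (0 : Eu n) 2, ENNReal.ofReal (|R ^ (s * p) * f (Tm x₀ R x)| ^ (p * q / (p - 1))))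
    (w2 := w2) (AE := (volume (ball x₀ (2 * R)))⁻¹ * ∫⁻ x in ball x₀ (2 * R), gP u p x)
    (AF := (volume (ball x₀ (2 * R)))⁻¹ * ∫⁻ x in ball x₀ (2 * R), ENNReal.ofReal (|R ^ s * f x| ^ (p * q / (p - 1))))
    (R1 := ENNReal.ofReal (R ^ (-p))) (R2 := ENNReal.ofReal (R ^ (s * p))) (R3 := ENNReal.ofReal (R ^ (-((1 - s) * p))))
    hq ?_ (hcore.trans (mul_le_mul' le_rfl (add_le_add (add_le_add le_rfl htail) le_rfl))) ?_ ?_ ?_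
  · refine hfin.trans ?_
    rw [← hCC]
    have hm : ∀ a : ℝ, ENNReal.ofReal ((CC.toReal + 1) * R ^ a) = ENNReal.ofReal (CC.toReal + 1) * ENNReal.ofReal (R ^ a) :=
      fun a => ENNReal.ofReal_mul (by positivity)
    rw [hm, hm]
    exact add_le_add (add_le_add (mul_le_mul' hCle le_rfl) (mul_le_mul' (mul_le_mul' hCle le_rfl) le_rfl))
      (mul_le_mul' (mul_le_mul' hCle le_rfl) le_rfl)
  · have h1 := avg 1 one_pos (gP u (p * q))
    rw [one_mul] at h1
    rw [h1, hGr, hR1q, ← mul_assoc (ENNReal.ofReal _), neg_mul, hcanc, one_mul]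
  · rw [avg 2 (by norm_num), hGr, ← mul_assoc, hcanc, one_mul, ← mul_assoc, ENNReal.mul_inv_cancel hw20 hw2f, one_mul]
  · rw [avg 2 (by norm_num), hR1q]
    have e : ∀ x : Eu n, ENNReal.ofReal (|R ^ (s * p) * f (Tm x₀ R x)| ^ (p * q / (p - 1))) =
        ENNReal.ofReal (R ^ (s * p * q)) * ENNReal.ofReal (|R ^ s * f (Tm x₀ R x)| ^ (p * q / (p - 1))) := by
      intro x
      rw [← ENNReal.ofReal_mul (by positivity)]
      congr 1
      have e1 : R ^ (s * p) = R ^ (s * (p - 1)) * R ^ s := by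
        rw [← Real.rpow_add hR]; congr 1; ring
      rw [e1, mul_assoc, abs_mul, Real.mul_rpow (abs_nonneg _) (abs_nonneg _),
        abs_of_pos (by positivity : 0 < R ^ (s * (p - 1))), ← Real.rpow_mul hR.le]
      congr 2
      field_simp
    simp only [e]
    rw [lintegral_const_mul' _ _ (by simp)]
    calc _ = (w2 * w2⁻¹) * (ENNReal.ofReal (R ^ (s * p * q)) * ∫⁻ x in ball (0 : Eu n) 2,
          ENNReal.ofReal (|R ^ s * f (Tm x₀ R x)| ^ (p * q / (p - 1)))) := by
          rw [ENNReal.mul_inv_cancel hw20 hw2f, one_mul]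
      _ = _ := by ring
  · rw [← ENNReal.ofReal_mul (by positivity), ← Real.rpow_add hR]
    congr 2; ring
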